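/- Let n_1,…,n_r ≥ 2 be integers and let ℤ/2 act on ℂP^n × S^{n_1}×⋯×S^{n_r} by the involution acting as complex conjugation on ℂP^n and as the antipodal map on each sphere factor. Then TC_{ℤ/2}(ℂP^n × S^{n_1}×⋯×S^{n_r}) = r + k + 2n + 1, where k is the number of indices i with n_i even. -/

import Mathlib

open Set

namespace Paper

/-- The `ℤ/2`-space `(X, τ)` admits an equivariant motion planning cover of size `k`:
`X × X` is covered by `k` open sets invariant under the diagonal `ℤ/2`-action, each
admitting a continuous `ℤ/2`-equivariant section of the path fibration
`π_X : C(I, X) → X × X`, `γ ↦ (γ 0, γ 1)`. -/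
def HasEqMPCover {X : Type*} [TopologicalSpace X] (τ : X → X) (k : ℕ) : Prop :=
  ∃ U : Fin k → Set (X × X),
    (∀ i, IsOpen (U i)) ∧ (⋃ i, U i) = univ ∧
    (∀ i, Prod.map τ τ '' U i = U i) ∧
    ∀ i, ∃ s : C(U i, C(unitInterval, X)),
      (∀ u : U i, (s u 0, s u 1) = (u : X × X)) ∧
      ∀ (u : U i) (hu : Prod.map τ τ (u : X × X) ∈ U i) (t : unitInterval),
        s ⟨Prod.map τ τ (u : X × X), hu⟩ t = τ (s u t)

/-- The equivariant topological complexity of the `ℤ/2`-space `(X, τ)` (unreduced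
convention), as an extended natural number. -/
noncomputable def eqTC {X : Type*} [TopologicalSpace X] (τ : X → X) : ℕ∞ :=
  sInf {k : ℕ∞ | ∃ m : ℕ, k = m ∧ HasEqMPCover τ m}

/-- The unit sphere `S^n ⊂ ℝ^{n+1}`. -/
abbrev Sph (n : ℕ) : Type :=
  (Metric.sphere (0 : EuclideanSpace ℝ (Fin (n + 1))) 1 : Set (EuclideanSpace ℝ (Fin (n + 1))))

/-- The antipodal involution of the sphere `S^n`. -/
noncomputable def negSph (n : ℕ) : Sph n → Sph n := fun x =>
  ⟨-(x : EuclideanSpace ℝ (Fin (n + 1))), by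
    have hx : ‖(x : EuclideanSpace ℝ (Fin (n + 1)))‖ = 1 :=
      mem_sphere_zero_iff_norm.mp x.2
    simp [mem_sphere_zero_iff_norm, hx]⟩

/-- Complex projective `n`-space: the quotient of the nonzero vectors of `ℂ^{n+1}`
by the scalar action of `ℂ`. -/
def CP (n : ℕ) : Type :=
  Quot (fun v w : {v : Fin (n + 1) → ℂ // v ≠ 0} =>
    ∃ c : ℂ, (w : Fin (n + 1) → ℂ) = c • (v : Fin (n + 1) → ℂ))

noncomputable instance (n : ℕ) : TopologicalSpace (CP n) := by
  unfold CP; infer_instance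

/-- The complex-conjugation involution `[z_0 : ⋯ : z_n] ↦ [z̄_0 : ⋯ : z̄_n]` of `ℂP^n`. -/
noncomputable def cpConj (n : ℕ) : CP n → CP n :=
  Quot.map
    (fun v => ⟨fun i => starRingEnd ℂ ((v : Fin (n + 1) → ℂ) i), by
      intro h0
      apply v.2
      funext i
      have := congrFun h0 i
      simpa using this⟩)
    (by
      rintro v w ⟨c, hc⟩
      refine ⟨starRingEnd ℂ c, ?_⟩
      funext i
      simp [hc, Pi.smul_apply, smul_eq_mul, map_mul])

open scoped Topology

/-- Alexander–Spanier cochains, as functions of infinite vertex sequences; a cochain of degree `p`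
is one that depends on the entries `0, …, p` only. -/
abbrev Cochain (T : Type*) := (ℕ → T) → ℝ

/-- The `i`-th coface map of `ℕ`, omitting the value `i`. -/
def skip (i k : ℕ) : ℕ := if k < i then k else k + 1

/-- The coboundary with values in degree `p`. -/
def coboundary {T : Type*} (p : ℕ) (G : Cochain T) : Cochain T :=
  fun x => ∑ i ∈ Finset.range (p + 1), (-1 : ℝ) ^ i * G (x ∘ skip i)

/-- The cup product of a cochain of degree `p` with another cochain. -/
def cup {T : Type*} (p : ℕ) (F G : Cochain T) : Cochain T :=
  fun x => F x * G (fun k => x (k + p))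

/-- Pullback of cochains along a map. -/
def pull {T Y : Type*} (a : T → Y) (F : Cochain Y) : Cochain T := fun x => F (a ∘ x)

section Algebra

variable {T : Type*}

theorem skip_of_lt {i k : ℕ} (h : k < i) : skip i k = k := if_pos h

theorem skip_of_le {i k : ℕ} (h : i ≤ k) : skip i k = k + 1 := if_neg (not_lt.mpr h)

theorem skip_comp_skip {i j : ℕ} (h : j ≤ i) : skip (i + 1) ∘ skip j = skip j ∘ skip i := by
  funext k
  simp only [skip, Function.comp]
  split_ifs <;> omega

theorem skip_le (i k : ℕ) : skip i k ≤ k + 1 := by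
  unfold skip; split_ifs <;> omega

theorem dependsOn_coboundary {p : ℕ} {G : Cochain T} (hG : DependsOn G (Iio p)) :
    DependsOn (coboundary p G) (Iic p) := by
  intro x y h
  refine Finset.sum_congr rfl fun i _ => ?_
  congr 1
  refine hG fun k hk => h _ ?_
  have := skip_le i k
  simp only [mem_Iio, mem_Iic] at *
  omega

theorem dependsOn_cup {p q : ℕ} {F G : Cochain T} (hF : DependsOn F (Iic p))
    (hG : DependsOn G (Iic q)) : DependsOn (cup p F G) (Iic (p + q)) := by
  intro x y h
  unfold cup
  rw [hF (fun k hk => h k (by simp only [mem_Iic] at *; omega)),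
    hG (y := fun k => y (k + p)) (fun k hk => h (k + p) (by simp only [mem_Iic] at *; omega))]

theorem DependsOn.add' {p : Set ℕ} {F G : Cochain T} (hF : DependsOn F p) (hG : DependsOn G p) :
    DependsOn (F + G) p := fun x y h => by simp [hF h, hG h]

theorem DependsOn.smul' {p : Set ℕ} {F : Cochain T} (c : ℝ) (hF : DependsOn F p) :
    DependsOn (c • F) p := fun x y h => by simp [hF h]

theorem coboundary_add (p : ℕ) (F G : Cochain T) :
    coboundary p (F + G) = coboundary p F + coboundary p G := by
  funext x
  simp [coboundary, mul_add, Finset.sum_add_distrib]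

theorem coboundary_smul (p : ℕ) (c : ℝ) (F : Cochain T) :
    coboundary p (c • F) = c • coboundary p F := by
  funext x
  simp only [coboundary, Pi.smul_apply, smul_eq_mul, Finset.mul_sum]
  exact Finset.sum_congr rfl fun i _ => by ring

theorem coboundary_zero (p : ℕ) : coboundary p (0 : Cochain T) = 0 := by
  funext x
  simp [coboundary]

theorem coboundary_coboundary (p : ℕ) (F : Cochain T) :
    coboundary (p + 1) (coboundary p F) = 0 := by
  funext x
  simp only [coboundary, Finset.mul_sum, Pi.zero_apply]
  rw [← Finset.sum_product', ← Finset.sum_filter_add_sum_filter_not _ (fun a => a.2 < a.1),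
    add_eq_zero_iff_eq_neg, ← Finset.sum_neg_distrib]
  refine Finset.sum_nbij' (fun a => (a.2, a.1 - 1)) (fun a => (a.2 + 1, a.1)) ?_ ?_ ?_ ?_ ?_
  · rintro ⟨i, j⟩ h
    simp only [Finset.mem_filter, Finset.mem_product, Finset.mem_range] at *
    omega
  · rintro ⟨i, j⟩ h
    simp only [Finset.mem_filter, Finset.mem_product, Finset.mem_range] at *
    omega
  · rintro ⟨i, j⟩ h
    simp only [Finset.mem_filter, Finset.mem_product, Finset.mem_range] at h
    exact Prod.ext (by simp only; omega) rfl
  · rintro ⟨i, j⟩ h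
    simp
  · rintro ⟨i, j⟩ h
    simp only [Finset.mem_filter, Finset.mem_product, Finset.mem_range] at *
    obtain ⟨i, rfl⟩ : ∃ i', i = i' + 1 := ⟨i - 1, by omega⟩
    have : (x ∘ skip (i + 1)) ∘ skip j = (x ∘ skip j) ∘ skip i := by
      rw [Function.comp_assoc, skip_comp_skip (by omega), Function.comp_assoc]
    simp only [Nat.add_sub_cancel, this]
    ring

theorem coboundary_cup {p : ℕ} (q : ℕ) {F : Cochain T} (G : Cochain T)
    (hF : DependsOn F (Iic p)) :
    coboundary (p + q + 1) (cup p F G) =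
      cup (p + 1) (coboundary (p + 1) F) G + (-1 : ℝ) ^ p • cup p F (coboundary (q + 1) G) := by
  funext x
  have hF' : ∀ i, p < i → F (x ∘ skip i) = F x := fun i hi =>
    hF fun k hk => by
      simp only [mem_Iic] at hk
      simp [skip_of_lt (show k < i by omega)]
  have key : ∀ i, (x ∘ skip (p + i)) ∘ (· + p) = (fun k => x (k + p)) ∘ skip i := by
    intro i
    funext k
    simp only [Function.comp, skip]
    split_ifs <;> first | rfl | omega | (congr 1; omega)
  have key' : ∀ i, i ≤ p → (x ∘ skip i) ∘ (· + p) = fun k => x (k + (p + 1)) := by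
    intro i hi
    funext k
    simp only [Function.comp, skip]
    rw [if_neg (by omega), add_assoc]
  have key0 : (fun k => x (k + p)) ∘ skip 0 = fun k => x (k + (p + 1)) := by
    funext k
    simp only [Function.comp, skip]
    rw [if_neg (by omega)]; congr 1; omega
  have e1 : ∀ i, cup p F G (x ∘ skip i) = F (x ∘ skip i) * G ((x ∘ skip i) ∘ (· + p)) :=
    fun i => rfl
  simp only [Pi.add_apply, Pi.smul_apply, smul_eq_mul, coboundary, cup]
  rw [show p + q + 1 + 1 = (p + 1) + (q + 1) by ring, Finset.sum_range_add,
    Finset.sum_range_succ _ (p + 1), Finset.sum_range_succ' _ (q + 1), key0]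
  have h1 : ∑ i ∈ Finset.range (p + 1), (-1 : ℝ) ^ i *
      (F (x ∘ skip i) * G (fun k => (x ∘ skip i) (k + p))) =
      (∑ i ∈ Finset.range (p + 1), (-1 : ℝ) ^ i * F (x ∘ skip i)) *
        G (fun k => x (k + (p + 1))) := by
    rw [Finset.sum_mul]
    refine Finset.sum_congr rfl fun i hi => ?_
    have := key' i (by simpa [Nat.lt_succ_iff] using hi)
    rw [show (fun k => (x ∘ skip i) (k + p)) = _ from this]
    ring
  have h2 : ∑ i ∈ Finset.range (q + 1), (-1 : ℝ) ^ (p + 1 + i) *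
      (F (x ∘ skip (p + 1 + i)) * G (fun k => (x ∘ skip (p + 1 + i)) (k + p))) =
      (-1) ^ p * (F x * ∑ i ∈ Finset.range (q + 1), (-1 : ℝ) ^ (i + 1) *
        G ((fun k => x (k + p)) ∘ skip (i + 1))) := by
    rw [Finset.mul_sum, Finset.mul_sum]
    refine Finset.sum_congr rfl fun i hi => ?_
    rw [hF' _ (by omega), ← key (i + 1), show p + (i + 1) = p + 1 + i by ring]
    simp only [Function.comp_def]
    ring
  rw [h1, h2, hF' _ (by omega)]
  ring

end Algebra

/-- Equality of cochains on all sufficiently small simplices. -/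
def LocEq {T : Type*} [TopologicalSpace T] (F G : Cochain T) : Prop :=
  ∀ p, ∀ᶠ O in (𝓝 p).smallSets, ∀ x : ℕ → T, (∀ k, x k ∈ O) → F x = G x

/-- Locally closed cochains of degree `p`. -/
def IsCocycle {T : Type*} [TopologicalSpace T] (p : ℕ) (F : Cochain T) : Prop :=
  DependsOn F (Iic p) ∧ LocEq (coboundary (p + 1) F) 0

/-- Cochains of degree `p` which differ locally by a coboundary. -/
def Cohom {T : Type*} [TopologicalSpace T] (p : ℕ) (F F' : Cochain T) : Prop :=
  ∃ G : Cochain T, DependsOn G (Iio p) ∧ (p = 0 → G = 0) ∧ LocEq F (F' + coboundary p G)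

section Local

variable {T Y : Type*} [TopologicalSpace T] [TopologicalSpace Y]

theorem LocEq.refl (F : Cochain T) : LocEq F F := fun _ => .of_forall fun _ _ _ => rfl

theorem LocEq.symm {F G : Cochain T} (h : LocEq F G) : LocEq G F := fun p => by
  filter_upwards [h p] with O hO x hx using (hO x hx).symm

theorem LocEq.trans {F G H : Cochain T} (h : LocEq F G) (h' : LocEq G H) : LocEq F H :=
  fun p => by
  filter_upwards [h p, h' p] with O hO hO' x hx using (hO x hx).trans (hO' x hx)

theorem LocEq.add {F F' G G' : Cochain T} (h : LocEq F F') (h' : LocEq G G') :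
    LocEq (F + G) (F' + G') := fun p => by
  filter_upwards [h p, h' p] with O hO hO' x hx
  simp [hO x hx, hO' x hx]

theorem LocEq.smul {F F' : Cochain T} (c : ℝ) (h : LocEq F F') :
    LocEq (c • F) (c • F') := fun p => by
  filter_upwards [h p] with O hO x hx
  simp [hO x hx]

theorem LocEq.cup {F F' G G' : Cochain T} (p : ℕ) (h : LocEq F F') (h' : LocEq G G') :
    LocEq (cup p F G) (cup p F' G') := fun z => by
  filter_upwards [h z, h' z] with O hO hO' x hx
  simp [Paper.cup, hO x hx, hO' (fun k => x (k + p)) fun k => hx _]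

theorem LocEq.coboundary {F F' : Cochain T} (p : ℕ) (h : LocEq F F') :
    LocEq (coboundary p F) (coboundary p F') := fun z => by
  filter_upwards [h z] with O hO x hx
  exact Finset.sum_congr rfl fun i _ => by rw [hO (x ∘ skip i) fun k => hx _]

theorem LocEq.pull {F F' : Cochain Y} {a : T → Y} (ha : Continuous a) (h : LocEq F F') :
    LocEq (pull a F) (pull a F') := fun z => by
  have := h (a z)
  rw [Filter.eventually_smallSets] at this ⊢
  obtain ⟨s, hs, H⟩ := this
  refine ⟨a ⁻¹' s, ha.continuousAt hs, fun t ht x hx => H s subset_rfl _ fun k => ht (hx k)⟩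

theorem IsCocycle.of_locEq {p : ℕ} {F F' : Cochain T} (hF : IsCocycle p F)
    (hF' : DependsOn F' (Iic p)) (h : LocEq F F') : IsCocycle p F' :=
  ⟨hF', (h.symm.coboundary _).trans hF.2⟩

theorem IsCocycle.cup {p q : ℕ} {F G : Cochain T} (hF : IsCocycle p F) (hG : IsCocycle q G) :
    IsCocycle (p + q) (cup p F G) := by
  refine ⟨dependsOn_cup hF.1 hG.1, ?_⟩
  rw [coboundary_cup q G hF.1]
  refine ((LocEq.cup _ hF.2 (.refl G)).add ((LocEq.cup p (.refl F) hG.2).smul _)).trans ?_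
  convert LocEq.refl (0 : Cochain T) using 1
  funext x
  simp [Paper.cup]

theorem IsCocycle.add {p : ℕ} {F G : Cochain T} (hF : IsCocycle p F) (hG : IsCocycle p G) :
    IsCocycle p (F + G) := by
  refine ⟨DependsOn.add' hF.1 hG.1, ?_⟩
  rw [coboundary_add]
  simpa using hF.2.add hG.2

theorem IsCocycle.smul {p : ℕ} {F : Cochain T} (c : ℝ) (hF : IsCocycle p F) :
    IsCocycle p (c • F) := by
  refine ⟨DependsOn.smul' c hF.1, ?_⟩
  rw [coboundary_smul]
  simpa using hF.2.smul c

theorem IsCocycle.zero (p : ℕ) : IsCocycle p (0 : Cochain T) :=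
  ⟨fun _ _ _ => rfl, by rw [coboundary_zero]; exact .refl _⟩

theorem IsCocycle.pull {p : ℕ} {F : Cochain Y} {a : T → Y} (ha : Continuous a)
    (hF : IsCocycle p F) : IsCocycle p (pull a F) :=
  ⟨fun _ _ h => hF.1 fun k hk => congrArg a (h k hk), hF.2.pull ha⟩

theorem isCocycle_coboundary {p : ℕ} {G : Cochain T} (hG : DependsOn G (Iio p)) :
    IsCocycle p (coboundary p G) :=
  ⟨dependsOn_coboundary hG, by rw [coboundary_coboundary]; exact .refl _⟩

theorem isCocycle_one : IsCocycle 0 (1 : Cochain T) :=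
  ⟨fun _ _ _ => rfl, by
    convert LocEq.refl (0 : Cochain T) using 1
    funext x
    simp [coboundary, Finset.sum_range_succ]⟩

theorem LocEq.cohom {p : ℕ} {F F' : Cochain T} (h : LocEq F F') : Cohom p F F' :=
  ⟨0, fun _ _ _ => rfl, fun _ => rfl, by rw [coboundary_zero, add_zero]; exact h⟩

theorem Cohom.refl (p : ℕ) (F : Cochain T) : Cohom p F F := (LocEq.refl F).cohom

theorem Cohom.trans {p : ℕ} {F F' F'' : Cochain T} (h : Cohom p F F') (h' : Cohom p F' F'') :
    Cohom p F F'' := by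
  obtain ⟨G, hG, hG0, e⟩ := h
  obtain ⟨G', hG', hG0', e'⟩ := h'
  refine ⟨G' + G, DependsOn.add' hG' hG, fun hp => by rw [hG0 hp, hG0' hp, add_zero], ?_⟩
  refine e.trans ?_
  rw [coboundary_add, ← add_assoc]
  exact e'.add (.refl _)

theorem Cohom.add {p : ℕ} {F F' H H' : Cochain T} (h : Cohom p F F') (h' : Cohom p H H') :
    Cohom p (F + H) (F' + H') := by
  obtain ⟨G, hG, hG0, e⟩ := h
  obtain ⟨G', hG', hG0', e'⟩ := h'
  refine ⟨G + G', DependsOn.add' hG hG', fun hp => by rw [hG0 hp, hG0' hp, add_zero], ?_⟩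
  rw [coboundary_add, add_add_add_comm]
  exact e.add e'

theorem Cohom.smul {p : ℕ} {F F' : Cochain T} (c : ℝ) (h : Cohom p F F') :
    Cohom p (c • F) (c • F') := by
  obtain ⟨G, hG, hG0, e⟩ := h
  refine ⟨c • G, DependsOn.smul' c hG, fun hp => by rw [hG0 hp, smul_zero], ?_⟩
  rw [coboundary_smul, ← smul_add]
  exact e.smul c

theorem Cohom.sum {ι : Type*} {p : ℕ} {s : Finset ι} {F F' : ι → Cochain T}
    (h : ∀ i ∈ s, Cohom p (F i) (F' i)) : Cohom p (∑ i ∈ s, F i) (∑ i ∈ s, F' i) := by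
  classical
  induction s using Finset.induction_on with
  | empty => simpa using Cohom.refl p (0 : Cochain T)
  | insert i s hi ih =>
    rw [Finset.sum_insert hi, Finset.sum_insert hi]
    exact (h i (by simp)).add (ih fun j hj => h j (by simp [hj]))

theorem Cohom.symm {p : ℕ} {F F' : Cochain T} (h : Cohom p F F') : Cohom p F' F := by
  obtain ⟨G, hG, hG0, e⟩ := h
  refine ⟨(-1 : ℝ) • G, DependsOn.smul' _ hG, fun hp => by rw [hG0 hp, smul_zero], ?_⟩
  rw [coboundary_smul]
  intro z
  filter_upwards [e z] with O hO x hx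
  simp [hO x hx]

theorem Cohom.cup_right {p q : ℕ} {F F' G : Cochain T} (h : Cohom p F F') (hG : IsCocycle q G) :
    Cohom (p + q) (cup p F G) (cup p F' G) := by
  obtain ⟨K, hK, hK0, e⟩ := h
  rcases p with _ | p
  · rw [hK0 rfl, coboundary_zero, add_zero] at e
    exact (LocEq.cup _ e (.refl G)).cohom
  have hIio : Iio (p + 1) = Iic p := by ext; simp
  rw [hIio] at hK
  refine ⟨cup p K G, ?_, by omega, (LocEq.cup _ e (.refl G)).trans ?_⟩
  · convert dependsOn_cup hK hG.1 using 1
    ext; simp; omega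
  · rw [show p + 1 + q = p + q + 1 by ring, coboundary_cup q G hK]
    have := ((LocEq.cup p (.refl K) hG.2).smul ((-1 : ℝ) ^ p))
    intro z
    filter_upwards [this z] with O hO x hx
    have h2 := hO x hx
    simp only [Pi.add_apply, h2, Pi.smul_apply, smul_eq_mul]
    simp [cup, add_mul]

theorem Cohom.cup_left {p q : ℕ} {F G G' : Cochain T} (hF : IsCocycle p F) (h : Cohom q G G') :
    Cohom (p + q) (cup p F G) (cup p F G') := by
  obtain ⟨K, hK, hK0, e⟩ := h
  rcases q with _ | q
  · rw [hK0 rfl, coboundary_zero, add_zero] at e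
    exact (LocEq.cup _ (.refl F) e).cohom
  have hIio : ∀ p, Iio (p + 1) = Iic p := fun p => by ext; simp
  rw [hIio] at hK
  refine ⟨(-1 : ℝ) ^ p • cup p F K, ?_, by omega, (LocEq.cup _ (.refl F) e).trans ?_⟩
  · rw [← add_assoc, hIio]
    exact DependsOn.smul' _ (dependsOn_cup hF.1 hK)
  · rw [← add_assoc, coboundary_smul, coboundary_cup q K hF.1]
    have := LocEq.cup (p + 1) hF.2 (.refl K)
    intro z
    filter_upwards [this z] with O hO x hx
    have h2 := hO x hx
    simp only [Pi.add_apply, h2, Pi.smul_apply, smul_eq_mul]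
    have h3 : ((-1 : ℝ) ^ p) * (-1) ^ p = 1 := by rw [← mul_pow]; simp
    simp only [cup, Pi.zero_apply, Pi.add_apply, zero_mul, zero_add]
    linear_combination (-F x * coboundary (q + 1) K fun k => x (k + p)) * h3

theorem Cohom.cup {p q : ℕ} {F F' G G' : Cochain T} (h : Cohom p F F') (h' : Cohom q G G')
    (hF' : IsCocycle p F') (hG : IsCocycle q G) :
    Cohom (p + q) (cup p F G) (cup p F' G') :=
  (h.cup_right hG).trans (.cup_left hF' h')

end Local

/-- The iterated cup product of the first `N` members of a family. -/
def cupProd {T : Type*} (d : ℕ → ℕ) (F : ℕ → Cochain T) (N : ℕ) : Cochain T :=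
  fun x => ∏ j ∈ Finset.range N, F j fun k => x (k + ∑ i ∈ Finset.range j, d i)

theorem cupProd_zero {T : Type*} {d : ℕ → ℕ} {F : ℕ → Cochain T} : cupProd d F 0 = 1 := by
  funext
  simp [cupProd]

theorem cupProd_succ {T : Type*} {d : ℕ → ℕ} {F : ℕ → Cochain T} (N : ℕ) :
    cupProd d F (N + 1) = cup (∑ i ∈ Finset.range N, d i) (cupProd d F N) (F N) := by
  funext x
  simp [cupProd, Finset.prod_range_succ, cup]

section Products

variable {T : Type*} [TopologicalSpace T] {d : ℕ → ℕ} {F F' : ℕ → Cochain T}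

theorem isCocycle_cupProd {N : ℕ} (hF : ∀ j < N, IsCocycle (d j) (F j)) :
    IsCocycle (∑ i ∈ Finset.range N, d i) (cupProd d F N) := by
  induction N with
  | zero => simpa [cupProd_zero] using isCocycle_one
  | succ N ih =>
    rw [cupProd_succ, Finset.sum_range_succ]
    exact (ih fun j hj => hF j (by omega)).cup (hF N (by omega))

theorem cohom_cupProd {N : ℕ} (hF : ∀ j < N, IsCocycle (d j) (F j))
    (hF' : ∀ j < N, IsCocycle (d j) (F' j)) (h : ∀ j < N, Cohom (d j) (F j) (F' j)) :
    Cohom (∑ i ∈ Finset.range N, d i) (cupProd d F N) (cupProd d F' N) := by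
  induction N with
  | zero => simpa [cupProd_zero] using Cohom.refl 0 (1 : Cochain T)
  | succ N ih =>
    rw [cupProd_succ, cupProd_succ, Finset.sum_range_succ]
    exact (ih (fun j hj => hF j (by omega)) (fun j hj => hF' j (by omega))
      (fun j hj => h j (by omega))).cup (h N (by omega))
      (isCocycle_cupProd fun j hj => hF' j (by omega)) (hF N (by omega))

end Products

/-- The `i`-th simplex of the triangulated prism with bottom `a ∘ x` and top `b ∘ x`. -/
def prismSimplex {T Y : Type*} (a b : T → Y) (i : ℕ) (x : ℕ → T) : ℕ → Y :=
  fun k => if k ≤ i then a (x k) else b (x (k - 1))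

/-- The prism operator, with values in degree `p`. -/
def prism {T Y : Type*} (p : ℕ) (a b : T → Y) (F : Cochain Y) : Cochain T :=
  fun x => ∑ i ∈ Finset.range (p + 1), (-1 : ℝ) ^ i * F (prismSimplex a b i x)

theorem dependsOn_prism {T Y : Type*} {p : ℕ} (a b : T → Y) {F : Cochain Y}
    (hF : DependsOn F (Iic (p + 1))) : DependsOn (prism p a b F) (Iic p) := by
  intro x y h
  refine Finset.sum_congr rfl fun i hi => ?_
  congr 1
  refine hF fun k hk => ?_
  simp only [mem_Iic, Finset.mem_range] at *
  unfold prismSimplex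
  split_ifs with hki
  · rw [h k (by omega)]
  · rw [h (k - 1) (by omega)]

theorem coboundary_prism {T Y : Type*} (p : ℕ) (a b : T → Y) {F : Cochain Y}
    (hF : DependsOn F (Iic (p + 1))) (x : ℕ → T) :
    coboundary (p + 1) (prism p a b F) x + prism (p + 1) a b (coboundary (p + 2) F) x =
      F (b ∘ x) - F (a ∘ x) := by
  let r : ℕ → ℕ → Y := fun i k => if k < i then a (x k) else b (x k)
  have hr0 : r 0 = b ∘ x := by funext k; simp [r]
  have hr1 : F (r (p + 2)) = F (a ∘ x) := hF fun k hk => by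
    simp only [mem_Iic] at hk
    simp [r, show k < p + 2 by omega]
  have e1 : ∀ i, prismSimplex a b i x ∘ skip i = r i := by
    intro i; funext k
    simp only [prismSimplex, skip, Function.comp, r]
    split_ifs <;> first | rfl | omega
  have e2 : ∀ i, prismSimplex a b i x ∘ skip (i + 1) = r (i + 1) := by
    intro i; funext k
    simp only [prismSimplex, skip, Function.comp, r]
    split_ifs <;> first | rfl | omega
  have e3 : ∀ i j, j ≤ i →
      prismSimplex a b (i + 1) x ∘ skip j = prismSimplex a b i (x ∘ skip j) := by
    intro i j h; funext k
    simp only [prismSimplex, skip, Function.comp]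
    split_ifs <;> first | rfl | omega | (congr 2; omega)
  have e4 : ∀ i j, i < j →
      prismSimplex a b i x ∘ skip (j + 1) = prismSimplex a b i (x ∘ skip j) := by
    intro i j h; funext k
    simp only [prismSimplex, skip, Function.comp]
    split_ifs <;> first | rfl | omega | (congr 2; omega)
  have split : prism (p + 1) a b (coboundary (p + 2) F) x =
      ∑ c ∈ (Finset.range (p + 2) ×ˢ Finset.range (p + 3)).filter
        (fun c => c.2 = c.1 ∨ c.2 = c.1 + 1),
          (-1 : ℝ) ^ c.1 * ((-1) ^ c.2 * F (prismSimplex a b c.1 x ∘ skip c.2)) +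
      ∑ c ∈ (Finset.range (p + 2) ×ˢ Finset.range (p + 3)).filter
        (fun c => ¬ (c.2 = c.1 ∨ c.2 = c.1 + 1)),
          (-1 : ℝ) ^ c.1 * ((-1) ^ c.2 * F (prismSimplex a b c.1 x ∘ skip c.2)) := by
    rw [Finset.sum_filter_add_sum_filter_not, Finset.sum_product]
    simp only [prism, coboundary, Finset.mul_sum]
  have diag : ∑ c ∈ (Finset.range (p + 2) ×ˢ Finset.range (p + 3)).filter
        (fun c => c.2 = c.1 ∨ c.2 = c.1 + 1),
          (-1 : ℝ) ^ c.1 * ((-1) ^ c.2 * F (prismSimplex a b c.1 x ∘ skip c.2)) =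
      F (b ∘ x) - F (a ∘ x) := by
    have : ∑ i ∈ Finset.range (p + 2), (F (r i) - F (r (i + 1))) = F (b ∘ x) - F (a ∘ x) := by
      rw [Finset.sum_range_sub', hr0, hr1]
    rw [← this]
    have hfil : (Finset.range (p + 2) ×ˢ Finset.range (p + 3)).filter
        (fun c => c.2 = c.1 ∨ c.2 = c.1 + 1) =
        (Finset.range (p + 2)).image (fun i => (i, i)) ∪
        (Finset.range (p + 2)).image (fun i => (i, i + 1)) := by
      ext ⟨i, j⟩
      simp only [Finset.mem_filter, Finset.mem_product, Finset.mem_range, Finset.mem_union,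
        Finset.mem_image, Prod.mk.injEq]
      constructor
      · rintro ⟨⟨h1, h2⟩, h | h⟩
        · exact .inl ⟨i, h1, rfl, h.symm⟩
        · exact .inr ⟨i, h1, rfl, h.symm⟩
      · rintro (⟨k, h1, h2, h3⟩ | ⟨k, h1, h2, h3⟩) <;> omega
    rw [hfil, Finset.sum_union, Finset.sum_image, Finset.sum_image, Finset.sum_sub_distrib,
      sub_eq_add_neg, ← Finset.sum_neg_distrib]
    · congr 1 <;> refine Finset.sum_congr rfl fun i _ => ?_
      · rw [e1, ← mul_assoc, ← mul_pow]; simp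
      · rw [e2, ← mul_assoc, pow_succ, ← mul_assoc, ← mul_pow]; simp
    · intro i _ j _ h; simpa using h
    · intro i _ j _ h; simpa using h
    · rw [Finset.disjoint_left]
      intro c h1 h2
      simp only [Finset.mem_image] at h1 h2
      obtain ⟨i, _, rfl⟩ := h1
      obtain ⟨j, _, h⟩ := h2
      simp only [Prod.mk.injEq] at h
      omega
  have rest : ∑ c ∈ (Finset.range (p + 2) ×ˢ Finset.range (p + 3)).filter
        (fun c => ¬ (c.2 = c.1 ∨ c.2 = c.1 + 1)),
          (-1 : ℝ) ^ c.1 * ((-1) ^ c.2 * F (prismSimplex a b c.1 x ∘ skip c.2)) =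
      - coboundary (p + 1) (prism p a b F) x := by
    simp only [coboundary, prism, Finset.mul_sum]
    rw [← Finset.sum_product', ← Finset.sum_neg_distrib]
    refine Finset.sum_nbij' (fun c => if c.2 < c.1 then (c.2, c.1 - 1) else (c.2 - 1, c.1))
      (fun c => if c.1 ≤ c.2 then (c.2 + 1, c.1) else (c.2, c.1 + 1)) ?_ ?_ ?_ ?_ ?_
    · rintro ⟨i, j⟩ h
      simp only [Finset.mem_filter, Finset.mem_product, Finset.mem_range] at *
      split_ifs <;> simp only <;> omega
    · rintro ⟨i, j⟩ h
      simp only [Finset.mem_filter, Finset.mem_product, Finset.mem_range] at *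
      split_ifs <;> simp only <;> omega
    · rintro ⟨i, j⟩ h
      simp only [Finset.mem_filter, Finset.mem_product, Finset.mem_range] at *
      by_cases hij : j < i
      · simp only [hij, if_true, show j ≤ i - 1 by omega]
        exact Prod.ext (by simp only; omega) rfl
      · simp only [hij, if_false, show ¬ (j - 1 ≤ i) by omega]
        exact Prod.ext rfl (by simp only; omega)
    · rintro ⟨i, j⟩ h
      by_cases hij : i ≤ j
      · simp only [hij, if_true, show i < j + 1 by omega, Nat.add_sub_cancel]
      · simp only [hij, if_false, show ¬ (i + 1 < j) by omega, Nat.add_sub_cancel]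
    · rintro ⟨i, j⟩ h
      simp only [Finset.mem_filter, Finset.mem_product, Finset.mem_range] at *
      by_cases hij : j < i
      · obtain ⟨i, rfl⟩ : ∃ i', i = i' + 1 := ⟨i - 1, by omega⟩
        simp only [hij, if_true, Nat.add_sub_cancel, e3 i j (by omega)]
        ring
      · obtain ⟨j, rfl⟩ : ∃ j', j = j' + 1 := ⟨j - 1, by omega⟩
        simp only [hij, if_false, Nat.add_sub_cancel, e4 i j (by omega)]
        ring
  rw [split, diag, rest]
  ring

/-- A uniform tube: along a compact parameter interval, a homotopy maps short pieces of a tube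
around a point into members of any given system of small sets. -/
theorem exists_tube {M Y : Type*} [TopologicalSpace M] [TopologicalSpace Y] {V : Set M}
    (hV : IsOpen V) {H : M × ℝ → Y} (hH : ContinuousOn H (V ×ˢ univ)) {P : Set Y → Prop}
    (hP : ∀ y, ∀ᶠ N in (𝓝 y).smallSets, P N) {m : M} (hm : m ∈ V) :
    ∃ O ∈ 𝓝 m, ∃ δ > 0, ∀ t ∈ Icc (0 : ℝ) 1, ∃ N, P N ∧
      ∀ m' ∈ O, ∀ t', |t' - t| < δ → H (m', t') ∈ N := by
  refine isCompact_Icc.induction_on (p := fun S : Set ℝ => ∃ O ∈ 𝓝 m, ∃ δ > 0, ∀ t ∈ S,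
    ∃ N, P N ∧ ∀ m' ∈ O, ∀ t', |t' - t| < δ → H (m', t') ∈ N) ?_ ?_ ?_ ?_
  · exact ⟨univ, Filter.univ_mem, 1, one_pos, by simp⟩
  · rintro S S' h ⟨O, hO, δ, hδ, K⟩
    exact ⟨O, hO, δ, hδ, fun t ht => K t (h ht)⟩
  · rintro S S' ⟨O, hO, δ, hδ, K⟩ ⟨O', hO', δ', hδ', K'⟩
    refine ⟨O ∩ O', Filter.inter_mem hO hO', min δ δ', lt_min hδ hδ', ?_⟩
    rintro t (ht | ht)
    · obtain ⟨N, hN, h⟩ := K t ht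
      exact ⟨N, hN, fun m' hm' t' ht' => h m' hm'.1 t' (ht'.trans_le (min_le_left _ _))⟩
    · obtain ⟨N, hN, h⟩ := K' t ht
      exact ⟨N, hN, fun m' hm' t' ht' => h m' hm'.2 t' (ht'.trans_le (min_le_right _ _))⟩
  · intro t _
    obtain ⟨N, hN, hPN⟩ := Filter.eventually_smallSets.mp (hP (H (m, t)))
    have hc : ContinuousAt H (m, t) :=
      hH.continuousAt ((hV.prod isOpen_univ).mem_nhds ⟨hm, mem_univ _⟩)
    have h1 := hc hN
    rw [Filter.mem_map, nhds_prod_eq, Filter.mem_prod_iff] at h1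
    obtain ⟨O, hO, S, hS, hsub⟩ := h1
    obtain ⟨δ, hδ, hball⟩ := Metric.mem_nhds_iff.mp hS
    refine ⟨Metric.ball t (δ / 2),
      mem_nhdsWithin_of_mem_nhds (Metric.ball_mem_nhds _ (by linarith)),
      O, hO, δ / 2, by linarith, fun u hu => ⟨N, hPN N subset_rfl, fun m' hm' t' ht' => ?_⟩⟩
    have : (m', t') ∈ O ×ˢ S := by
      refine ⟨hm', hball ?_⟩
      rw [Metric.mem_ball, Real.dist_eq] at hu ⊢
      calc |t' - t| ≤ |t' - u| + |u - t| := abs_sub_le _ _ _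
        _ < δ := by linarith
    exact hsub this

/-- Homotopy invariance: over an open set on which `a` and `b` are homotopic, pullbacks of a locally
closed cochain along `a` and `b` differ locally by a coboundary. -/
theorem exists_homotopy_coboundary {M Y : Type*} [TopologicalSpace M] [TopologicalSpace Y]
    {V : Set M} (hV : IsOpen V) {H : M × ℝ → Y} (hH : ContinuousOn H (V ×ˢ univ)) {a b : M → Y}
    (ha : ∀ m ∈ V, H (m, 0) = a m) (hb : ∀ m ∈ V, H (m, 1) = b m) {p : ℕ} {F : Cochain Y}
    (hF : IsCocycle (p + 1) F) :
    ∃ G : ℕ → Cochain M, (∀ L, DependsOn (G L) (Iic p)) ∧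
      ∀ m ∈ V, ∀ᶠ O in (𝓝 m).smallSets, ∀ᶠ L in Filter.atTop, ∀ x : ℕ → M, (∀ k, x k ∈ O) →
        (pull b F - pull a F) x = coboundary (p + 1) (G L) x := by
  refine ⟨fun L => ∑ l ∈ Finset.range L, prism p (fun m => H (m, (l : ℝ) / L))
    (fun m => H (m, ((l + 1 : ℕ) : ℝ) / L)) F, fun L => ?_, fun m hm => ?_⟩
  · intro x y h
    simp only [Finset.sum_apply]
    exact Finset.sum_congr rfl fun l _ => dependsOn_prism _ _ hF.1 h
  · obtain ⟨O, hO, δ, hδ, K⟩ := exists_tube hV hH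
      (P := fun N => ∀ y : ℕ → Y, (∀ k, y k ∈ N) → coboundary (p + 2) F y = 0) hF.2 hm
    refine Filter.eventually_smallSets.mpr ⟨O ∩ V, Filter.inter_mem hO (hV.mem_nhds hm), ?_⟩
    intro O' hO'
    obtain ⟨L₀, hL₀⟩ := exists_nat_gt (1 / δ)
    filter_upwards [Filter.eventually_ge_atTop (max L₀ 1)] with L hL x hx
    have hL1 : 1 ≤ L := (le_max_right _ _).trans hL
    have hLpos : (0 : ℝ) < L := by exact_mod_cast hL1
    have hLδ : 1 / (L : ℝ) < δ := by
      rw [div_lt_iff₀ hLpos]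
      have : (L₀ : ℝ) ≤ L := by exact_mod_cast (le_max_left _ _).trans hL
      rw [div_lt_iff₀ hδ] at hL₀
      nlinarith
    have key : ∀ l ∈ Finset.range L, coboundary (p + 1) (prism p (fun m => H (m, (l : ℝ) / L))
        (fun m => H (m, ((l + 1 : ℕ) : ℝ) / L)) F) x =
        F (fun k => H (x k, ((l + 1 : ℕ) : ℝ) / L)) - F (fun k => H (x k, (l : ℝ) / L)) := by
      intro l hl
      have hl' : l < L := Finset.mem_range.mp hl
      obtain ⟨N, hN, hNH⟩ := K ((l : ℝ) / L) ⟨by positivity, by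
        rw [div_le_one hLpos]; exact_mod_cast hl'.le⟩
      have hzero : prism (p + 1) (fun m => H (m, (l : ℝ) / L))
          (fun m => H (m, ((l + 1 : ℕ) : ℝ) / L)) (coboundary (p + 2) F) x = 0 := by
        refine Finset.sum_eq_zero fun i _ => ?_
        rw [hN, mul_zero]
        intro k
        unfold prismSimplex
        split_ifs
        · exact hNH _ (hO' (hx _)).1 _ (by simpa using hδ)
        · refine hNH _ (hO' (hx _)).1 _ ?_
          rw [← sub_div]
          push_cast
          rw [add_sub_cancel_left, abs_of_pos (by positivity)]
          exact hLδ
      have h2 := coboundary_prism p (fun m => H (m, (l : ℝ) / L))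
          (fun m => H (m, ((l + 1 : ℕ) : ℝ) / L)) hF.1 x
      rw [hzero, add_zero] at h2
      rw [h2]
      rfl
    have hsum : coboundary (p + 1) (∑ l ∈ Finset.range L, prism p (fun m => H (m, (l : ℝ) / L))
        (fun m => H (m, ((l + 1 : ℕ) : ℝ) / L)) F) x =
        ∑ l ∈ Finset.range L, coboundary (p + 1) (prism p (fun m => H (m, (l : ℝ) / L))
        (fun m => H (m, ((l + 1 : ℕ) : ℝ) / L)) F) x := by
      simp only [coboundary, Finset.sum_apply, Finset.mul_sum]
      exact Finset.sum_comm
    rw [hsum, Finset.sum_congr rfl key,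
      Finset.sum_range_sub (fun l : ℕ => F fun k => H (x k, (l : ℝ) / L))]
    have h1 : (fun k => H (x k, (L : ℝ) / L)) = b ∘ x := by
      funext k
      rw [div_self hLpos.ne']
      exact hb _ (hO' (hx k)).2
    have h0 : (fun k => H (x k, ((0 : ℕ) : ℝ) / L)) = a ∘ x := by
      funext k
      rw [Nat.cast_zero, zero_div]
      exact ha _ (hO' (hx k)).2
    rw [h1, h0]
    rfl

section Kuhn

variable {A T : Type*} [AddCommGroup A]

/-- The vertices of a Kuhn simplex: starting from `v`, add the vectors `w (σ 0), w (σ 1), …`. -/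
def kuhnPath {D : ℕ} (w : Fin D → A) (v : A) (σ : Equiv.Perm (Fin D)) (k : ℕ) : A :=
  v + ∑ i : Fin D, if (i : ℕ) < k then w (σ i) else 0

/-- Evaluation of a cochain on the fundamental cycle formed by all Kuhn simplices of a grid. -/
def kuhnEval [Fintype A] {D : ℕ} (w : Fin D → A) (pt : A → T) (F : Cochain T) : ℝ :=
  ∑ v : A, ∑ σ : Equiv.Perm (Fin D), ((Equiv.Perm.sign σ : ℤ) : ℝ) * F (pt ∘ kuhnPath w v σ)

theorem kuhnPath_mul_swap {p : ℕ} (w : Fin (p + 1) → A) (v : A) (σ : Equiv.Perm (Fin (p + 1)))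
    (j : Fin p) : kuhnPath w v (σ * Equiv.swap j.castSucc j.succ) ∘ skip (j + 1) =
      kuhnPath w v σ ∘ skip (j + 1) := by
  funext k
  simp only [kuhnPath, Function.comp, Equiv.Perm.mul_apply]
  congr 1
  rw [← Equiv.sum_comp (Equiv.swap j.castSucc j.succ)]
  refine Finset.sum_congr rfl fun i _ => ?_
  rw [Equiv.swap_apply_self]
  congr 1
  rcases eq_or_ne i j.castSucc with rfl | h1
  · rw [Equiv.swap_apply_left]
    simp only [Fin.val_succ, Fin.val_castSucc, skip, eq_iff_iff]
    split_ifs <;> omega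
  rcases eq_or_ne i j.succ with rfl | h2
  · rw [Equiv.swap_apply_right]
    simp only [Fin.val_succ, Fin.val_castSucc, skip, eq_iff_iff]
    split_ifs <;> omega
  · rw [Equiv.swap_apply_of_ne_of_ne h1 h2]

theorem kuhnPath_rotate {p : ℕ} (w : Fin (p + 1) → A) (v : A) (σ : Equiv.Perm (Fin (p + 1)))
    {k : ℕ} (hk : k ≤ p) :
    kuhnPath w v σ (k + 1) = kuhnPath w (v + w (σ 0)) (σ * finRotate (p + 1)) k := by
  simp only [kuhnPath, Equiv.Perm.mul_apply]
  rw [← Equiv.sum_comp (finRotate (p + 1)), Fin.sum_univ_castSucc, Fin.sum_univ_castSucc]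
  have hlast : finRotate (p + 1) (Fin.last p) = 0 := finRotate_last
  have hc : ∀ i : Fin p, ((finRotate (p + 1) i.castSucc : Fin (p + 1)) : ℕ) = i + 1 := by
    intro i
    rw [coe_finRotate_of_ne_last (Fin.castSucc_lt_last i).ne]
    rfl
  rw [hlast]
  simp only [hc, Fin.val_castSucc, Fin.val_last, if_neg (not_lt.mpr hk), add_lt_add_iff_right,
    Fin.val_zero, Nat.succ_pos, if_true, add_zero]
  abel

theorem kuhnEval_coboundary [Fintype A] {p : ℕ} (w : Fin (p + 1) → A) (pt : A → T)
    {G : Cochain T} (hG : DependsOn G (Iic p)) :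
    kuhnEval w pt (coboundary (p + 1) G) = 0 := by
  let E : ℕ → ℝ := fun j => ∑ v : A, ∑ σ : Equiv.Perm (Fin (p + 1)),
    ((Equiv.Perm.sign σ : ℤ) : ℝ) * G ((pt ∘ kuhnPath w v σ) ∘ skip j)
  have hE : kuhnEval w pt (coboundary (p + 1) G) =
      ∑ j ∈ Finset.range (p + 2), (-1 : ℝ) ^ j * E j := by
    simp only [kuhnEval, coboundary, E, Finset.mul_sum]
    rw [Finset.sum_comm' (t' := Finset.univ) (s' := fun _ => Finset.range (p + 2)) (by simp)]
    refine Finset.sum_congr rfl fun v _ => ?_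
    rw [Finset.sum_comm]
    refine Finset.sum_congr rfl fun j _ => Finset.sum_congr rfl fun σ _ => by ring
  have hmid : ∀ j ∈ Finset.range p, (-1 : ℝ) ^ (j + 1) * E (j + 1) = 0 := by
    intro j hj
    have hj' : j < p := Finset.mem_range.mp hj
    suffices E (j + 1) = - E (j + 1) by rw [show E (j + 1) = 0 by linarith, mul_zero]
    simp only [E, ← Finset.sum_neg_distrib]
    refine Finset.sum_congr rfl fun v _ => ?_
    have hne : (Fin.castSucc ⟨j, hj'⟩ : Fin (p + 1)) ≠ Fin.succ ⟨j, hj'⟩ := by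
      simp [Fin.ext_iff]
    rw [← Equiv.sum_comp (Equiv.mulRight (Equiv.swap (Fin.castSucc ⟨j, hj'⟩)
      (Fin.succ ⟨j, hj'⟩)))]
    refine Finset.sum_congr rfl fun σ _ => ?_
    have := kuhnPath_mul_swap w v σ ⟨j, hj'⟩
    rw [Equiv.coe_mulRight, Function.comp_assoc, this, Equiv.Perm.sign_mul,
      Equiv.Perm.sign_swap hne, Function.comp_assoc]
    simp
  have h0 : E 0 = (-1) ^ p * E (p + 1) := by
    simp only [E]
    rw [Finset.sum_comm, Finset.sum_comm (s := (Finset.univ : Finset A)), Finset.mul_sum]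
    rw [← Equiv.sum_comp (Equiv.mulRight (finRotate (p + 1)))
      (fun σ => (-1 : ℝ) ^ p * ∑ v : A, ((Equiv.Perm.sign σ : ℤ) : ℝ) *
        G ((pt ∘ kuhnPath w v σ) ∘ skip (p + 1)))]
    refine Finset.sum_congr rfl fun σ _ => ?_
    rw [← Equiv.sum_comp (Equiv.addRight (w (σ 0)))
      (fun v => ((Equiv.Perm.sign _ : ℤ) : ℝ) *
        G ((pt ∘ kuhnPath w v (Equiv.mulRight (finRotate (p + 1)) σ)) ∘ skip (p + 1))),
      Finset.mul_sum]
    refine Finset.sum_congr rfl fun v _ => ?_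
    have : G ((pt ∘ kuhnPath w v σ) ∘ skip 0) =
        G ((pt ∘ kuhnPath w (v + w (σ 0)) (σ * finRotate (p + 1))) ∘ skip (p + 1)) := by
      refine hG fun k hk => ?_
      simp only [mem_Iic] at hk
      simp only [Function.comp, skip_of_le (Nat.zero_le k), skip_of_lt (Nat.lt_succ_of_le hk),
        kuhnPath_rotate w v σ hk]
    rw [Equiv.coe_mulRight, Equiv.coe_addRight, this, Equiv.Perm.sign_mul, sign_finRotate]
    have h3 : ((-1 : ℝ) ^ p) * (-1) ^ p = 1 := by rw [← mul_pow]; simp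
    push_cast
    linear_combination (-((Equiv.Perm.sign σ : ℤ) : ℝ) *
      G ((pt ∘ kuhnPath w (v + w (σ 0)) (σ * finRotate (p + 1))) ∘ skip (p + 1))) * h3
  rw [hE, Finset.sum_range_succ, Finset.sum_range_succ', Finset.sum_eq_zero hmid, h0]
  simp only [pow_zero, pow_succ]
  ring

end Kuhn

/-- A permutation of the disjoint union of blocks which permutes the blocks, preserves the position
inside each block and fixes all blocks of odd size, is even. -/
theorem sign_blockPerm {J : Type*} [Fintype J] [DecidableEq J] (d : J → ℕ)
    (σ : Equiv.Perm (Σ j, Fin (d j)))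
    (φ : J → J) (hd : ∀ j, d (φ j) = d j) (hodd : ∀ j, Odd (d j) → φ j = j)
    (hσ : ∀ c, σ c = ⟨φ c.1, Fin.cast (hd c.1).symm c.2⟩) :
    Equiv.Perm.sign σ = 1 := by
  classical
  let P : (Σ j, Fin (d j)) → Prop := fun c => Even (d c.1) ∧ Even (c.2 : ℕ)
  let Q : (Σ j, Fin (d j)) → Prop := fun c => Even (d c.1) ∧ Odd (c.2 : ℕ)
  have hP : ∀ c, P (σ c) ↔ P c := fun c => by rw [hσ c]; simp only [P, hd, Fin.val_cast]
  have hQ : ∀ c, Q (σ c) ↔ Q c := fun c => by rw [hσ c]; simp only [Q, hd, Fin.val_cast]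
  have hmul : σ = Equiv.Perm.ofSubtype (σ.subtypePerm hP) *
      Equiv.Perm.ofSubtype (σ.subtypePerm hQ) := by
    ext1 c
    rw [Equiv.Perm.mul_apply]
    by_cases hc : Q c
    · rw [Equiv.Perm.ofSubtype_apply_of_mem _ hc]
      rw [Equiv.Perm.ofSubtype_apply_of_not_mem]
      · rfl
      · intro h
        have h1 := (hQ c).mpr hc
        exact (Nat.not_even_iff_odd.mpr h1.2) h.2
    · rw [Equiv.Perm.ofSubtype_apply_of_not_mem _ hc]
      by_cases hc' : P c
      · rw [Equiv.Perm.ofSubtype_apply_of_mem _ hc']; rfl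
      · rw [Equiv.Perm.ofSubtype_apply_of_not_mem _ hc', hσ c]
        have h1 : Odd (d c.1) := by
          by_contra h
          rw [Nat.not_odd_iff_even] at h
          rcases Nat.even_or_odd (c.2 : ℕ) with h2 | h2
          · exact hc' ⟨h, h2⟩
          · exact hc ⟨h, h2⟩
        obtain ⟨j, i⟩ := c
        exact Sigma.ext (hodd j h1) ((Fin.heq_ext_iff (hd j)).mpr rfl)
  have hlt : ∀ c, P c → (c.2 : ℕ) + 1 < d c.1 := fun c hc => by
    obtain ⟨⟨a, ha⟩, ⟨b, hb⟩⟩ := hc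
    have := c.2.2
    omega
  let e : {c // P c} ≃ {c // Q c} :=
    { toFun := fun c => ⟨⟨c.1.1, ⟨c.1.2 + 1, hlt c.1 c.2⟩⟩, c.2.1, c.2.2.add_one⟩
      invFun := fun c => ⟨⟨c.1.1, ⟨c.1.2 - 1, by have := c.1.2.2; omega⟩⟩, c.2.1,
        Nat.Odd.sub_odd c.2.2 odd_one⟩
      left_inv := fun c => by
        obtain ⟨⟨j, i⟩, h⟩ := c
        simp
      right_inv := fun c => by
        obtain ⟨⟨j, i⟩, h, a, ha⟩ := c
        have ha' : (i : ℕ) = 2 * a + 1 := ha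
        simp only [Subtype.mk.injEq, Sigma.mk.injEq, heq_eq_eq, true_and]
        apply Fin.ext
        show (i : ℕ) - 1 + 1 = i
        omega }
  have hs : Equiv.Perm.sign (σ.subtypePerm hP) = Equiv.Perm.sign (σ.subtypePerm hQ) := by
    refine Equiv.Perm.sign_eq_sign_of_equiv _ _ e fun c => ?_
    refine Subtype.ext ?_
    have h1 := hσ c.1
    have h2 := hσ (e c).1
    have h3 : ((σ.subtypePerm hQ) (e c)).1 = σ (e c).1 := rfl
    have h4 : ((σ.subtypePerm hP) c).1 = σ c.1 := rfl
    rw [h3, h2]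
    show (⟨((σ.subtypePerm hP) c).1.1, ⟨((σ.subtypePerm hP) c).1.2 + 1, _⟩⟩ : Σ j, Fin (d j)) = _
    have h5 : ((σ.subtypePerm hP) c).1.1 = φ c.1.1 := by rw [h4, h1]
    have h6 : (((σ.subtypePerm hP) c).1.2 : ℕ) = c.1.2 := by rw [h4, h1]; rfl
    exact Sigma.ext h5 ((Fin.heq_ext_iff (congrArg d h5)).mpr (congrArg (· + 1) h6))
  rw [hmul, Equiv.Perm.sign_mul, Equiv.Perm.sign_ofSubtype, Equiv.Perm.sign_ofSubtype, hs,
    Int.units_mul_self]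

/-- The cochain measuring the angle between the images of the first two vertices. -/
noncomputable def angle {T : Type*} (θ : T → Circle) : Cochain T :=
  fun x => Complex.arg ((θ (x 1) / θ (x 0) : Circle) : ℂ)

/-- The product of the angle cochains of the coordinates in the block `j` of a torus. -/
noncomputable def blockAngle {J : Type*} (d : J → ℕ) (j : J) :
    Cochain ((Σ j, Fin (d j)) → Circle) :=
  fun x => ∏ i : Fin (d j), angle (fun m => m ⟨j, i⟩) fun k => x (k + i)

section Grid

variable {J : Type*} [DecidableEq J] (d : J → ℕ) {D : ℕ}
  (E : Fin D ≃ Σ j, Fin (d j))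

/-- The unit steps of the grid, in the order given by `E`. -/
def gridStep (L : ℕ) (q : Fin D) : (Σ j, Fin (d j)) → ZMod L := Pi.single (E q) 1

/-- The embedding of the grid into the torus. -/
noncomputable def gridPoint (L : ℕ) [NeZero L] (v : (Σ j, Fin (d j)) → ZMod L) :
    (Σ j, Fin (d j)) → Circle := fun c => ZMod.toCircle (v c)

theorem kuhnPath_succ {A : Type*} [AddCommGroup A] (w : Fin D → A) (v : A)
    (σ : Equiv.Perm (Fin D)) {k : ℕ} (hk : k < D) :
    kuhnPath w v σ (k + 1) = kuhnPath w v σ k + w (σ ⟨k, hk⟩) := by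
  have : ∀ i : Fin D, (if (i : ℕ) < k + 1 then w (σ i) else 0) =
      (if (i : ℕ) < k then w (σ i) else 0) + if i = ⟨k, hk⟩ then w (σ i) else 0 := by
    intro i
    by_cases h1 : i = ⟨k, hk⟩
    · subst h1; simp
    · have h2 : (i : ℕ) ≠ k := fun h => h1 (Fin.ext h)
      simp only [h1, if_false, add_zero]
      congr 1
      simp only [eq_iff_iff]; omega
  simp only [kuhnPath, this, Finset.sum_add_distrib, Finset.sum_ite_eq', Finset.mem_univ, if_true,
    add_assoc]

theorem kuhnPath_gridStep (L : ℕ) (v : (Σ j, Fin (d j)) → ZMod L) (σ : Equiv.Perm (Fin D))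
    (k : ℕ) (c : Σ j, Fin (d j)) : kuhnPath (gridStep d E L) v σ k c =
      v c + if ((σ.symm (E.symm c) : Fin D) : ℕ) < k then 1 else 0 := by
  simp only [kuhnPath, Pi.add_apply, Finset.sum_apply]
  congr 1
  rw [Finset.sum_eq_single (σ.symm (E.symm c))]
  · split_ifs <;> simp [gridStep]
  · intro b _ hb
    have : c ≠ E (σ b) := fun h => hb (by rw [h]; simp)
    split_ifs <;> simp [gridStep, this]
  · simp

theorem arg_toCircle_one {L : ℕ} [NeZero L] (hL : 2 ≤ L) :
    Complex.arg ((ZMod.toCircle (1 : ZMod L) : Circle) : ℂ) = 2 * Real.pi / L := by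
  have h := ZMod.toCircle_intCast (N := L) 1
  simp only [Int.cast_one] at h
  have h0 : (2 : ℝ) ≤ L := by exact_mod_cast hL
  rw [h, show (2 * Real.pi * Complex.I * 1 / L : ℂ) = ((2 * Real.pi / L : ℝ) : ℂ) * Complex.I by
    push_cast; ring, Complex.arg_exp_mul_I, toIocMod_eq_self]
  have := Real.pi_pos
  constructor
  · have : 0 < 2 * Real.pi / L := by positivity
    linarith
  · rw [div_le_iff₀ (by linarith)]; nlinarith

theorem angle_gridPoint {L : ℕ} [NeZero L] (hL : 2 ≤ L) (v : (Σ j, Fin (d j)) → ZMod L)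
    (σ : Equiv.Perm (Fin D)) {k : ℕ} (hk : k < D) (c : Σ j, Fin (d j)) :
    angle (fun m => m c) (fun l => (gridPoint d L ∘ kuhnPath (gridStep d E L) v σ) (l + k)) =
      if E (σ ⟨k, hk⟩) = c then 2 * Real.pi / L else 0 := by
  have h1 : kuhnPath (gridStep d E L) v σ (1 + k) c = kuhnPath (gridStep d E L) v σ k c +
      gridStep d E L (σ ⟨k, hk⟩) c := by
    rw [add_comm, kuhnPath_succ _ _ _ hk]; rfl
  simp only [angle, gridPoint, Function.comp, h1, zero_add, AddChar.map_add_eq_mul,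
    mul_div_cancel_left]
  split_ifs with h
  · subst h
    simp [gridStep, arg_toCircle_one hL]
  · simp [gridStep, Pi.single_eq_of_ne (Ne.symm h)]

theorem eventually_dist_gridPoint [Fintype J] {δ : ℝ} (hδ : 0 < δ) :
    ∀ᶠ L in Filter.atTop, ∀ [NeZero L], ∀ (v : (Σ j, Fin (d j)) → ZMod L)
      (σ : Equiv.Perm (Fin D)) (k l : ℕ),
      dist ((gridPoint d L ∘ kuhnPath (gridStep d E L) v σ) k)
        ((gridPoint d L ∘ kuhnPath (gridStep d E L) v σ) l) < δ := by
  have hlim : Filter.Tendsto (fun L : ℕ => Complex.exp ((2 * Real.pi * Complex.I : ℂ) / L))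
      Filter.atTop (𝓝 1) := by
    have := (tendsto_const_div_atTop_nhds_zero_nat (2 * Real.pi * Complex.I : ℂ))
    simpa [Function.comp_def] using (Complex.continuous_exp.tendsto 0).comp this
  filter_upwards [Metric.tendsto_nhds.mp hlim δ hδ] with L hL _ v σ k l
  rw [dist_pi_lt_iff hδ]
  intro c
  have h := ZMod.toCircle_intCast (N := L) 1
  simp only [Int.cast_one, mul_one] at h
  rw [← h, dist_eq_norm] at hL
  have key : ∀ a : ZMod L, dist (ZMod.toCircle (v c + a)) (ZMod.toCircle (v c)) =
      ‖((ZMod.toCircle a : Circle) : ℂ) - 1‖ := by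
    intro a
    have hd : ∀ a b : Circle, dist a b = ‖(a : ℂ) - b‖ := fun a b => dist_eq_norm (a : ℂ) b
    rw [AddChar.map_add_eq_mul, hd, Circle.coe_mul]
    rw [← mul_sub_one, norm_mul, Circle.norm_coe, one_mul]
  simp only [Function.comp, gridPoint, kuhnPath_gridStep]
  split_ifs
  · simpa using hδ
  · rw [add_zero, key]; exact hL
  · rw [add_zero, dist_comm, key]; exact hL
  · simpa using hδ

theorem exists_kuhnEval_eq_zero [Fintype J] {F : Cochain ((Σ j, Fin (d j)) → Circle)}
    (hF : LocEq F 0) :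
    ∃ (L : ℕ) (_ : NeZero L), 2 ≤ L ∧ kuhnEval (gridStep d E L) (gridPoint d L) F = 0 := by
  have h1 : ∀ p, ∃ O, IsOpen O ∧ p ∈ O ∧ ∀ x : ℕ → _, (∀ k, x k ∈ O) → F x = 0 := by
    intro p
    obtain ⟨O, hO, H⟩ := Filter.eventually_smallSets.mp (hF p)
    obtain ⟨O', hO', h2, h3⟩ := mem_nhds_iff.mp hO
    exact ⟨O', h2, h3, H O' hO'⟩
  choose O hO hpO hFO using h1
  obtain ⟨δ, hδ, hleb⟩ := lebesgue_number_lemma_of_metric isCompact_univ hO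
    (fun p _ => mem_iUnion.mpr ⟨p, hpO p⟩)
  obtain ⟨L, hL, hL2⟩ := ((eventually_dist_gridPoint d E hδ).and
    (Filter.eventually_ge_atTop 2)).exists
  have : NeZero L := ⟨by omega⟩
  refine ⟨L, this, hL2, Finset.sum_eq_zero fun v _ => Finset.sum_eq_zero fun σ _ => ?_⟩
  obtain ⟨p, hp⟩ := hleb ((gridPoint d L ∘ kuhnPath (gridStep d E L) v σ) 0) (mem_univ _)
  rw [hFO p _ fun k => hp (Metric.mem_ball.mpr (hL v σ k 0)), mul_zero]

end Grid

/-- Extension of a finite family, enumerated by `e`, to a sequence. -/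
def extendFin {J : Type*} {N : ℕ} {B : Type*} [Zero B] (e : Fin N ≃ J) (F : J → B) (j : ℕ) : B :=
  if h : j < N then F (e ⟨j, h⟩) else 0

theorem extendFin_val {J : Type*} {N : ℕ} {B : Type*} [Zero B] (e : Fin N ≃ J) (F : J → B)
    (j : Fin N) : extendFin e F j = F (e j) := by
  simp [extendFin]

section Blocks

variable {J : Type*} (d : J → ℕ) {N : ℕ} (e : Fin N ≃ J)

/-- The enumeration of all coordinates block by block. -/
def blockEquiv : Fin (∑ j ∈ Finset.range N, extendFin e d j) ≃ Σ j, Fin (d j) :=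
  (finCongr (by
    rw [Finset.sum_range]
    exact Finset.sum_congr rfl fun i _ => extendFin_val e d i)).trans
    (finSigmaFinEquiv.symm.trans (Equiv.sigmaCongrLeft (β := fun j => Fin (d j)) e))

theorem blockEquiv_apply (j : Fin N) (k : Fin (d (e j)))
    (h : k + ∑ i ∈ Finset.range j, extendFin e d i < ∑ j ∈ Finset.range N, extendFin e d j) :
    blockEquiv d e ⟨k + ∑ i ∈ Finset.range j, extendFin e d i, h⟩ = ⟨e j, k⟩ := by
  have : finSigmaFinEquiv (n := fun j => d (e j)) ⟨j, k⟩ = finCongr (by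
    rw [Finset.sum_range]
    exact Finset.sum_congr rfl fun i _ => extendFin_val e d i)
      ⟨k + ∑ i ∈ Finset.range j, extendFin e d i, h⟩ := by
    apply Fin.ext
    rw [finSigmaFinEquiv_apply]
    simp only [finCongr_apply, Fin.val_cast]
    rw [add_comm, Finset.sum_range]
    congr 1
    exact Finset.sum_congr rfl fun i _ => (extendFin_val e d (Fin.castLE j.2.le i)).symm
  simp only [blockEquiv, Equiv.trans_apply, ← this, Equiv.symm_apply_apply]
  rfl

theorem offset_lt (j : Fin N) (k : Fin (d (e j))) :
    k + ∑ i ∈ Finset.range j, extendFin e d i < ∑ j ∈ Finset.range N, extendFin e d j := by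
  calc k + ∑ i ∈ Finset.range j, extendFin e d i
      < extendFin e d j + ∑ i ∈ Finset.range j, extendFin e d i := by
        rw [extendFin_val]; exact Nat.add_lt_add_right k.2 _
    _ = ∑ i ∈ Finset.range (j + 1), extendFin e d i := by
        rw [Finset.sum_range_succ, add_comm]
    _ ≤ _ := Finset.sum_le_sum_of_subset (by
        intro x hx
        have := j.2
        simp only [Finset.mem_range] at *; omega)

theorem blockEquiv_apply' (j : Fin N) (k : Fin (d (e j))) :
    blockEquiv d e ⟨_, offset_lt d e j k⟩ = ⟨e j, k⟩ := blockEquiv_apply d e j k _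

variable [DecidableEq J]

theorem blockAngle_gridPoint {L : ℕ} [NeZero L] (hL : 2 ≤ L) (v : (Σ j, Fin (d j)) → ZMod L)
    (σ : Equiv.Perm (Fin (∑ j ∈ Finset.range N, extendFin e d j))) (j : Fin N) (j' : J)
    (hj : d j' = d (e j)) :
    blockAngle d j' (fun k => (gridPoint d L ∘ kuhnPath (gridStep d (blockEquiv d e) L) v σ)
      (k + ∑ i ∈ Finset.range j, extendFin e d i)) =
      ∏ i : Fin (d j'), if blockEquiv d e (σ ⟨_, offset_lt d e j (Fin.cast hj i)⟩) = ⟨j', i⟩ then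
        2 * Real.pi / L else 0 := by
  refine Finset.prod_congr rfl fun i _ => ?_
  simp only [add_assoc]
  exact angle_gridPoint d (blockEquiv d e) hL v σ _ _

theorem kuhnEval_pos [Fintype J] (S : J → Finset J) (hS : ∀ j, j ∈ S j)
    (hS' : ∀ j, ∀ j' ∈ S j, d j' = d j ∧ (j' ≠ j → Even (d j))) {L : ℕ} [NeZero L] (hL : 2 ≤ L) :
    0 < kuhnEval (gridStep d (blockEquiv d e) L) (gridPoint d L)
      (cupProd (extendFin e d) (extendFin e fun j => ∑ j' ∈ S j, blockAngle d j') N) := by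
  have hπ : 0 < 2 * Real.pi / L := by
    have : (0 : ℝ) < L := by exact_mod_cast (by omega : 0 < L)
    have := Real.pi_pos
    positivity
  have hval : ∀ v σ, cupProd (extendFin e d) (extendFin e fun j => ∑ j' ∈ S j, blockAngle d j') N
      (gridPoint d L ∘ kuhnPath (gridStep d (blockEquiv d e) L) v σ) =
      ∏ j : Fin N, ∑ j' ∈ (S (e j)).attach, ∏ i : Fin (d j'),
        if blockEquiv d e (σ ⟨_, offset_lt d e j (Fin.cast (hS' _ j' j'.2).1 i)⟩) = ⟨j', i⟩ then
          2 * Real.pi / L else 0 := by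
    intro v σ
    rw [cupProd, Finset.prod_range]
    refine Finset.prod_congr rfl fun j _ => ?_
    rw [extendFin_val, Finset.sum_apply, ← Finset.sum_attach]
    exact Finset.sum_congr rfl fun j' _ => blockAngle_gridPoint d e hL v σ j j' _
  have hnn : ∀ v σ, 0 ≤ cupProd (extendFin e d)
      (extendFin e fun j => ∑ j' ∈ S j, blockAngle d j') N
      (gridPoint d L ∘ kuhnPath (gridStep d (blockEquiv d e) L) v σ) := by
    intro v σ
    rw [hval]
    refine Finset.prod_nonneg fun j _ => Finset.sum_nonneg fun j' _ =>
      Finset.prod_nonneg fun i _ => ?_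
    split_ifs
    exacts [hπ.le, le_rfl]
  have hterm : ∀ v σ, 0 ≤ ((Equiv.Perm.sign σ : ℤ) : ℝ) * cupProd (extendFin e d)
      (extendFin e fun j => ∑ j' ∈ S j, blockAngle d j') N
      (gridPoint d L ∘ kuhnPath (gridStep d (blockEquiv d e) L) v σ) := by
    intro v σ
    by_cases h0 : cupProd (extendFin e d)
      (extendFin e fun j => ∑ j' ∈ S j, blockAngle d j') N
      (gridPoint d L ∘ kuhnPath (gridStep d (blockEquiv d e) L) v σ) = 0
    · rw [h0, mul_zero]
    have h1 : ∀ j : Fin N, ∃ j' ∈ S (e j), ∀ (hd : d j' = d (e j)) (i : Fin (d j')),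
        blockEquiv d e (σ ⟨_, offset_lt d e j (Fin.cast hd i)⟩) = ⟨j', i⟩ := by
      intro j
      rw [hval, Finset.prod_eq_zero_iff] at h0
      push Not at h0
      obtain ⟨j', -, hj'⟩ := Finset.exists_ne_zero_of_sum_ne_zero (h0 j (Finset.mem_univ _))
      refine ⟨j', j'.2, fun hd i => ?_⟩
      by_contra hi
      exact hj' (Finset.prod_eq_zero (Finset.mem_univ i) (if_neg hi))
    choose φ hφ hφσ using h1
    have hsgn : Equiv.Perm.sign ((blockEquiv d e).permCongr σ) = 1 := by
      refine sign_blockPerm d _ (fun j => φ (e.symm j)) ?_ ?_ ?_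
      · intro j
        have := (hS' _ _ (hφ (e.symm j))).1
        rwa [e.apply_symm_apply] at this
      · intro j hj
        have := (hS' _ _ (hφ (e.symm j))).2
        rw [e.apply_symm_apply] at this
        by_contra h
        exact Nat.not_even_iff_odd.mpr hj (this h)
      · rintro ⟨j, i⟩
        obtain ⟨j, rfl⟩ := e.surjective j
        have hd := (hS' _ _ (hφ j)).1
        rw [Equiv.permCongr_apply, (Equiv.symm_apply_eq _).mpr (blockEquiv_apply' d e j i).symm]
        have := hφσ j hd (Fin.cast hd.symm i)
        simp only [Fin.cast_cast, Fin.cast_eq_self] at this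
        rw [this]
        refine Sigma.ext (by simp) ((Fin.heq_ext_iff (by simp)).mpr (by simp))
    rw [Equiv.Perm.sign_permCongr] at hsgn
    rw [hsgn]
    simpa using hnn v σ
  refine Finset.sum_pos' (fun v _ => Finset.sum_nonneg fun σ _ => hterm v σ)
    ⟨0, Finset.mem_univ _, ?_⟩
  refine Finset.sum_pos' (fun σ _ => hterm 0 σ) ⟨1, Finset.mem_univ _, ?_⟩
  rw [Equiv.Perm.sign_one, hval]
  rw [Units.val_one, Int.cast_one, one_mul]
  refine Finset.prod_pos fun j _ => ?_
  refine Finset.sum_pos' (fun j' _ => Finset.prod_nonneg fun i _ => ?_)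
    ⟨⟨e j, hS _⟩, Finset.mem_attach _ _, Finset.prod_pos fun i _ => ?_⟩
  · split_ifs
    exacts [hπ.le, le_rfl]
  · rw [if_pos]
    · exact hπ
    · simpa using blockEquiv_apply' d e j i

end Blocks

theorem kuhnEval_add {A T : Type*} [AddCommGroup A] [Fintype A] {D : ℕ} (w : Fin D → A)
    (pt : A → T) (F G : Cochain T) :
    kuhnEval w pt (F + G) = kuhnEval w pt F + kuhnEval w pt G := by
  simp only [kuhnEval, Pi.add_apply, mul_add, Finset.sum_add_distrib]

theorem kuhnEval_smul {A T : Type*} [AddCommGroup A] [Fintype A] {D : ℕ} (w : Fin D → A)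
    (pt : A → T) (c : ℝ) (F : Cochain T) :
    kuhnEval w pt (c • F) = c * kuhnEval w pt F := by
  simp only [kuhnEval, Pi.smul_apply, smul_eq_mul, Finset.mul_sum]
  exact Finset.sum_congr rfl fun _ _ => Finset.sum_congr rfl fun _ _ => by ring

theorem Iio_add_one (p : ℕ) : Iio (p + 1) = Iic p := by
  ext; simp

theorem isCocycle_of_cohom {T : Type*} [TopologicalSpace T] {p : ℕ} {F F' : Cochain T}
    (hF : IsCocycle p F) (hF' : DependsOn F' (Iic p)) (h : Cohom p F F') : IsCocycle p F' := by
  obtain ⟨G, hG, -, e⟩ := h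
  refine (hF.add ((isCocycle_coboundary hG).smul (-1))).of_locEq hF' ?_
  intro z
  filter_upwards [e z] with O hO x hx
  simp [hO x hx]

theorem cupProd_smul {T : Type*} (d : ℕ → ℕ) (C : ℕ → ℝ) (F : ℕ → Cochain T) (N : ℕ) :
    cupProd d (fun j => C j • F j) N = (∏ j ∈ Finset.range N, C j) • cupProd d F N := by
  funext x
  simp [cupProd, Finset.prod_mul_distrib]

theorem dependsOn_blockAngle {J : Type*} (d : J → ℕ) (j : J) :
    DependsOn (blockAngle d j) (Iic (d j)) := by
  intro x y h
  refine Finset.prod_congr rfl fun i _ => ?_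
  simp only [angle]
  rw [h (1 + i) (by have := i.2; simp only [mem_Iic]; omega),
    h (0 + i) (by have := i.2; simp only [mem_Iic]; omega)]

theorem DependsOn.sum' {T ι : Type*} {p : Set ℕ} {s : Finset ι} {F : ι → Cochain T}
    (h : ∀ i ∈ s, DependsOn (F i) p) : DependsOn (∑ i ∈ s, F i) p := by
  intro x y hxy
  simp only [Finset.sum_apply]
  exact Finset.sum_congr rfl fun i hi => h i hi hxy

theorem exists_uniform_coboundary {M J : Type*} [TopologicalSpace M] [CompactSpace M]
    (d : J → ℕ) (A : J → Cochain M) (G : J → ℕ → Cochain M)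
    (hcov : ∀ p : M, ∃ j, ∀ᶠ O in (𝓝 p).smallSets, ∀ᶠ L in Filter.atTop, ∀ x : ℕ → M,
      (∀ k, x k ∈ O) → A j x = coboundary (d j) (G j L) x) :
    ∃ L, ∀ p : M, ∃ j, ∀ᶠ O in (𝓝 p).smallSets, ∀ x : ℕ → M,
      (∀ k, x k ∈ O) → A j x = coboundary (d j) (G j L) x := by
  suffices ∀ᶠ L in Filter.atTop, ∀ p ∈ (univ : Set M), ∃ j, ∀ᶠ O in (𝓝 p).smallSets,
      ∀ x : ℕ → M, (∀ k, x k ∈ O) → A j x = coboundary (d j) (G j L) x by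
    obtain ⟨L, hL⟩ := this.exists
    exact ⟨L, fun p => hL p (mem_univ p)⟩
  refine isCompact_univ.induction_on (p := fun s => ∀ᶠ L in Filter.atTop, ∀ p ∈ s, ∃ j,
      ∀ᶠ O in (𝓝 p).smallSets, ∀ x : ℕ → M, (∀ k, x k ∈ O) → A j x = coboundary (d j) (G j L) x)
      (by simp) ?_ ?_ ?_
  · intro s t hst ht
    filter_upwards [ht] with L hL p hp using hL p (hst hp)
  · intro s t hs ht
    filter_upwards [hs, ht] with L hL hL' p hp
    exact hp.elim (hL p) (hL' p)
  · intro p _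
    obtain ⟨j, hj⟩ := hcov p
    obtain ⟨O, hO, H⟩ := Filter.eventually_smallSets.mp hj
    obtain ⟨O', hO', h2, h3⟩ := mem_nhds_iff.mp hO
    refine ⟨O', mem_nhdsWithin_of_mem_nhds (h2.mem_nhds h3), ?_⟩
    filter_upwards [H O' hO'] with L hL q hq
    refine ⟨j, Filter.eventually_smallSets.mpr ⟨O', h2.mem_nhds hq, fun t ht x hx =>
      hL x fun k => ht (hx k)⟩⟩

theorem false_of_torus_cover {J : Type*} [Fintype J] [DecidableEq J] (d : J → ℕ)
    (A : J → Cochain ((Σ j, Fin (d j)) → Circle)) (C : J → ℝ) (S : J → Finset J)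
    (hA : ∀ j, IsCocycle (d j) (A j)) (hC : ∀ j, C j ≠ 0)
    (hcoh : ∀ j, Cohom (d j) (A j) (C j • ∑ j' ∈ S j, blockAngle d j'))
    (hS : ∀ j, j ∈ S j) (hS' : ∀ j, ∀ j' ∈ S j, d j' = d j ∧ (j' ≠ j → Even (d j)))
    (G : J → ℕ → Cochain ((Σ j, Fin (d j)) → Circle))
    (hG : ∀ j L, DependsOn (G j L) (Iio (d j))) (hd : ∀ j, d j ≠ 0)
    (hcov : ∀ p, ∃ j, ∀ᶠ O in (𝓝 p).smallSets, ∀ᶠ L in Filter.atTop, ∀ x : ℕ → _,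
      (∀ k, x k ∈ O) → A j x = coboundary (d j) (G j L) x) : False := by
  obtain ⟨L, hL⟩ := exists_uniform_coboundary d A G hcov
  let e : Fin (Fintype.card J) ≃ J := (Fintype.equivFin J).symm
  let B : J → Cochain ((Σ j, Fin (d j)) → Circle) :=
    fun j => A j + (-1 : ℝ) • coboundary (d j) (G j L)
  let W : J → Cochain ((Σ j, Fin (d j)) → Circle) := fun j => ∑ j' ∈ S j, blockAngle d j'
  have hB : ∀ j, IsCocycle (d j) (B j) := fun j =>
    (hA j).add ((isCocycle_coboundary (hG j L)).smul _)
  have hBA : ∀ j, Cohom (d j) (B j) (A j) := fun j =>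
    ⟨(-1 : ℝ) • G j L, DependsOn.smul' _ (hG j L), fun h => absurd h (hd j), by
      rw [coboundary_smul]; exact .refl _⟩
  have hBW : ∀ j, Cohom (d j) (B j) (C j • W j) := fun j => (hBA j).trans (hcoh j)
  have hW : ∀ j, IsCocycle (d j) (C j • W j) := fun j =>
    isCocycle_of_cohom (hB j) (DependsOn.smul' _ (DependsOn.sum' fun j' hj' =>
      (hS' j j' hj').1 ▸ dependsOn_blockAngle d j')) (hBW j)
  obtain ⟨K, hK, hK0, hKe⟩ := cohom_cupProd (d := extendFin e d) (F := extendFin e B)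
    (F' := extendFin e fun j => C j • W j) (N := Fintype.card J)
    (fun j hj => by simpa [extendFin, hj] using hB _)
    (fun j hj => by simpa [extendFin, hj] using hW _)
    (fun j hj => by simpa [extendFin, hj] using hBW _)
  have hzero : LocEq (cupProd (extendFin e d) (extendFin e B) (Fintype.card J)) 0 := by
    intro p
    obtain ⟨j, hj⟩ := hL p
    filter_upwards [hj] with O hO x hx
    obtain ⟨i, rfl⟩ := e.surjective j
    refine Finset.prod_eq_zero (Finset.mem_range.mpr i.2) ?_
    rw [extendFin_val]
    simp only [B, Pi.add_apply, Pi.smul_apply, smul_eq_mul]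
    rw [hO _ fun k => hx _]
    ring
  obtain ⟨L', _, hL', hev⟩ := exists_kuhnEval_eq_zero d (blockEquiv d e) (hKe.symm.trans hzero)
  have hcob : kuhnEval (gridStep d (blockEquiv d e) L') (gridPoint d L')
      (coboundary (∑ i ∈ Finset.range (Fintype.card J), extendFin e d i) K) = 0 := by
    generalize blockEquiv d e = E at *
    generalize ∑ i ∈ Finset.range (Fintype.card J), extendFin e d i = D at *
    rcases D with _ | D
    · rw [hK0 rfl, coboundary_zero]
      simp [kuhnEval]
    · rw [Iio_add_one] at hK
      exact kuhnEval_coboundary _ _ hK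
  have hsm : (extendFin e fun j => C j • W j) = fun j => extendFin e C j • extendFin e W j := by
    funext j
    by_cases h : j < Fintype.card J <;> simp [extendFin, h]
  rw [kuhnEval_add, hcob, add_zero, hsm, cupProd_smul, kuhnEval_smul] at hev
  rcases mul_eq_zero.mp hev with h | h
  · obtain ⟨j, hj, hj0⟩ := Finset.prod_eq_zero_iff.mp h
    rw [Finset.mem_range] at hj
    exact hC (e ⟨j, hj⟩) (by simpa [extendFin, hj] using hj0)
  · exact (kuhnEval_pos d e S hS hS' hL').ne' h

section Local

variable {T : Type*}

theorem coboundary_one_apply (G : Cochain T) (x : ℕ → T) :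
    coboundary 1 G x = G (fun k => x (k + 1)) - G (x ∘ skip 1) := by
  have : x ∘ skip 0 = fun k => x (k + 1) := by
    funext k; simp [skip]
  simp [coboundary, Finset.sum_range_succ, this, sub_eq_add_neg]

/-- The cochain of degree zero given by a function. -/
def ofFun (g : T → ℝ) : Cochain T := fun x => g (x 0)

theorem dependsOn_ofFun (g : T → ℝ) : DependsOn (ofFun g) (Iio 1) := fun x y h => by
  simp [ofFun, h 0 (by simp)]

theorem coboundary_ofFun (g : T → ℝ) (x : ℕ → T) :
    coboundary 1 (ofFun g) x = g (x 1) - g (x 0) := by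
  rw [coboundary_one_apply]
  simp [ofFun, skip]

theorem dependsOn_angle (θ : T → Circle) : DependsOn (angle θ) (Iic 1) := fun x y h => by
  simp [angle, h 0 (by simp), h 1 (by simp)]

/-- The cochain counting (with the factor `2π`) the crossings of a circle-valued map through the
point `-1`. -/
noncomputable def crossing (θ : T → Circle) : Cochain T :=
  fun x => angle θ x - (Complex.arg (θ (x 1) : ℂ) - Complex.arg (θ (x 0) : ℂ))

theorem dependsOn_crossing (θ : T → Circle) : DependsOn (crossing θ) (Iic 1) := fun x y h => by
  simp [crossing, angle, h 0 (by simp), h 1 (by simp)]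

variable [TopologicalSpace T]

theorem eventually_smallSets_pair {p : T} {P : T → T → Prop}
    (h : ∀ᶠ q : T × T in 𝓝 (p, p), P q.1 q.2) :
    ∀ᶠ O in (𝓝 p).smallSets, ∀ a ∈ O, ∀ b ∈ O, P a b := by
  rw [nhds_prod_eq, Filter.eventually_prod_self_iff] at h
  obtain ⟨t, ht, H⟩ := h
  exact Filter.eventually_smallSets.mpr ⟨t, ht, fun s hs a ha b hb => H a (hs ha) b (hs hb)⟩

theorem eventually_smallSets_mem {p : T} {P : T → Prop} (h : ∀ᶠ q in 𝓝 p, P q) :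
    ∀ᶠ O in (𝓝 p).smallSets, ∀ a ∈ O, P a :=
  Filter.eventually_smallSets.mpr ⟨_, h, fun _ hs _ ha => hs ha⟩

theorem isCocycle_of_local {p : ℕ} {F : Cochain T} (hF : DependsOn F (Iic p))
    (h : ∀ z, ∃ F', IsCocycle p F' ∧ ∀ᶠ O in (𝓝 z).smallSets, ∀ x : ℕ → T, (∀ k, x k ∈ O) →
      F x = F' x) : IsCocycle p F := by
  refine ⟨hF, fun z => ?_⟩
  obtain ⟨F', hF', e⟩ := h z
  filter_upwards [hF'.2 z, e] with O h1 h2 x hx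
  rw [← h1 x hx]
  exact Finset.sum_congr rfl fun i _ => by rw [h2 (x ∘ skip i) fun k => hx _]

theorem eventually_abs_arg_div_lt {θ : T → Circle} (hθ : Continuous θ) (p : T) {ε : ℝ}
    (hε : 0 < ε) :
    ∀ᶠ O in (𝓝 p).smallSets, ∀ a ∈ O, ∀ b ∈ O, |Complex.arg ((θ b / θ a : Circle) : ℂ)| < ε := by
  refine eventually_smallSets_pair (P := fun a b => |Complex.arg ((θ b / θ a : Circle) : ℂ)| < ε) ?_
  have h1 : Continuous fun q : T × T => ((θ q.2 / θ q.1 : Circle) : ℂ) :=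
    continuous_subtype_val.comp ((hθ.comp continuous_snd).div' (hθ.comp continuous_fst))
  have h2 : ContinuousAt (fun q : T × T => |Complex.arg ((θ q.2 / θ q.1 : Circle) : ℂ)|) (p, p) :=
    ((Complex.continuousAt_arg (by simp)).comp h1.continuousAt).abs
  refine h2.eventually_lt continuousAt_const ?_
  simpa using hε

theorem arg_mul_circle {u v : Circle}
    (h : Complex.arg (u : ℂ) + Complex.arg (v : ℂ) ∈ Ioc (-Real.pi) Real.pi) :
    Complex.arg ((u * v : Circle) : ℂ) = Complex.arg (u : ℂ) + Complex.arg (v : ℂ) := by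
  rw [Circle.coe_mul]
  exact Complex.arg_mul (Circle.coe_ne_zero u) (Circle.coe_ne_zero v) h

theorem eventually_arg_div {θ : T → Circle} (hθ : Continuous θ) (p : T) :
    ∀ᶠ O in (𝓝 p).smallSets, ∀ a ∈ O, ∀ b ∈ O, Complex.arg ((θ b / θ a : Circle) : ℂ) =
      Complex.arg ((θ b / θ p : Circle) : ℂ) - Complex.arg ((θ a / θ p : Circle) : ℂ) := by
  have hπ := Real.pi_pos
  have h1 : ∀ᶠ O in (𝓝 p).smallSets, ∀ a ∈ O,
      |Complex.arg ((θ a / θ p : Circle) : ℂ)| < Real.pi / 2 := by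
    refine eventually_smallSets_mem ?_
    have h2 : ContinuousAt (fun q : T => |Complex.arg ((θ q / θ p : Circle) : ℂ)|) p :=
      ((Complex.continuousAt_arg (by simp)).comp
        (by fun_prop : Continuous fun q => ((θ q / θ p : Circle) : ℂ)).continuousAt).abs
    refine h2.eventually_lt continuousAt_const ?_
    simpa using hπ
  filter_upwards [eventually_abs_arg_div_lt hθ p (show 0 < Real.pi / 2 by positivity), h1]
    with O h2 h3 a ha b hb
  have h4 := abs_lt.mp (h2 a ha b hb)
  have h5 := abs_lt.mp (h3 a ha)
  have h6 := arg_mul_circle (u := θ b / θ a) (v := θ a / θ p) ⟨by linarith, by linarith⟩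
  rw [div_mul_div_cancel] at h6
  linarith

theorem isCocycle_coboundary_ofFun (g : T → ℝ) : IsCocycle 1 (coboundary 1 (ofFun g)) :=
  isCocycle_coboundary (dependsOn_ofFun g)

theorem isCocycle_angle {θ : T → Circle} (hθ : Continuous θ) : IsCocycle 1 (angle θ) := by
  refine isCocycle_of_local (dependsOn_angle θ) fun z =>
    ⟨_, isCocycle_coboundary_ofFun fun y => Complex.arg ((θ y / θ z : Circle) : ℂ), ?_⟩
  filter_upwards [eventually_arg_div hθ z] with O hO x hx
  rw [coboundary_ofFun]
  exact hO _ (hx 0) _ (hx 1)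

theorem locEq_angle_inv {θ : T → Circle} (hθ : Continuous θ) :
    LocEq (angle θ⁻¹) ((-1 : ℝ) • angle θ) := by
  intro p
  filter_upwards [eventually_abs_arg_div_lt hθ p Real.pi_pos] with O hO x hx
  have h := hO _ (hx 0) _ (hx 1)
  have h1 : (θ⁻¹ (x 1) / θ⁻¹ (x 0) : Circle) = (θ (x 1) / θ (x 0))⁻¹ := by
    simp only [Pi.inv_apply]; rw [inv_div_inv, inv_div]
  simp only [angle, Pi.smul_apply, smul_eq_mul, h1, Circle.coe_inv]
  rw [Complex.arg_inv, if_neg]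
  · ring
  · intro h2
    rw [h2, abs_of_pos Real.pi_pos] at h
    exact lt_irrefl _ h

theorem cohom_angle_crossing (θ : T → Circle) : Cohom 1 (angle θ) (crossing θ) := by
  refine ⟨ofFun fun y => Complex.arg (θ y : ℂ), dependsOn_ofFun _, by simp, ?_⟩
  intro p
  refine .of_forall fun O x hx => ?_
  rw [Pi.add_apply, coboundary_ofFun, crossing]
  ring

theorem isCocycle_crossing {θ : T → Circle} (hθ : Continuous θ) : IsCocycle 1 (crossing θ) :=
  isCocycle_of_cohom (isCocycle_angle hθ) (dependsOn_crossing θ) (cohom_angle_crossing θ)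

/-- The indicator of the open lower half plane. -/
noncomputable def lower (u : Circle) : ℝ := if (u : ℂ).im < 0 then 1 else 0

theorem eventually_crossing_of_ne {θ : T → Circle} (hθ : Continuous θ) {p : T} (hp : θ p ≠ -1) :
    ∀ᶠ O in (𝓝 p).smallSets, ∀ x : ℕ → T, (∀ k, x k ∈ O) → crossing θ x = 0 := by
  have hslit : (θ p : ℂ) ∈ Complex.slitPlane := by
    rw [Complex.mem_slitPlane_iff_arg]
    refine ⟨fun h => hp ?_, Circle.coe_ne_zero _⟩
    have := Complex.norm_mul_exp_arg_mul_I (θ p : ℂ)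
    rw [h, Circle.norm_coe, Complex.ofReal_one, one_mul, Complex.exp_pi_mul_I] at this
    exact Circle.ext (by rw [← this]; rfl)
  have hlt : |Complex.arg (θ p : ℂ)| < Real.pi := by
    refine lt_of_le_of_ne (Complex.abs_arg_le_pi _) fun h => ?_
    have h1 := (Complex.mem_slitPlane_iff_arg.mp hslit).1
    have h2 := Complex.neg_pi_lt_arg (θ p : ℂ)
    rcases abs_eq Real.pi_pos.le |>.mp h with h | h
    · exact h1 h
    · linarith
  set ε := (Real.pi - |Complex.arg (θ p : ℂ)|) / 2 with hε
  have hε0 : 0 < ε := by rw [hε]; linarith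
  have h1 : ∀ᶠ O in (𝓝 p).smallSets, ∀ a ∈ O, |Complex.arg (θ a : ℂ)| < Real.pi - ε := by
    refine eventually_smallSets_mem ?_
    have h2 : ContinuousAt (fun q : T => |Complex.arg (θ q : ℂ)|) p :=
      (ContinuousAt.comp (f := fun q => (θ q : ℂ)) (Complex.continuousAt_arg hslit)
        (by fun_prop : Continuous fun q => (θ q : ℂ)).continuousAt).abs
    refine h2.eventually_lt continuousAt_const ?_
    rw [hε]; linarith
  filter_upwards [h1, eventually_abs_arg_div_lt hθ p hε0] with O h1 h2 x hx
  have h3 := abs_lt.mp (h1 _ (hx 0))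
  have h4 := abs_lt.mp (h2 _ (hx 0) _ (hx 1))
  have h6 := arg_mul_circle (u := θ (x 1) / θ (x 0)) (v := θ (x 0)) ⟨by linarith, by linarith⟩
  rw [div_mul_cancel] at h6
  rw [crossing, angle, h6]
  ring

theorem arg_neg_circle {u : Circle} (hu : (u : ℂ).re < 0) :
    Complex.arg (u : ℂ) = Complex.arg ((-u : Circle) : ℂ) + (1 - 2 * lower u) * Real.pi := by
  have hn : ((-u : Circle) : ℂ) = -(u : ℂ) := rfl
  rw [hn, lower]
  split_ifs with h
  · rw [Complex.arg_neg_eq_arg_add_pi_of_im_neg h]; ring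
  · rcases (not_lt.mp h).lt_or_eq with h | h
    · rw [Complex.arg_neg_eq_arg_sub_pi_of_im_pos h]; ring
    · rw [Complex.arg_eq_pi_iff.mpr ⟨hu, h.symm⟩, Complex.arg_eq_zero_iff.mpr
        ⟨by simp; linarith, by simp [← h]⟩]
      ring

theorem eventually_crossing_of_eq {θ : T → Circle} (hθ : Continuous θ) {p : T} (hp : θ p = -1) :
    ∀ᶠ O in (𝓝 p).smallSets, ∀ x : ℕ → T, (∀ k, x k ∈ O) →
      crossing θ x = 2 * Real.pi * (lower (θ (x 1)) - lower (θ (x 0))) := by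
  have h1 : ∀ᶠ O in (𝓝 p).smallSets, ∀ a ∈ O, (θ a : ℂ).re < 0 := by
    refine eventually_smallSets_mem ?_
    have h2 : Continuous fun q : T => (θ q : ℂ).re := by fun_prop
    refine h2.continuousAt.eventually_lt continuousAt_const ?_
    rw [hp]
    show (-1 : ℂ).re < 0
    simp
  filter_upwards [h1, eventually_arg_div hθ p] with O h1 h2 x hx
  have hd : ∀ u : Circle, u / -1 = -u := fun u => by
    apply Circle.ext
    rw [Circle.coe_div]
    show (u : ℂ) / (-1 : ℂ) = -(u : ℂ)
    rw [div_neg, div_one]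
  have h3 := h2 _ (hx 0) _ (hx 1)
  rw [hp, hd, hd] at h3
  rw [crossing, angle, h3, arg_neg_circle (h1 _ (hx 0)), arg_neg_circle (h1 _ (hx 1))]
  ring

end Local

/-- The cup product of `m` cochains of degree one. -/
def prodOne {T : Type*} {m : ℕ} (F : Fin m → Cochain T) : Cochain T :=
  fun x => ∏ i : Fin m, F i fun k => x (k + i)

theorem prodOne_eq_cupProd {T : Type*} {m : ℕ} (F : Fin m → Cochain T) :
    prodOne F = cupProd (fun _ => 1) (extendFin (Equiv.refl _) F) m := by
  funext x
  simp only [cupProd, Finset.prod_range, extendFin_val]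
  simp [prodOne]

theorem prodOne_smul {T : Type*} {m : ℕ} (c : Fin m → ℝ) (F : Fin m → Cochain T) :
    prodOne (fun i => c i • F i) = (∏ i, c i) • prodOne F := by
  funext x
  simp [prodOne, Finset.prod_mul_distrib]

section ProdOne

variable {T : Type*} [TopologicalSpace T] {m : ℕ} {F F' : Fin m → Cochain T}

theorem isCocycle_prodOne (hF : ∀ i, IsCocycle 1 (F i)) : IsCocycle m (prodOne F) := by
  rw [prodOne_eq_cupProd]
  convert isCocycle_cupProd (d := fun _ => 1) (F := extendFin (Equiv.refl _) F) (N := m) ?_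
  · simp
  · intro j hj
    simpa [extendFin, hj] using hF _

theorem cohom_prodOne (hF : ∀ i, IsCocycle 1 (F i)) (hF' : ∀ i, IsCocycle 1 (F' i))
    (h : ∀ i, Cohom 1 (F i) (F' i)) : Cohom m (prodOne F) (prodOne F') := by
  rw [prodOne_eq_cupProd, prodOne_eq_cupProd]
  convert cohom_cupProd (d := fun _ => 1) (F := extendFin (Equiv.refl _) F)
    (F' := extendFin (Equiv.refl _) F') (N := m) ?_ ?_ ?_
  · simp
  · intro j hj
    simpa [extendFin, hj] using hF _
  · intro j hj
    simpa [extendFin, hj] using hF' _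
  · intro j hj
    simpa [extendFin, hj] using h _

theorem locEq_prodOne (h : ∀ i, LocEq (F i) (F' i)) : LocEq (prodOne F) (prodOne F') := by
  intro p
  have : ∀ᶠ O in (𝓝 p).smallSets, ∀ i, ∀ x : ℕ → T, (∀ k, x k ∈ O) → F i x = F' i x :=
    Filter.eventually_all.mpr fun i => h i p
  filter_upwards [this] with O hO x hx
  exact Finset.prod_congr rfl fun i _ => hO i _ fun k => hx _

end ProdOne

/-- The indicator of the negative reals. -/
noncomputable def negInd (t : ℝ) : ℝ := if t < 0 then 1 else 0

theorem eventually_negInd {T : Type*} [TopologicalSpace T] {g : T → ℝ} (hg : Continuous g) {p : T}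
    (hp : g p ≠ 0) : ∀ᶠ O in (𝓝 p).smallSets, ∀ a ∈ O, negInd (g a) = negInd (g p) := by
  refine eventually_smallSets_mem ?_
  rcases hp.lt_or_gt with h | h
  · filter_upwards [hg.continuousAt.eventually_lt continuousAt_const h] with q hq
    simp [negInd, h, hq]
  · filter_upwards [continuousAt_const.eventually_lt hg.continuousAt h] with q hq
    simp [negInd, h.not_gt, hq.not_gt]

/-- A cocycle representing a generator of the top cohomology of the sphere. -/
noncomputable def sphereClass (m : ℕ) : Cochain (Sph m) :=
  fun x => negInd (-(x 0).1 0) *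
    prodOne (fun i : Fin m => coboundary 1 (ofFun fun y : Sph m => negInd (y.1 i.succ))) x

theorem continuous_sph_coord (m : ℕ) (i : Fin (m + 1)) : Continuous fun y : Sph m => y.1 i :=
  (PiLp.continuous_apply 2 _ i).comp continuous_subtype_val

theorem isCocycle_sphereClass (m : ℕ) : IsCocycle m (sphereClass m) := by
  refine isCocycle_of_local ?_ fun p => ?_
  · intro x y h
    have h0 : x 0 = y 0 := h 0 (by simp)
    have h1 := (isCocycle_prodOne fun i : Fin m =>
      isCocycle_coboundary_ofFun fun y : Sph m => negInd (y.1 i.succ)).1 h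
    simp only [sphereClass]
    rw [h0, h1]
  by_cases h0 : p.1 0 = 0
  · refine ⟨0, IsCocycle.zero m, ?_⟩
    obtain ⟨i, hi⟩ : ∃ i : Fin m, p.1 i.succ ≠ 0 := by
      by_contra! h
      have h1 : p.1 = 0 := by
        ext i
        refine Fin.cases h0 h i
      have h2 := p.2
      rw [h1] at h2
      simp at h2
    filter_upwards [eventually_negInd (continuous_sph_coord m i.succ) hi] with O hO x hx
    refine mul_eq_zero_of_right _ (Finset.prod_eq_zero (Finset.mem_univ i) ?_)
    simp only [coboundary_ofFun]
    rw [hO _ (hx _), hO _ (hx _), sub_self]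
  · refine ⟨_, (isCocycle_prodOne fun i : Fin m =>
      isCocycle_coboundary_ofFun fun y : Sph m => negInd (y.1 i.succ)).smul (negInd (-p.1 0)), ?_⟩
    filter_upwards [eventually_negInd (continuous_sph_coord m 0).neg (neg_ne_zero.mpr h0)]
      with O hO x hx
    exact congrArg (· * _) (hO _ (hx 0))

section SphereMap

variable {T : Type*} {m : ℕ}

/-- A map from an `m`-torus to `ℝ^{m+1} ∖ 0` of degree one. -/
noncomputable def sphereVec (θ : Fin m → T → Circle) (x : T) : EuclideanSpace ℝ (Fin (m + 1)) :=
  WithLp.toLp 2 (Fin.cons (1 - ∑ i, ((θ i x : ℂ).re + 1)) fun i => (θ i x : ℂ).im)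

theorem circle_re_of_im {u : Circle} (h : (u : ℂ).im = 0) : u = -1 ∨ (u : ℂ).re = 1 := by
  have h1 : (u : ℂ).re * (u : ℂ).re + (u : ℂ).im * (u : ℂ).im = 1 := by
    rw [← Complex.normSq_apply]; exact Circle.normSq_coe u
  rw [h, mul_zero, add_zero] at h1
  rcases mul_self_eq_one_iff.mp h1 with h2 | h2
  · exact .inr h2
  · exact .inl (Circle.ext (Complex.ext h2 (h.trans (by
      show (0 : ℝ) = (-1 : ℂ).im
      simp))))

theorem circle_re_ge (u : Circle) : 0 ≤ (u : ℂ).re + 1 := by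
  have h1 := Complex.abs_re_le_norm (u : ℂ)
  rw [Circle.norm_coe] at h1
  linarith [(abs_le.mp h1).1]

theorem sphereVec_zero (θ : Fin m → T → Circle) (x : T) :
    sphereVec θ x 0 = 1 - ∑ i, ((θ i x : ℂ).re + 1) := rfl

theorem sphereVec_succ (θ : Fin m → T → Circle) (x : T) (i : Fin m) :
    sphereVec θ x i.succ = (θ i x : ℂ).im := rfl

theorem sphereVec_pos {θ : Fin m → T → Circle} {x : T} (h : ∀ i, θ i x = -1) :
    0 < sphereVec θ x 0 := by
  rw [sphereVec_zero, Finset.sum_eq_zero]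
  · simp
  · intro i _
    rw [h i]
    show (-1 : ℂ).re + 1 = 0
    simp

theorem sphereVec_neg {θ : Fin m → T → Circle} {x : T} (h : ∀ i, (θ i x : ℂ).im = 0)
    (h' : ¬ ∀ i, θ i x = -1) : sphereVec θ x 0 < 0 := by
  push Not at h'
  obtain ⟨i, hi⟩ := h'
  have h1 := (circle_re_of_im (h i)).resolve_left hi
  have h2 := Finset.single_le_sum (f := fun i => (θ i x : ℂ).re + 1)
    (fun j _ => circle_re_ge (θ j x)) (Finset.mem_univ i)
  rw [sphereVec_zero]
  simp only [h1] at h2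
  linarith

theorem sphereVec_ne_zero (θ : Fin m → T → Circle) (x : T) : sphereVec θ x ≠ 0 := by
  intro h
  have h1 : ∀ i, (θ i x : ℂ).im = 0 := fun i => by rw [← sphereVec_succ, h]; rfl
  have h2 : sphereVec θ x 0 = 0 := by rw [h]; rfl
  by_cases h3 : ∀ i, θ i x = -1
  · exact (sphereVec_pos h3).ne' h2
  · exact (sphereVec_neg h1 h3).ne h2

/-- A map from an `m`-torus to `S^m` of degree one. -/
noncomputable def sphereMap (θ : Fin m → T → Circle) (x : T) : Sph m :=
  ⟨‖sphereVec θ x‖⁻¹ • sphereVec θ x, by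
    rw [mem_sphere_zero_iff_norm, norm_smul, norm_inv, norm_norm,
      inv_mul_cancel₀ (norm_ne_zero_iff.mpr (sphereVec_ne_zero θ x))]⟩

theorem negInd_mul {c : ℝ} (hc : 0 < c) (t : ℝ) : negInd (c * t) = negInd t := by
  simp only [negInd, mul_neg_iff, hc, hc.not_gt, true_and, false_and, or_false]

theorem negInd_sphereMap (θ : Fin m → T → Circle) (x : T) (i : Fin (m + 1)) :
    negInd ((sphereMap θ x).1 i) = negInd (sphereVec θ x i) :=
  negInd_mul (inv_pos.mpr (norm_pos_iff.mpr (sphereVec_ne_zero θ x))) _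

theorem negInd_neg_sphereMap (θ : Fin m → T → Circle) (x : T) (i : Fin (m + 1)) :
    negInd (-(sphereMap θ x).1 i) = negInd (-sphereVec θ x i) := by
  rw [← negInd_mul (inv_pos.mpr (norm_pos_iff.mpr (sphereVec_ne_zero θ x))) (-sphereVec θ x i),
    mul_neg]
  rfl

variable [TopologicalSpace T]

theorem continuous_sphereVec {θ : Fin m → T → Circle} (hθ : ∀ i, Continuous (θ i)) :
    Continuous (sphereVec θ) := by
  refine (PiLp.continuous_toLp 2 _).comp (continuous_pi fun i => ?_)
  refine Fin.cases ?_ (fun i => ?_) i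
  · simp only [Fin.cons_zero]
    fun_prop
  · simp only [Fin.cons_succ]
    fun_prop

theorem continuous_sphereMap {θ : Fin m → T → Circle} (hθ : ∀ i, Continuous (θ i)) :
    Continuous (sphereMap θ) :=
  (((continuous_sphereVec hθ).norm.inv₀ fun x => norm_ne_zero_iff.mpr
    (sphereVec_ne_zero θ x)).smul (continuous_sphereVec hθ)).subtype_mk _

theorem locEq_pull_sphereClass {θ : Fin m → T → Circle} (hθ : ∀ i, Continuous (θ i)) :
    LocEq (pull (sphereMap θ) (sphereClass m))
      (((2 * Real.pi)⁻¹ ^ m) • prodOne fun i => crossing (θ i)) := by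
  have hπ : (2 * Real.pi) ≠ 0 := by have := Real.pi_pos; positivity
  have hcoord : ∀ i, Continuous fun x => sphereVec θ x i := fun i =>
    (PiLp.continuous_apply 2 _ i).comp (continuous_sphereVec hθ)
  have hneg : Continuous fun x => -sphereVec θ x 0 := (hcoord 0).neg
  have hpull : ∀ x : ℕ → T, pull (sphereMap θ) (sphereClass m) x =
      negInd (-sphereVec θ (x 0) 0) *
        ∏ i : Fin m, (lower (θ i (x (1 + i))) - lower (θ i (x (0 + i)))) := by
    intro x
    simp only [pull, sphereClass, prodOne, coboundary_ofFun, Function.comp,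
      negInd_sphereMap, negInd_neg_sphereMap, sphereVec_succ]
    rfl
  intro p
  by_cases h : ∀ i, θ i p = -1
  · have h0 := sphereVec_pos h
    have h1 := eventually_negInd hneg (neg_ne_zero.mpr h0.ne')
    have h2 : ∀ᶠ O in (𝓝 p).smallSets, ∀ i, ∀ x : ℕ → T, (∀ k, x k ∈ O) →
        crossing (θ i) x = 2 * Real.pi * (lower (θ i (x 1)) - lower (θ i (x 0))) :=
      Filter.eventually_all.mpr fun i => eventually_crossing_of_eq (hθ i) (h i)
    filter_upwards [h1, h2] with O h1 h2 x hx
    rw [hpull, h1 _ (hx 0)]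
    simp only [Pi.smul_apply, smul_eq_mul, prodOne]
    rw [Finset.prod_congr rfl fun i _ => h2 i (fun k => x (k + i)) fun k => hx _,
      Finset.prod_mul_distrib]
    simp only [Finset.prod_const, Finset.card_univ, Fintype.card_fin]
    rw [← mul_assoc, ← mul_pow, inv_mul_cancel₀ hπ, one_pow]
    congr 1
    simp [negInd, h0]
  · have h1 : ∀ᶠ O in (𝓝 p).smallSets, ∀ x : ℕ → T, (∀ k, x k ∈ O) →
        (((2 * Real.pi)⁻¹ ^ m) • prodOne fun i => crossing (θ i)) x = 0 := by
      push Not at h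
      obtain ⟨i, hi⟩ := h
      filter_upwards [eventually_crossing_of_ne (hθ i) hi] with O hO x hx
      exact mul_eq_zero_of_right _ (Finset.prod_eq_zero (Finset.mem_univ i)
        (hO _ fun k => hx _))
    suffices ∀ᶠ O in (𝓝 p).smallSets, ∀ x : ℕ → T, (∀ k, x k ∈ O) →
        pull (sphereMap θ) (sphereClass m) x = 0 by
      filter_upwards [h1, this] with O h1 h2 x hx
      rw [h1 x hx, h2 x hx]
    by_cases h2 : ∀ i, (θ i p : ℂ).im = 0
    · have h3 := sphereVec_neg h2 h
      filter_upwards [eventually_negInd hneg (neg_ne_zero.mpr h3.ne)] with O hO x hx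
      rw [hpull, hO _ (hx 0)]
      simp [negInd, h3.le]
    · push Not at h2
      obtain ⟨i, hi⟩ := h2
      filter_upwards [eventually_negInd (hcoord i.succ) hi] with O hO x hx
      rw [hpull, Finset.prod_eq_zero (Finset.mem_univ i), mul_zero]
      exact sub_eq_zero_of_eq ((hO _ (hx _)).trans (hO _ (hx _)).symm)

theorem cohom_pull_sphereClass {θ : Fin m → T → Circle} (hθ : ∀ i, Continuous (θ i)) :
    Cohom m (pull (sphereMap θ) (sphereClass m))
      (((2 * Real.pi)⁻¹ ^ m) • prodOne fun i => angle (θ i)) :=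
  (locEq_pull_sphereClass hθ).cohom.trans ((cohom_prodOne (fun i => isCocycle_angle (hθ i))
    (fun i => isCocycle_crossing (hθ i)) fun _ => cohom_angle_crossing _).symm.smul _)

end SphereMap

section ProjectiveSpace

variable {n : ℕ}

/-- The point of projective space with the given homogeneous coordinates. -/
def cpMk (v : {v : Fin (n + 1) → ℂ // v ≠ 0}) : CP n := Quot.mk _ v

theorem cpMk_eq_iff {v w : {v : Fin (n + 1) → ℂ // v ≠ 0}} :
    cpMk v = cpMk w ↔ ∃ c : ℂ, w.1 = c • v.1 := by
  refine ⟨fun h => ?_, fun h => Quot.sound h⟩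
  refine (Equivalence.eqvGen_iff ⟨fun v => ⟨1, (one_smul _ _).symm⟩, ?_, ?_⟩).mp
    (Quot.eqvGen_exact h)
  · rintro v w ⟨c, hc⟩
    have hc0 : c ≠ 0 := by
      rintro rfl
      exact w.2 (by rw [hc, zero_smul])
    exact ⟨c⁻¹, by rw [hc, smul_smul, inv_mul_cancel₀ hc0, one_smul]⟩
  · rintro u v w ⟨c, hc⟩ ⟨d, hd⟩
    exact ⟨d * c, by rw [hd, hc, smul_smul]⟩

theorem cpMk_eq_of_smul {v w : {v : Fin (n + 1) → ℂ // v ≠ 0}} {c : ℂ} (h : w.1 = c • v.1) :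
    cpMk v = cpMk w := cpMk_eq_iff.mpr ⟨c, h⟩

theorem cpMk_surjective : Function.Surjective (cpMk (n := n)) := Quot.mk_surjective

theorem isQuotientMap_cpMk : Topology.IsQuotientMap (cpMk (n := n)) := isQuotientMap_quot_mk

theorem continuous_cpMk : Continuous (cpMk (n := n)) := isQuotientMap_cpMk.continuous

theorem isOpenMap_cpMk : IsOpenMap (cpMk (n := n)) := by
  intro U hU
  rw [← isQuotientMap_cpMk.isOpen_preimage]
  let scale (c : ℂˣ) (v : {v : Fin (n + 1) → ℂ // v ≠ 0}) : {v : Fin (n + 1) → ℂ // v ≠ 0} :=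
    ⟨(c : ℂ) • v.1, smul_ne_zero c.ne_zero v.2⟩
  have hs : ∀ c, Continuous (scale c) := fun c => by
    refine Continuous.subtype_mk ?_ _
    fun_prop
  have : cpMk ⁻¹' (cpMk '' U) = ⋃ c : ℂˣ, scale c ⁻¹' U := by
    ext v
    simp only [mem_preimage, mem_image, mem_iUnion]
    constructor
    · rintro ⟨w, hw, h⟩
      obtain ⟨c, hc⟩ := cpMk_eq_iff.mp h.symm
      have hc0 : c ≠ 0 := by
        rintro rfl
        exact w.2 (by rw [hc, zero_smul])
      refine ⟨Units.mk0 c hc0, ?_⟩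
      rwa [show scale (Units.mk0 c hc0) v = w from Subtype.ext hc.symm]
    · rintro ⟨c, hc⟩
      exact ⟨_, hc, (cpMk_eq_of_smul (c := c) rfl).symm⟩
  rw [this]
  exact isOpen_iUnion fun c => hU.preimage (hs c)

theorem isOpenQuotientMap_cpMk : IsOpenQuotientMap (cpMk (n := n)) :=
  ⟨cpMk_surjective, continuous_cpMk, isOpenMap_cpMk⟩

/-- The representative of a point of projective space on which a linear form takes the
value `1`, provided that the form does not vanish there. -/
noncomputable def cpLift (φ : (Fin (n + 1) → ℂ) →ₗ[ℂ] ℂ) : CP n → Fin (n + 1) → ℂ :=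
  Quot.lift (fun v => (φ v.1)⁻¹ • v.1) (by
    rintro v w ⟨c, hc⟩
    have hc0 : c ≠ 0 := by
      rintro rfl
      exact w.2 (by rw [hc, zero_smul])
    simp only [hc, map_smul, smul_smul, smul_eq_mul, mul_inv]
    congr 1
    field_simp)

theorem cpLift_cpMk (φ : (Fin (n + 1) → ℂ) →ₗ[ℂ] ℂ) (v : {v : Fin (n + 1) → ℂ // v ≠ 0}) :
    cpLift φ (cpMk v) = (φ v.1)⁻¹ • v.1 := rfl

theorem continuousAt_cpLift (φ : (Fin (n + 1) → ℂ) →ₗ[ℂ] ℂ) {v : {v : Fin (n + 1) → ℂ // v ≠ 0}}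
    (hv : φ v.1 ≠ 0) : ContinuousAt (cpLift φ) (cpMk v) := by
  rw [← isOpenQuotientMap_cpMk.continuousAt_comp_iff]
  have : Continuous fun w : {v : Fin (n + 1) → ℂ // v ≠ 0} => φ w.1 :=
    φ.continuous_of_finiteDimensional.comp continuous_subtype_val
  exact (this.continuousAt.inv₀ hv).smul continuous_subtype_val.continuousAt

/-- The set of points of projective space on which a linear form does not vanish. -/
def cpNonvanishing (φ : (Fin (n + 1) → ℂ) →ₗ[ℂ] ℂ) : Set (CP n) := {z | cpLift φ z ≠ 0}

theorem cpMk_mem_cpNonvanishing {φ : (Fin (n + 1) → ℂ) →ₗ[ℂ] ℂ}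
    {v : {v : Fin (n + 1) → ℂ // v ≠ 0}} : cpMk v ∈ cpNonvanishing φ ↔ φ v.1 ≠ 0 := by
  simp [cpNonvanishing, cpLift_cpMk, v.2]

theorem isOpen_cpNonvanishing (φ : (Fin (n + 1) → ℂ) →ₗ[ℂ] ℂ) : IsOpen (cpNonvanishing φ) := by
  rw [← isQuotientMap_cpMk.isOpen_preimage]
  simp only [preimage, cpMk_mem_cpNonvanishing]
  exact isOpen_ne.preimage (φ.continuous_of_finiteDimensional.comp continuous_subtype_val)

theorem continuousOn_cpLift (φ : (Fin (n + 1) → ℂ) →ₗ[ℂ] ℂ) :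
    ContinuousOn (cpLift φ) (cpNonvanishing φ) := by
  intro z hz
  obtain ⟨v, rfl⟩ := cpMk_surjective z
  exact (continuousAt_cpLift φ (cpMk_mem_cpNonvanishing.mp hz)).continuousWithinAt

theorem cpLift_ne_zero_cpMk {φ : (Fin (n + 1) → ℂ) →ₗ[ℂ] ℂ} {z : CP n} (h : cpLift φ z ≠ 0) :
    cpMk ⟨cpLift φ z, h⟩ = z := by
  obtain ⟨v, rfl⟩ := cpMk_surjective z
  exact (cpMk_eq_of_smul (c := (φ v.1)⁻¹) rfl).symm

theorem map_cpLift {φ : (Fin (n + 1) → ℂ) →ₗ[ℂ] ℂ} {z : CP n} (h : z ∈ cpNonvanishing φ) :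
    φ (cpLift φ z) = 1 := by
  obtain ⟨v, rfl⟩ := cpMk_surjective z
  rw [cpLift_cpMk, map_smul, smul_eq_mul, inv_mul_cancel₀ (cpMk_mem_cpNonvanishing.mp h)]

/-- The standard Hermitian form, semilinear in the first variable. -/
noncomputable def herm (v w : Fin (n + 1) → ℂ) : ℂ := ∑ i, starRingEnd ℂ (v i) * w i

theorem herm_smul_smul (a b : ℂ) (v w : Fin (n + 1) → ℂ) :
    herm (a • v) (b • w) = starRingEnd ℂ a * b * herm v w := by
  simp only [herm, Pi.smul_apply, smul_eq_mul, map_mul, Finset.mul_sum]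
  exact Finset.sum_congr rfl fun i _ => by ring

theorem conj_herm (v w : Fin (n + 1) → ℂ) : starRingEnd ℂ (herm v w) = herm w v := by
  simp only [herm, map_sum, map_mul, Complex.conj_conj]
  exact Finset.sum_congr rfl fun i _ => mul_comm _ _

theorem herm_self (v : Fin (n + 1) → ℂ) : herm v v = ((∑ i, Complex.normSq (v i) : ℝ) : ℂ) := by
  simp [herm, Complex.normSq_eq_conj_mul_self]

theorem sum_normSq_pos {v : Fin (n + 1) → ℂ} (hv : v ≠ 0) : 0 < ∑ i, Complex.normSq (v i) := by
  obtain ⟨i, hi⟩ := Function.ne_iff.mp hv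
  exact Finset.sum_pos' (fun i _ => Complex.normSq_nonneg _) ⟨i, Finset.mem_univ i,
    Complex.normSq_pos.mpr hi⟩

theorem herm_self_mem_slitPlane {v : Fin (n + 1) → ℂ} (hv : v ≠ 0) :
    herm v v ∈ Complex.slitPlane := by
  rw [herm_self, Complex.ofReal_mem_slitPlane]
  exact sum_normSq_pos hv

theorem continuous_herm : Continuous fun q : (Fin (n + 1) → ℂ) × (Fin (n + 1) → ℂ) =>
    herm q.1 q.2 := by
  unfold herm
  fun_prop

theorem eq_of_coe_angle_eq {a b : ℝ} (h : (a : Real.Angle) = b) (hab : |a - b| < 2 * Real.pi) :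
    a = b := by
  obtain ⟨k, hk⟩ := Real.Angle.angle_eq_iff_two_pi_dvd_sub.mp h
  rw [hk, abs_mul, abs_of_pos Real.two_pi_pos] at hab
  have h1 : |(k : ℝ)| < 1 := by
    have := Real.two_pi_pos
    nlinarith
  have h2 : k = 0 := Int.abs_lt_one_iff.mp (by exact_mod_cast h1)
  rw [h2] at hk
  simp only [Int.cast_zero, mul_zero] at hk
  linarith

/-- The triple product whose argument is the symplectic area of a geodesic triangle. -/
noncomputable def tripleHerm (u v w : Fin (n + 1) → ℂ) : ℂ := herm u v * herm v w * herm w u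

theorem arg_tripleHerm_smul {a b c : ℂ} (ha : a ≠ 0) (hb : b ≠ 0) (hc : c ≠ 0)
    (u v w : Fin (n + 1) → ℂ) :
    Complex.arg (tripleHerm (a • u) (b • v) (c • w)) = Complex.arg (tripleHerm u v w) := by
  have h : tripleHerm (a • u) (b • v) (c • w) =
      ((Complex.normSq a * Complex.normSq b * Complex.normSq c : ℝ) : ℂ) * tripleHerm u v w := by
    simp only [tripleHerm, herm_smul_smul, Complex.ofReal_mul, Complex.normSq_eq_conj_mul_self]
    ring
  rw [h, Complex.arg_real_mul]
  have := Complex.normSq_pos.mpr ha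
  have := Complex.normSq_pos.mpr hb
  have := Complex.normSq_pos.mpr hc
  positivity

/-- A cocycle representing a generator of the second cohomology of projective space. -/
noncomputable def cpClass (n : ℕ) : Cochain (CP n) := fun y =>
  Complex.arg (tripleHerm (Function.surjInv cpMk_surjective (y 0)).1
    (Function.surjInv cpMk_surjective (y 1)).1 (Function.surjInv cpMk_surjective (y 2)).1)

theorem cpClass_apply {y : ℕ → CP n} {v : ℕ → {v : Fin (n + 1) → ℂ // v ≠ 0}}
    (h : ∀ k, y k = cpMk (v k)) :
    cpClass n y = Complex.arg (tripleHerm (v 0).1 (v 1).1 (v 2).1) := by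
  have h1 : ∀ k, ∃ c : ℂ, c ≠ 0 ∧ (Function.surjInv cpMk_surjective (y k)).1 = c • (v k).1 := by
    intro k
    obtain ⟨c, hc⟩ := cpMk_eq_iff.mp ((h k).symm.trans
      (Function.surjInv_eq cpMk_surjective (y k)).symm)
    refine ⟨c, ?_, hc⟩
    rintro rfl
    exact (Function.surjInv cpMk_surjective (y k)).2 (by rw [hc, zero_smul])
  obtain ⟨a, ha, ha'⟩ := h1 0
  obtain ⟨b, hb, hb'⟩ := h1 1
  obtain ⟨c, hc, hc'⟩ := h1 2
  rw [cpClass, ha', hb', hc', arg_tripleHerm_smul ha hb hc]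

theorem dependsOn_cpClass : DependsOn (cpClass n) (Iic 2) := fun x y h => by
  simp [cpClass, h 0 (by simp), h 1 (by simp), h 2 (by simp)]

/-- The degree one cochain given by the Hermitian phase of pairs of vectors. -/
noncomputable def phase {T : Type*} (S : T → Fin (n + 1) → ℂ) : Cochain T :=
  fun x => Complex.arg (herm (S (x 0)) (S (x 1)))

theorem eventually_abs_arg_herm_lt {T : Type*} [TopologicalSpace T] {S : T → Fin (n + 1) → ℂ}
    {p : T} (hS : ContinuousAt S p) (hp : S p ≠ 0) {ε : ℝ} (hε : 0 < ε) :
    ∀ᶠ O in (𝓝 p).smallSets, ∀ a ∈ O, ∀ b ∈ O,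
      herm (S a) (S b) ≠ 0 ∧ |Complex.arg (herm (S a) (S b))| < ε := by
  refine eventually_smallSets_pair
    (P := fun a b => herm (S a) (S b) ≠ 0 ∧ |Complex.arg (herm (S a) (S b))| < ε) ?_
  have h1 : ContinuousAt (fun q : T × T => herm (S q.1) (S q.2)) (p, p) :=
    continuous_herm.continuousAt.comp (f := fun q : T × T => (S q.1, S q.2))
      ((ContinuousAt.comp (f := Prod.fst) (g := S) hS continuousAt_fst).prodMk
        (ContinuousAt.comp (f := Prod.snd) (g := S) hS continuousAt_snd))
  have hs := herm_self_mem_slitPlane hp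
  have h2 := ((Complex.continuousAt_arg hs).comp (f := fun q : T × T => herm (S q.1) (S q.2))
    (x := (p, p)) h1).abs
  refine (h1.eventually_ne (Complex.slitPlane_ne_zero hs)).and
    (h2.eventually_lt continuousAt_const ?_)
  simp only [Function.comp]
  rw [herm_self, Complex.arg_ofReal_of_nonneg (sum_normSq_pos hp).le, abs_zero]
  exact hε

theorem eventually_pull_cpClass {T : Type*} [TopologicalSpace T] {Φ : T → CP n}
    {S : T → Fin (n + 1) → ℂ} {p : T} (hS : ContinuousAt S p) (hp : S p ≠ 0)
    (h : ∀ᶠ q in 𝓝 p, ∀ hq : S q ≠ 0, Φ q = cpMk ⟨S q, hq⟩) :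
    ∀ᶠ O in (𝓝 p).smallSets, ∀ x : ℕ → T, (∀ k, x k ∈ O) →
      pull Φ (cpClass n) x = coboundary 2 (phase S) x := by
  have hπ := Real.pi_pos
  filter_upwards [eventually_abs_arg_herm_lt hS hp (ε := Real.pi / 3) (by positivity),
    eventually_smallSets_mem (h.and (hS.eventually_ne hp))] with O h1 h2 x hx
  have e : ∀ k, (Φ ∘ x) k = cpMk ⟨S (x k), (h2 _ (hx k)).2⟩ := fun k => (h2 _ (hx k)).1 _
  rw [pull, cpClass_apply e]
  have e2 : coboundary 2 (phase S) x = Complex.arg (herm (S (x 1)) (S (x 2))) -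
      Complex.arg (herm (S (x 0)) (S (x 2))) + Complex.arg (herm (S (x 0)) (S (x 1))) := by
    simp [coboundary, Finset.sum_range_succ, phase, skip]
    ring
  obtain ⟨a0, a1⟩ := h1 _ (hx 0) _ (hx 1)
  obtain ⟨b0, b1⟩ := h1 _ (hx 1) _ (hx 2)
  obtain ⟨c0, c1⟩ := h1 _ (hx 0) _ (hx 2)
  obtain ⟨d0, -⟩ := h1 _ (hx 2) _ (hx 0)
  have e3 := Complex.arg_le_pi (tripleHerm (S (x 0)) (S (x 1)) (S (x 2)))
  have e4 := Complex.neg_pi_lt_arg (tripleHerm (S (x 0)) (S (x 1)) (S (x 2)))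
  rw [abs_lt] at a1 b1 c1
  rw [e2]
  refine eq_of_coe_angle_eq ?_ ?_
  · rw [tripleHerm, Complex.arg_mul_coe_angle (mul_ne_zero a0 b0) d0,
      Complex.arg_mul_coe_angle a0 b0, ← conj_herm (S (x 0)), Complex.arg_conj_coe_angle]
    rw [Real.Angle.coe_add, Real.Angle.coe_sub]
    abel
  · rw [abs_lt]
    constructor <;> linarith

theorem isCocycle_cpClass : IsCocycle 2 (cpClass n) := by
  refine isCocycle_of_local dependsOn_cpClass fun p => ?_
  obtain ⟨v, rfl⟩ := cpMk_surjective p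
  let φ : (Fin (n + 1) → ℂ) →ₗ[ℂ] ℂ :=
    { toFun := herm v.1
      map_add' := fun x y => by simp [herm, mul_add, Finset.sum_add_distrib]
      map_smul' := fun c x => by
        have := herm_smul_smul 1 c v.1 x
        simpa using this }
  have hv : φ v.1 ≠ 0 := Complex.slitPlane_ne_zero (herm_self_mem_slitPlane v.2)
  have h0 : cpLift φ (cpMk v) ≠ 0 := cpMk_mem_cpNonvanishing.mpr hv
  refine ⟨coboundary 2 (phase (cpLift φ)), isCocycle_coboundary fun x y h => ?_, ?_⟩
  · simp [phase, h 0 (by simp), h 1 (by simp)]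
  · exact eventually_pull_cpClass (Φ := id) (continuousAt_cpLift φ hv) h0
      (Filter.Eventually.of_forall fun q hq => (cpLift_ne_zero_cpMk hq).symm)

end ProjectiveSpace

section ProjectiveMap

theorem prod_linear_ne_zero {n : ℕ} {U V : Fin n → ℂ} (h : ∀ s, U s = 0 → V s ≠ 0) :
    (fun i : Fin (n + 1) => ∏ s, (U s + (i : ℕ) * V s)) ≠ 0 := by
  intro h0
  have h1 : ∀ i : Fin (n + 1), ∃ s, U s + (i : ℕ) * V s = 0 := fun i => by
    have := congrFun h0 i
    simpa [Finset.prod_eq_zero_iff] using this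
  choose σ hσ using h1
  obtain ⟨i, j, hij, hs⟩ : ∃ i j, i ≠ j ∧ σ i = σ j := by
    by_contra! h2
    have := Fintype.card_le_of_injective σ fun i j => not_imp_not.mp (h2 i j)
    simp at this
  have hi := hσ i
  have hj := hσ j
  rw [← hs] at hj
  have h2 : (((i : ℕ) : ℂ) - ((j : ℕ) : ℂ)) * V (σ i) = 0 := by linear_combination hi - hj
  have h3 : ((i : ℕ) : ℂ) - ((j : ℕ) : ℂ) ≠ 0 := by
    rw [sub_ne_zero]
    exact fun h => hij (Fin.ext (by exact_mod_cast h))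
  have hV : V (σ i) = 0 := (mul_eq_zero.mp h2).resolve_left h3
  refine h (σ i) ?_ hV
  simpa [hV] using hi

/-- The homogeneous coordinates of the (discontinuous) lift of a degree one map from the torus
to the projective line. -/
noncomputable def lineCoord (a b : Circle) : ℂ × ℂ :=
  (((max (-(a : ℂ).re) 0 : ℝ) : ℂ) * (if (a : ℂ).im < 0 then 1 else (b : ℂ)),
    ((1 + (a : ℂ).re : ℝ) : ℂ))

theorem lineCoord_ne_zero (a b : Circle) (h : (lineCoord a b).1 = 0) : (lineCoord a b).2 ≠ 0 := by
  intro h2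
  have h3 : (a : ℂ).re = -1 := by
    have : 1 + (a : ℂ).re = 0 := Complex.ofReal_eq_zero.mp h2
    linarith
  simp only [lineCoord, h3] at h
  split_ifs at h <;> simp at h

variable {T : Type*} {n : ℕ}

/-- Homogeneous coordinates of a map from the torus to projective space, twisted by phases. -/
noncomputable def twistVec (α β E : Fin n → T → Circle) (x : T) (i : Fin (n + 1)) : ℂ :=
  ∏ s, ((lineCoord (α s x) (β s x)).1 * (E s x : ℂ) +
    (i : ℕ) * ((lineCoord (α s x) (β s x)).2 * (E s x : ℂ)))

theorem twistVec_ne_zero (α β E : Fin n → T → Circle) (x : T) : twistVec α β E x ≠ 0 := by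
  refine prod_linear_ne_zero (U := fun s => (lineCoord (α s x) (β s x)).1 * (E s x : ℂ))
    (V := fun s => (lineCoord (α s x) (β s x)).2 * (E s x : ℂ)) fun s h => ?_
  exact mul_ne_zero (lineCoord_ne_zero _ _ ((mul_eq_zero.mp h).resolve_right
    (Circle.coe_ne_zero _))) (Circle.coe_ne_zero _)

theorem twistVec_eq_smul (α β E : Fin n → T → Circle) (x : T) :
    twistVec α β E x = ((∏ s, E s x : Circle) : ℂ) • twistVec α β 1 x := by
  funext i
  have h : ((∏ s, E s x : Circle) : ℂ) = ∏ s, (E s x : ℂ) := map_prod Circle.coeHom _ _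
  rw [h]
  simp only [twistVec, Pi.smul_apply, smul_eq_mul, ← Finset.prod_mul_distrib,
    Pi.one_apply, Circle.coe_one]
  exact Finset.prod_congr rfl fun s _ => by ring

/-- A map of degree `n!` from the torus of dimension `2 n` to `n`-dimensional projective space. -/
noncomputable def cpMap (α β : Fin n → T → Circle) (x : T) : CP n :=
  cpMk ⟨twistVec α β 1 x, twistVec_ne_zero α β 1 x⟩

theorem cpMap_eq (α β E : Fin n → T → Circle) (x : T) :
    cpMap α β x = cpMk ⟨twistVec α β E x, twistVec_ne_zero α β E x⟩ :=
  cpMk_eq_of_smul (twistVec_eq_smul α β E x)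

/-- The indicator of the lower half circle, near the parameters whose value at `p` is `-1`. -/
noncomputable def lowerAt (α : T → Circle) (p x : T) : ℝ := by
  classical exact if α p = -1 then lower (α x) else 0

theorem lowerAt_eq_zero_or_one (α : T → Circle) (p x : T) :
    lowerAt α p x = 0 ∨ lowerAt α p x = 1 := by
  simp only [lowerAt, lower]
  split_ifs <;> simp

/-- The phases making the homogeneous coordinates continuous at `p`. -/
noncomputable def localPhase (α β : T → Circle) (p x : T) : Circle :=
  Circle.exp (lowerAt α p x * Complex.arg (β x : ℂ))

theorem localPhase_of_ne {α β : T → Circle} {p : T} (h : α p ≠ -1) (x : T) :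
    localPhase α β p x = 1 := by
  simp [localPhase, lowerAt, h]

theorem localPhase_of_lt {α β : T → Circle} {p x : T} (h : α p = -1) (hx : (α x : ℂ).im < 0) :
    localPhase α β p x = β x := by
  simp [localPhase, lowerAt, h, lower, hx]

theorem localPhase_of_not_lt {α β : T → Circle} {p x : T} (hx : ¬ (α x : ℂ).im < 0) :
    localPhase α β p x = 1 := by
  simp [localPhase, lowerAt, lower, hx]

variable [TopologicalSpace T]

theorem continuousAt_lineCoord_fst {α β : T → Circle} (hα : Continuous α) (hβ : Continuous β)
    (p : T) : ContinuousAt (fun x => (lineCoord (α x) (β x)).1 * (localPhase α β p x : ℂ)) p := by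
  by_cases h : α p = -1
  · have e : (fun x => (lineCoord (α x) (β x)).1 * (localPhase α β p x : ℂ)) =
        fun x => ((max (-(α x : ℂ).re) 0 : ℝ) : ℂ) * (β x : ℂ) := by
      funext x
      by_cases hx : (α x : ℂ).im < 0
      · rw [localPhase_of_lt h hx]
        simp [lineCoord, hx]
      · rw [localPhase_of_not_lt hx]
        simp [lineCoord, hx]
    rw [e]
    have : Continuous fun x => ((max (-(α x : ℂ).re) 0 : ℝ) : ℂ) * (β x : ℂ) := by fun_prop
    exact this.continuousAt
  · simp only [localPhase_of_ne h, Circle.coe_one, mul_one]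
    have him : Continuous fun x => (α x : ℂ).im := by fun_prop
    have hre : Continuous fun x => (α x : ℂ).re := by fun_prop
    rcases lt_trichotomy (α p : ℂ).im 0 with h1 | h1 | h1
    · have : Continuous fun x => ((max (-(α x : ℂ).re) 0 : ℝ) : ℂ) := by fun_prop
      refine this.continuousAt.congr ?_
      filter_upwards [him.continuousAt.eventually_lt continuousAt_const h1] with x hx
      simp [lineCoord, hx]
    · have h2 : 0 < (α p : ℂ).re := by
        rw [(circle_re_of_im h1).resolve_left h]
        exact one_pos
      refine (continuousAt_const (y := (0 : ℂ))).congr ?_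
      filter_upwards [continuousAt_const.eventually_lt hre.continuousAt h2] with x hx
      simp [lineCoord, hx.le]
    · have : Continuous fun x => ((max (-(α x : ℂ).re) 0 : ℝ) : ℂ) * (β x : ℂ) := by fun_prop
      refine this.continuousAt.congr ?_
      filter_upwards [continuousAt_const.eventually_lt him.continuousAt h1] with x hx
      simp [lineCoord, hx.not_gt]

theorem continuousAt_lineCoord_snd {α β : T → Circle} (hα : Continuous α)
    (p : T) : ContinuousAt (fun x => (lineCoord (α x) (β x)).2 * (localPhase α β p x : ℂ)) p := by
  have hre : Continuous fun x => ((1 + (α x : ℂ).re : ℝ) : ℂ) := by fun_prop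
  by_cases h : α p = -1
  · have h0 : ((1 + (α p : ℂ).re : ℝ) : ℂ) = 0 := by
      rw [h]
      have : ((-1 : Circle) : ℂ) = -1 := rfl
      simp [this]
    rw [ContinuousAt]
    simp only [lineCoord, h0, zero_mul]
    refine squeeze_zero_norm (a := fun x => ‖((1 + (α x : ℂ).re : ℝ) : ℂ)‖) (fun x => ?_) ?_
    · rw [norm_mul, Circle.norm_coe, mul_one]
    · have := hre.norm.continuousAt (x := p)
      rw [ContinuousAt, h0, norm_zero] at this
      exact this
  · simp only [localPhase_of_ne h, Circle.coe_one, mul_one]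
    exact hre.continuousAt

variable {α β : Fin n → T → Circle}

theorem continuousAt_twistVec (hα : ∀ s, Continuous (α s)) (hβ : ∀ s, Continuous (β s)) (p : T) :
    ContinuousAt (twistVec α β fun s => localPhase (α s) (β s) p) p := by
  refine continuousAt_pi.mpr fun i => ?_
  simp only [twistVec]
  exact tendsto_finsetProd _ fun s _ => (continuousAt_lineCoord_fst (hα s) (hβ s) p).add
    (continuousAt_const.mul (continuousAt_lineCoord_snd (hα s) p))

theorem continuous_cpMap (hα : ∀ s, Continuous (α s)) (hβ : ∀ s, Continuous (β s)) :
    Continuous (cpMap α β) := by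
  refine continuous_iff_continuousAt.mpr fun p => ?_
  rw [show cpMap α β = fun x => cpMk ⟨_, twistVec_ne_zero α β
    (fun s => localPhase (α s) (β s) p) x⟩ from funext fun x => cpMap_eq _ _ _ _]
  exact continuous_cpMk.continuousAt.comp
    ((continuousAt_twistVec hα hβ p).codRestrict _)

/-- The global part of the phase of the homogeneous coordinates on pairs of points. -/
noncomputable def globalPhase (α β : Fin n → T → Circle) : Cochain T := fun x =>
  Complex.arg (herm (twistVec α β 1 (x 0)) (twistVec α β 1 (x 1)) *
    (∏ s, Circle.exp (crossing (α s) x / (2 * Real.pi) * Complex.arg (β s (x 1) : ℂ)) : Circle))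

theorem dependsOn_globalPhase : DependsOn (globalPhase α β) (Iio 2) := fun x y h => by
  have h1 : ∀ s, crossing (α s) x = crossing (α s) y := fun s =>
    dependsOn_crossing (α s) fun i hi => h i (Nat.lt_succ_iff.mpr hi)
  simp [globalPhase, h 0 (by simp), h 1 (by simp), h1]

theorem arg_circle_exp_coe_angle (t : ℝ) :
    (Complex.arg (Circle.exp t : ℂ) : Real.Angle) = t := by
  rw [Circle.coe_exp, Complex.exp_mul_I]
  exact_mod_cast Complex.arg_cos_add_sin_mul_I_coe_angle (t : Real.Angle)

theorem circle_exp_sum {ι : Type*} (s : Finset ι) (t : ι → ℝ) :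
    Circle.exp (∑ i ∈ s, t i) = ∏ i ∈ s, Circle.exp (t i) := by
  induction s using Finset.cons_induction with
  | empty => simp
  | cons a s ha ih => rw [Finset.prod_cons, Finset.sum_cons, Circle.exp_add, ih]

theorem coe_angle_sum {ι : Type*} (s : Finset ι) (t : ι → ℝ) :
    ((∑ i ∈ s, t i : ℝ) : Real.Angle) = ∑ i ∈ s, (t i : Real.Angle) :=
  map_sum Real.Angle.coeHom t s

theorem arg_circle_prod_coe_angle {ι : Type*} (s : Finset ι) (t : ι → ℝ) :
    (Complex.arg ((∏ i ∈ s, Circle.exp (t i) : Circle) : ℂ) : Real.Angle) = ∑ i ∈ s, t i := by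
  rw [← circle_exp_sum, arg_circle_exp_coe_angle]

theorem eventually_crossing_eq_lowerAt {α : T → Circle} (hα : Continuous α) (p : T) :
    ∀ᶠ O in (𝓝 p).smallSets, ∀ x : ℕ → T, (∀ k, x k ∈ O) →
      crossing α x / (2 * Real.pi) = lowerAt α p (x 1) - lowerAt α p (x 0) := by
  by_cases h : α p = -1
  · filter_upwards [eventually_crossing_of_eq hα h] with O hO x hx
    rw [hO x hx, mul_div_cancel_left₀ _ Real.two_pi_pos.ne']
    simp [lowerAt, h]
  · filter_upwards [eventually_crossing_of_ne hα h] with O hO x hx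
    rw [hO x hx]
    simp [lowerAt, h]

theorem eventually_globalPhase (hα : ∀ s, Continuous (α s)) (hβ : ∀ s, Continuous (β s)) (p : T) :
    ∀ᶠ O in (𝓝 p).smallSets, ∀ x : ℕ → T, (∀ k, x k ∈ O) →
      globalPhase α β x = phase (twistVec α β fun s => localPhase (α s) (β s) p) x -
        ∑ s, lowerAt (α s) p (x 0) * angle (β s) x := by
  have hπ := Real.pi_pos
  have h1 := eventually_abs_arg_herm_lt (continuousAt_twistVec hα hβ p)
    (twistVec_ne_zero _ _ _ p) (ε := Real.pi / 2) (by positivity)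
  have h2 : ∀ᶠ O in (𝓝 p).smallSets, ∀ s, ∀ a ∈ O, ∀ b ∈ O,
      |Complex.arg ((β s b / β s a : Circle) : ℂ)| < Real.pi / (2 * (n + 1)) :=
    Filter.eventually_all.mpr fun s => eventually_abs_arg_div_lt (hβ s) p (by positivity)
  have h3 : ∀ᶠ O in (𝓝 p).smallSets, ∀ s, ∀ x : ℕ → T, (∀ k, x k ∈ O) →
      crossing (α s) x / (2 * Real.pi) = lowerAt (α s) p (x 1) - lowerAt (α s) p (x 0) :=
    Filter.eventually_all.mpr fun s => eventually_crossing_eq_lowerAt (hα s) p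
  filter_upwards [h1, h2, h3] with O h1 h2 h3 x hx
  obtain ⟨k1, k2⟩ := h1 _ (hx 0) _ (hx 1)
  have h4 : |∑ s, lowerAt (α s) p (x 0) * angle (β s) x| ≤ Real.pi / 2 := by
    refine (Finset.abs_sum_le_sum_abs _ _).trans ?_
    have : ∀ s ∈ Finset.univ, |lowerAt (α s) p (x 0) * angle (β s) x| ≤
        Real.pi / (2 * (n + 1)) := fun s _ => by
      rw [abs_mul]
      have := (h2 s _ (hx 0) _ (hx 1)).le
      rcases lowerAt_eq_zero_or_one (α s) p (x 0) with h | h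
      · rw [h, abs_zero, zero_mul]
        positivity
      · rw [h, abs_one, one_mul]
        exact this
    refine (Finset.sum_le_card_nsmul _ _ _ this).trans ?_
    simp only [Finset.card_univ, Fintype.card_fin, nsmul_eq_mul]
    rw [mul_div_assoc', div_le_div_iff₀ (by positivity) (by positivity)]
    nlinarith
  have h5 : herm (twistVec α β (fun s => localPhase (α s) (β s) p) (x 0))
      (twistVec α β (fun s => localPhase (α s) (β s) p) (x 1)) =
      herm (twistVec α β 1 (x 0)) (twistVec α β 1 (x 1)) *
        ((∏ s, Circle.exp (lowerAt (α s) p (x 1) * Complex.arg (β s (x 1) : ℂ) -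
          lowerAt (α s) p (x 0) * Complex.arg (β s (x 0) : ℂ)) : Circle) : ℂ) := by
    rw [twistVec_eq_smul, twistVec_eq_smul _ _ _ (x 1), herm_smul_smul, mul_comm]
    congr 1
    rw [← Circle.coe_inv_eq_conj, ← Circle.coe_mul]
    congr 1
    simp only [localPhase, Circle.exp_sub, div_eq_mul_inv,
      Finset.prod_mul_distrib, Finset.prod_inv_distrib]
    exact mul_comm _ _
  have h6 : herm (twistVec α β 1 (x 0)) (twistVec α β 1 (x 1)) ≠ 0 := by
    rw [h5] at k1
    exact left_ne_zero_of_mul k1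
  refine eq_of_coe_angle_eq ?_ ?_
  · rw [Real.Angle.coe_sub]
    simp only [phase, globalPhase]
    rw [h5, Complex.arg_mul_coe_angle h6 (Circle.coe_ne_zero _),
      Complex.arg_mul_coe_angle h6 (Circle.coe_ne_zero _), arg_circle_prod_coe_angle,
      arg_circle_prod_coe_angle, add_sub_assoc]
    congr 1
    rw [coe_angle_sum, coe_angle_sum, coe_angle_sum, ← Finset.sum_sub_distrib]
    refine Finset.sum_congr rfl fun s _ => ?_
    rw [h3 s x hx]
    rcases lowerAt_eq_zero_or_one (α s) p (x 0) with h | h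
    · simp [h]
    · have h7 : (angle (β s) x : Real.Angle) =
          Complex.arg (β s (x 1) : ℂ) - Complex.arg (β s (x 0) : ℂ) := by
        rw [angle, Circle.coe_div, Complex.arg_div_coe_angle (Circle.coe_ne_zero _)
          (Circle.coe_ne_zero _)]
      rw [h, one_mul, one_mul, Real.Angle.coe_sub, h7, sub_mul, one_mul, Real.Angle.coe_sub]
      abel
  · have e1 := Complex.arg_le_pi (herm (twistVec α β 1 (x 0)) (twistVec α β 1 (x 1)) *
      (∏ s, Circle.exp (crossing (α s) x / (2 * Real.pi) * Complex.arg (β s (x 1) : ℂ)) : Circle))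
    have e2 := Complex.neg_pi_lt_arg (herm (twistVec α β 1 (x 0)) (twistVec α β 1 (x 1)) *
      (∏ s, Circle.exp (crossing (α s) x / (2 * Real.pi) * Complex.arg (β s (x 1) : ℂ)) : Circle))
    rw [abs_lt] at k2
    rw [abs_le] at h4
    rw [abs_lt]
    simp only [phase, globalPhase]
    constructor <;> linarith

theorem coboundary_two_apply (G : Cochain T) (x : ℕ → T) :
    coboundary 2 G x = G (x ∘ skip 0) - G (x ∘ skip 1) + G (x ∘ skip 2) := by
  simp [coboundary, Finset.sum_range_succ]
  ring

theorem locEq_pull_cpClass (hα : ∀ s, Continuous (α s)) (hβ : ∀ s, Continuous (β s)) :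
    LocEq (pull (cpMap α β) (cpClass n))
      ((∑ s, (2 * Real.pi)⁻¹ • cup 1 (crossing (α s)) (angle (β s))) +
        coboundary 2 (globalPhase α β)) := by
  intro p
  have h1 := eventually_pull_cpClass (continuousAt_twistVec hα hβ p) (twistVec_ne_zero _ _ _ p)
    (Filter.Eventually.of_forall fun q hq => cpMap_eq α β _ q)
  have h2 : ∀ᶠ O in (𝓝 p).smallSets, ∀ s, ∀ x : ℕ → T, (∀ k, x k ∈ O) →
      coboundary 2 (angle (β s)) x = 0 :=
    Filter.eventually_all.mpr fun s => (isCocycle_angle (hβ s)).2 p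
  have h3 : ∀ᶠ O in (𝓝 p).smallSets, ∀ s, ∀ x : ℕ → T, (∀ k, x k ∈ O) →
      crossing (α s) x / (2 * Real.pi) = lowerAt (α s) p (x 1) - lowerAt (α s) p (x 0) :=
    Filter.eventually_all.mpr fun s => eventually_crossing_eq_lowerAt (hα s) p
  filter_upwards [h1, h2, h3, eventually_globalPhase hα hβ p] with O h1 h2 h3 h4 x hx
  rw [h1 x hx]
  simp only [Pi.add_apply, Finset.sum_apply, Pi.smul_apply, smul_eq_mul, cup]
  rw [coboundary_two_apply, coboundary_two_apply, h4 (x ∘ skip 0) fun k => hx _,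
    h4 (x ∘ skip 1) fun k => hx _, h4 (x ∘ skip 2) fun k => hx _]
  have h5 : ∀ s, (2 * Real.pi)⁻¹ * (crossing (α s) x * angle (β s) fun k => x (k + 1)) =
      lowerAt (α s) p (x 1) * angle (β s) (x ∘ skip 0) -
      lowerAt (α s) p (x 0) * angle (β s) (x ∘ skip 1) +
      lowerAt (α s) p (x 0) * angle (β s) (x ∘ skip 2) := by
    intro s
    have h6 := h2 s x hx
    rw [coboundary_two_apply] at h6
    have h7 : (fun k => x (k + 1)) = x ∘ skip 0 := by
      funext k; simp [skip]
    rw [h7, ← mul_assoc, inv_mul_eq_div, h3 s x hx]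
    linear_combination -(lowerAt (α s) p (x 0)) * h6
  simp only [h5, Finset.sum_add_distrib, Finset.sum_sub_distrib]
  simp only [Function.comp, skip]
  norm_num
  ring

theorem cohom_pull_cpClass (hα : ∀ s, Continuous (α s)) (hβ : ∀ s, Continuous (β s)) :
    Cohom 2 (pull (cpMap α β) (cpClass n))
      ((2 * Real.pi)⁻¹ • ∑ s, cup 1 (angle (α s)) (angle (β s))) := by
  have h1 : Cohom 2 (pull (cpMap α β) (cpClass n))
      (∑ s, (2 * Real.pi)⁻¹ • cup 1 (crossing (α s)) (angle (β s))) :=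
    ⟨_, dependsOn_globalPhase, fun h => absurd h two_ne_zero, locEq_pull_cpClass hα hβ⟩
  refine h1.trans ?_
  rw [Finset.smul_sum]
  refine Cohom.sum fun s _ => Cohom.smul _ ?_
  exact Cohom.cup_right (p := 1) (q := 1) (cohom_angle_crossing (α s)).symm (isCocycle_angle (hβ s))

end ProjectiveMap

section LowerBound

theorem exists_coboundary_of_section {M X Y : Type*} [TopologicalSpace M] [TopologicalSpace X]
    [TopologicalSpace Y] {U : Set (X × X)} (hU : IsOpen U) (s : C(U, C(unitInterval, X)))
    (hs : ∀ u : U, (s u 0, s u 1) = (u : X × X)) {g : M → X × X} (hg : Continuous g) {f : X → Y}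
    (hf : Continuous f) {d : ℕ} (hd : d ≠ 0) {F : Cochain Y} (hF : IsCocycle d F) :
    ∃ G : ℕ → Cochain M, (∀ L, DependsOn (G L) (Iio d)) ∧ ∀ m, g m ∈ U →
      ∀ᶠ O in (𝓝 m).smallSets, ∀ᶠ L in Filter.atTop, ∀ x : ℕ → M, (∀ k, x k ∈ O) →
        (pull (fun m => f (g m).2) F - pull (fun m => f (g m).1) F) x = coboundary d (G L) x := by
  classical
  obtain ⟨p, rfl⟩ := Nat.exists_eq_succ_of_ne_zero hd
  let H : M × ℝ → Y := fun q => if h : g q.1 ∈ U then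
    f (s ⟨g q.1, h⟩ (projIcc 0 1 zero_le_one q.2)) else f (g q.1).1
  have hH : ContinuousOn H ((g ⁻¹' U) ×ˢ univ) := by
    rw [continuousOn_iff_continuous_domRestrict]
    have e : domRestrict ((g ⁻¹' U) ×ˢ univ) H = fun q : ((g ⁻¹' U) ×ˢ univ : Set (M × ℝ)) =>
        f (s ⟨g q.1.1, q.2.1⟩ (projIcc 0 1 zero_le_one q.1.2)) := by
      funext q
      exact dif_pos q.2.1
    rw [e]
    refine hf.comp ?_
    have h1 : Continuous fun q : ((g ⁻¹' U) ×ˢ univ : Set (M × ℝ)) =>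
        s (⟨g q.1.1, q.2.1⟩ : U) :=
      s.continuous.comp ((hg.comp (continuous_fst.comp continuous_subtype_val)).subtype_mk _)
    have h2 : Continuous fun q : ((g ⁻¹' U) ×ˢ univ : Set (M × ℝ)) =>
        projIcc (0 : ℝ) 1 zero_le_one q.1.2 :=
      continuous_projIcc.comp (continuous_snd.comp continuous_subtype_val)
    exact h1.eval h2
  have h0 : ∀ m ∈ g ⁻¹' U, H (m, 0) = f (g m).1 := by
    intro m hm
    have hm' : g m ∈ U := hm
    have h0 := congrArg Prod.fst (hs ⟨g m, hm'⟩)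
    simp only [H, dif_pos hm', projIcc_left]
    exact congrArg f h0
  have h1 : ∀ m ∈ g ⁻¹' U, H (m, 1) = f (g m).2 := by
    intro m hm
    have hm' : g m ∈ U := hm
    have h0 := congrArg Prod.snd (hs ⟨g m, hm'⟩)
    simp only [H, dif_pos hm', projIcc_right]
    exact congrArg f h0
  obtain ⟨G, hG, h⟩ := exists_homotopy_coboundary (hU.preimage hg) hH
    (a := fun m => f (g m).1) (b := fun m => f (g m).2) h0 h1 hF
  exact ⟨G, fun L => by rw [Nat.succ_eq_add_one, Iio_add_one]; exact hG L, h⟩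

theorem locEq_prodOne_angle_inv {T : Type*} [TopologicalSpace T] {m : ℕ} (hm : 0 < m)
    {θ : Fin m → T → Circle} (hθ : ∀ i, Continuous (θ i)) :
    LocEq (prodOne fun i => angle (if (i : ℕ) = 0 then (θ i)⁻¹ else θ i))
      ((-1 : ℝ) • prodOne fun i => angle (θ i)) := by
  have h : (∏ i : Fin m, if (i : ℕ) = 0 then (-1 : ℝ) else 1) = -1 := by
    rw [Finset.prod_eq_single (⟨0, hm⟩ : Fin m)]
    · simp
    · intro b _ hb
      have : (b : ℕ) ≠ 0 := fun h => hb (Fin.ext h)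
      simp [this]
    · simp
  have e : ((-1 : ℝ) • prodOne fun i => angle (θ i)) =
      prodOne fun i : Fin m => (if (i : ℕ) = 0 then (-1 : ℝ) else 1) • angle (θ i) := by
    rw [prodOne_smul, h]
  rw [e]
  refine locEq_prodOne fun i => ?_
  split_ifs with h
  · exact locEq_angle_inv (hθ i)
  · rw [one_smul]
    exact .refl _

theorem angle_one {T : Type*} : angle (1 : T → Circle) = 0 := by
  funext x
  simp [angle]

theorem prodOne_zero {T : Type*} {m : ℕ} (hm : 0 < m) {F : Fin m → Cochain T} (hF : ∀ i, F i = 0) :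
    prodOne F = 0 := by
  funext x
  exact Finset.prod_eq_zero (Finset.mem_univ ⟨0, hm⟩) (by rw [hF]; rfl)

variable (n r : ℕ) (m : Fin r → ℕ)

/-- The index set of the cohomology classes with nonzero product. -/
abbrev Block : Type := (Fin 2 × Fin n) ⊕ (Fin r ⊕ {i // Even (m i)})

/-- The degrees of the cohomology classes with nonzero product. -/
def blockDim : Block n r m → ℕ := Sum.elim (fun _ => 2) (Sum.elim m fun i => m i.1)

/-- The blocks mapping to the sphere with index `i`. -/
def sphereBlocks (i : Fin r) : Finset (Block n r m) :=
  if h : Even (m i) then {.inr (.inl i), .inr (.inr ⟨i, h⟩)} else {.inr (.inl i)}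

/-- The blocks mapping to the same factor as a given block. -/
def sameFactor : Block n r m → Finset (Block n r m) :=
  Sum.elim (fun _ => Finset.univ.map Function.Embedding.inl)
    (Sum.elim (sphereBlocks n r m) fun i => sphereBlocks n r m i.1)

/-- The torus mapping to the square of the product of projective space and spheres. -/
abbrev BlockTorus : Type := (Σ j, Fin (blockDim n r m j)) → Circle

theorem mem_sameFactor (j : Block n r m) : j ∈ sameFactor n r m j := by
  rcases j with j | j | j
  · simp [sameFactor]
  · simp only [sameFactor, Sum.elim_inr, Sum.elim_inl, sphereBlocks]
    split_ifs <;> simp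
  · simp [sameFactor, sphereBlocks, j.2]

theorem blockDim_of_mem_sameFactor {j j' : Block n r m} (h : j' ∈ sameFactor n r m j) :
    blockDim n r m j' = blockDim n r m j ∧ (j' ≠ j → Even (blockDim n r m j)) := by
  have key : ∀ i, j' ∈ sphereBlocks n r m i → blockDim n r m j' = m i ∧
      (j' ≠ .inr (.inl i) → Even (m i)) := by
    intro i hi
    simp only [sphereBlocks] at hi
    split_ifs at hi with he
    · refine ⟨?_, fun _ => he⟩
      simp only [Finset.mem_insert, Finset.mem_singleton] at hi
      rcases hi with rfl | rfl <;> rfl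
    · rw [Finset.mem_singleton] at hi
      exact ⟨by rw [hi]; rfl, fun h => absurd hi h⟩
  rcases j with j | j | j
  · simp only [sameFactor, Sum.elim_inl, Finset.mem_map, Finset.mem_univ, true_and] at h
    obtain ⟨a, rfl⟩ := h
    exact ⟨rfl, fun _ => even_two⟩
  · exact key j h
  · exact ⟨(key j.1 h).1, fun _ => j.2⟩

variable {n r m}

/-- Coordinates of the torus mapping to the projective spaces. -/
def cpCoord (e : Fin 2) (b : Fin 2) (s : Fin n) (x : BlockTorus n r m) : Circle :=
  x ⟨.inl (b, s), e⟩

/-- Coordinates of the torus mapping to the spheres in the first factor. -/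
def sphCoord (i : Fin r) (s : Fin (m i)) (x : BlockTorus n r m) : Circle :=
  x ⟨.inr (.inl i), s⟩

/-- Coordinates of the torus mapping to the even spheres in the second factor. -/
def evenSphCoord {i : Fin r} (h : Even (m i)) (s : Fin (m i)) (x : BlockTorus n r m) : Circle :=
  x ⟨.inr (.inr ⟨i, h⟩), s⟩

/-- The functions defining the map to the spheres in the second factor. -/
noncomputable def sphCoord' (i : Fin r) (s : Fin (m i)) : BlockTorus n r m → Circle :=
  if h : Even (m i) then if (s : ℕ) = 0 then (evenSphCoord h s)⁻¹ else evenSphCoord h s else 1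

theorem continuous_cpCoord (e b : Fin 2) (s : Fin n) :
    Continuous (cpCoord (r := r) (m := m) e b s) := continuous_apply _

theorem continuous_sphCoord (i : Fin r) (s : Fin (m i)) :
    Continuous (sphCoord (n := n) i s) := continuous_apply _

theorem continuous_evenSphCoord {i : Fin r} (h : Even (m i)) (s : Fin (m i)) :
    Continuous (evenSphCoord (n := n) h s) := continuous_apply _

theorem continuous_sphCoord' (i : Fin r) (s : Fin (m i)) :
    Continuous (sphCoord' (n := n) i s) := by
  unfold sphCoord'
  split_ifs
  · exact (continuous_evenSphCoord _ s).inv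
  · exact continuous_evenSphCoord _ s
  · exact continuous_one

/-- The map from the torus on which the product of the cohomology classes is detected. -/
noncomputable def blockMap (x : BlockTorus n r m) :
    (CP n × ∀ i, Sph (m i)) × (CP n × ∀ i, Sph (m i)) :=
  ((cpMap (cpCoord 0 0) (cpCoord 1 0) x, fun i => sphereMap (sphCoord i) x),
    (cpMap (cpCoord 0 1) (fun s => (cpCoord 1 1 s)⁻¹) x, fun i => sphereMap (sphCoord' i) x))

theorem continuous_blockMap : Continuous (blockMap (n := n) (m := m)) :=
  ((continuous_cpMap (continuous_cpCoord 0 0) (continuous_cpCoord 1 0)).prodMk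
    (continuous_pi fun i => continuous_sphereMap (continuous_sphCoord i))).prodMk
  ((continuous_cpMap (continuous_cpCoord 0 1) fun s => (continuous_cpCoord 1 1 s).inv).prodMk
    (continuous_pi fun i => continuous_sphereMap (continuous_sphCoord' i)))

theorem blockAngle_inl (b : Fin 2) (s : Fin n) :
    blockAngle (blockDim n r m) (.inl (b, s)) = cup 1 (angle (cpCoord 0 b s))
      (angle (cpCoord 1 b s)) := by
  funext x
  exact Fin.prod_univ_two _

theorem cohom_cp : Cohom 2
    (pull (fun x => (blockMap (n := n) (m := m) x).2.1) (cpClass n) -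
      pull (fun x => (blockMap (n := n) (m := m) x).1.1) (cpClass n))
    ((-(2 * Real.pi)⁻¹) • ∑ j ∈ Finset.univ.map Function.Embedding.inl,
      blockAngle (blockDim n r m) j) := by
  have h1 := cohom_pull_cpClass (continuous_cpCoord (n := n) (m := m) 0 0)
    (continuous_cpCoord (n := n) (m := m) 1 0)
  have h2 := cohom_pull_cpClass (continuous_cpCoord (n := n) (m := m) 0 1)
    (fun s => (continuous_cpCoord (n := n) (m := m) 1 1 s).inv)
  have h3 : Cohom 2 (∑ s, cup 1 (angle (cpCoord (n := n) (m := m) 0 1 s))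
      (angle (cpCoord 1 1 s)⁻¹))
      ((-1 : ℝ) • ∑ s, cup 1 (angle (cpCoord 0 1 s)) (angle (cpCoord 1 1 s))) := by
    rw [Finset.smul_sum]
    refine Cohom.sum fun s _ => ?_
    have := Cohom.cup_left (p := 1) (q := 1)
      (isCocycle_angle (continuous_cpCoord (n := n) (m := m) 0 1 s))
      (locEq_angle_inv (continuous_cpCoord (n := n) (m := m) 1 1 s)).cohom
    convert this using 1
    funext x
    exact mul_left_comm _ _ _
  have h4 := ((h2.trans (h3.smul _)).add (h1.smul (-1)))
  convert h4 using 1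
  · funext x
    simp [blockMap, pull, sub_eq_add_neg, Function.comp_def]
  · rw [Finset.sum_map, Fintype.sum_prod_type, Fin.sum_univ_two]
    simp only [Function.Embedding.inl_apply, blockAngle_inl]
    funext x
    simp only [Pi.smul_apply, Pi.add_apply, smul_eq_mul]
    ring

theorem cohom_sph {i : Fin r} (hi : 0 < m i) : Cohom (m i)
    (pull (fun x => (blockMap (n := n) (m := m) x).2.2 i) (sphereClass (m i)) -
      pull (fun x => (blockMap (n := n) (m := m) x).1.2 i) (sphereClass (m i)))
    ((-(2 * Real.pi)⁻¹ ^ m i) • ∑ j ∈ sphereBlocks n r m i, blockAngle (blockDim n r m) j) := by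
  have h1 := cohom_pull_sphereClass (continuous_sphCoord (n := n) (m := m) i)
  have h2 := cohom_pull_sphereClass (continuous_sphCoord' (n := n) (m := m) i)
  have h4 : Cohom (m i) (prodOne fun s => angle (sphCoord' (n := n) (m := m) i s))
      ((-1 : ℝ) • if h : Even (m i) then
        blockAngle (blockDim n r m) (.inr (.inr ⟨i, h⟩)) else 0) := by
    split_ifs with h
    · have := (locEq_prodOne_angle_inv hi (continuous_evenSphCoord (n := n) h)).cohom (p := m i)
      convert this using 3
      · funext s
        simp [sphCoord', h]
      · rfl
    · rw [prodOne_zero hi, smul_zero]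
      · exact .refl _ _
      · intro s
        simp only [sphCoord', h, dif_neg, not_false_eq_true]
        exact angle_one
  have h5 := (h2.trans (h4.smul _)).add (h1.smul (-1))
  convert h5 using 1
  · funext x
    simp [blockMap, pull, sub_eq_add_neg, Function.comp_def]
  · have h6 : blockAngle (blockDim n r m) (.inr (.inl i)) =
      prodOne fun s => angle (sphCoord (n := n) i s) := rfl
    simp only [sphereBlocks]
    split_ifs with h
    · rw [Finset.sum_pair (by simp), h6]
      funext x
      simp only [Pi.smul_apply, Pi.add_apply, smul_eq_mul]
      ring
    · rw [Finset.sum_singleton, h6]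
      funext x
      simp only [Pi.smul_apply, Pi.add_apply, smul_eq_mul, Pi.zero_apply]
      ring

end LowerBound

section LowerBoundMain

variable {n r : ℕ} {m : Fin r → ℕ}

theorem exists_blockClass_aux {Y : Type*} [TopologicalSpace Y] {d : ℕ} (hd : d ≠ 0)
    {f : (CP n × ∀ i, Sph (m i)) → Y} (hf : Continuous f) {F : Cochain Y} (hF : IsCocycle d F)
    {C : ℝ} (hC : C ≠ 0) {B : Cochain (BlockTorus n r m)}
    (h : Cohom d (pull (fun x => f (blockMap x).2) F - pull (fun x => f (blockMap x).1) F)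
      (C • B)) :
    ∃ (A : Cochain (BlockTorus n r m)) (C : ℝ), IsCocycle d A ∧ C ≠ 0 ∧ Cohom d A (C • B) ∧
      ∀ U : Set ((CP n × ∀ i, Sph (m i)) × (CP n × ∀ i, Sph (m i))), IsOpen U →
        (∃ s : C(U, C(unitInterval, CP n × ∀ i, Sph (m i))),
          ∀ u : U, (s u 0, s u 1) = (u : (CP n × ∀ i, Sph (m i)) × (CP n × ∀ i, Sph (m i)))) →
        ∃ G : ℕ → Cochain (BlockTorus n r m), (∀ L, DependsOn (G L) (Iio d)) ∧
          ∀ p, blockMap p ∈ U → ∀ᶠ O in (𝓝 p).smallSets, ∀ᶠ L in Filter.atTop,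
            ∀ x : ℕ → BlockTorus n r m, (∀ k, x k ∈ O) → A x = coboundary d (G L) x := by
  refine ⟨_, C, ?_, hC, h, ?_⟩
  · rw [sub_eq_add_neg, ← neg_one_smul ℝ (pull _ F)]
    have c1 : Continuous fun x : BlockTorus n r m => f (blockMap x).1 :=
      hf.comp (continuous_fst.comp continuous_blockMap)
    have c2 : Continuous fun x : BlockTorus n r m => f (blockMap x).2 :=
      hf.comp (continuous_snd.comp continuous_blockMap)
    exact (hF.pull c2).add ((hF.pull c1).smul (-1))
  · rintro U hU ⟨s, hs⟩
    exact exists_coboundary_of_section hU s hs continuous_blockMap hf hd hF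

theorem exists_blockClass (hm : ∀ i, 2 ≤ m i) (j : Block n r m) :
    ∃ (A : Cochain (BlockTorus n r m)) (C : ℝ), IsCocycle (blockDim n r m j) A ∧ C ≠ 0 ∧
      Cohom (blockDim n r m j) A
        (C • ∑ j' ∈ sameFactor n r m j, blockAngle (blockDim n r m) j') ∧
      ∀ U : Set ((CP n × ∀ i, Sph (m i)) × (CP n × ∀ i, Sph (m i))), IsOpen U →
        (∃ s : C(U, C(unitInterval, CP n × ∀ i, Sph (m i))),
          ∀ u : U, (s u 0, s u 1) = (u : (CP n × ∀ i, Sph (m i)) × (CP n × ∀ i, Sph (m i)))) →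
        ∃ G : ℕ → Cochain (BlockTorus n r m), (∀ L, DependsOn (G L) (Iio (blockDim n r m j))) ∧
          ∀ p, blockMap p ∈ U → ∀ᶠ O in (𝓝 p).smallSets, ∀ᶠ L in Filter.atTop,
            ∀ x : ℕ → BlockTorus n r m, (∀ k, x k ∈ O) →
              A x = coboundary (blockDim n r m j) (G L) x := by
  have hpi : (2 * Real.pi)⁻¹ ≠ 0 := inv_ne_zero Real.two_pi_pos.ne'
  have key (i : Fin r) := exists_blockClass_aux (n := n) (m := m)
    (show m i ≠ 0 by have := hm i; omega)
    ((continuous_apply i).comp continuous_snd) (isCocycle_sphereClass (m i))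
    (neg_ne_zero.mpr (pow_ne_zero (m i) hpi)) (cohom_sph (by have := hm i; omega))
  rcases j with j | j | j
  · exact exists_blockClass_aux (n := n) (m := m) two_ne_zero continuous_fst
      isCocycle_cpClass (neg_ne_zero.mpr hpi) cohom_cp
  · exact key j
  · exact key j.1

theorem blockDim_ne_zero (hm : ∀ i, 2 ≤ m i) (j : Block n r m) : blockDim n r m j ≠ 0 := by
  rcases j with j | j | j
  · exact two_ne_zero
  · have := hm j
    simp only [blockDim, Sum.elim_inr, Sum.elim_inl]
    omega
  · have := hm j.1
    simp only [blockDim, Sum.elim_inr]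
    omega

theorem card_block : Fintype.card (Block n r m) =
    r + (Finset.univ.filter fun i => Even (m i)).card + 2 * n := by
  rw [Fintype.card_sum, Fintype.card_sum, Fintype.card_prod, Fintype.card_subtype]
  simp only [Fintype.card_fin]
  omega

theorem lt_of_hasEqMPCover (hm : ∀ i, 2 ≤ m i)
    {τ : (CP n × ∀ i : Fin r, Sph (m i)) → CP n × ∀ i : Fin r, Sph (m i)} {k : ℕ}
    (h : HasEqMPCover τ k) :
    r + (Finset.univ.filter fun i => Even (m i)).card + 2 * n < k := by
  by_contra! hk
  rw [← card_block] at hk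
  obtain ⟨U, hU, hcov, -, hsec⟩ := h
  have hmem (p : BlockTorus n r m) : ∃ i, blockMap p ∈ U i := by
    have := mem_univ (blockMap p)
    rwa [← hcov, mem_iUnion] at this
  have hpos : Nonempty (Fin k) := ⟨(hmem 1).choose⟩
  obtain ⟨e⟩ := Function.Embedding.nonempty_of_card_le
    (α := Fin k) (β := Block n r m) (by rwa [Fintype.card_fin])
  have he := Function.invFun_surjective e.injective
  choose A C hA hC hcoh hG using exists_blockClass (n := n) (m := m) hm
  choose G hGd hGA using fun j => hG j (U (Function.invFun e j)) (hU _)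
    (by obtain ⟨s, hs, -⟩ := hsec (Function.invFun e j); exact ⟨s, hs⟩)
  refine false_of_torus_cover (blockDim n r m) A C (sameFactor n r m) hA hC hcoh
    (mem_sameFactor n r m) (fun j j' hj' => blockDim_of_mem_sameFactor n r m hj') G hGd
    (blockDim_ne_zero hm) fun p => ?_
  obtain ⟨i, hi⟩ := hmem p
  obtain ⟨j, rfl⟩ := he i
  exact ⟨j, hGA j p hi⟩

end LowerBoundMain

section UpperBound

/-- A family of paths `P u : ℝ → X`, depending continuously and equivariantly on the pair `u` of
end points in the invariant open set `U`. -/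
structure IsEqPlanner {X : Type*} [TopologicalSpace X] (τ : X → X) (U : Set (X × X))
    (P : X × X → ℝ → X) : Prop where
  isOpen : IsOpen U
  mapsTo : ∀ u ∈ U, Prod.map τ τ u ∈ U
  continuousOn : ContinuousOn (fun q : (X × X) × ℝ => P q.1 q.2) (U ×ˢ Icc 0 1)
  zero : ∀ u ∈ U, P u 0 = u.1
  one : ∀ u ∈ U, P u 1 = u.2
  equivariant : ∀ u ∈ U, ∀ s ∈ Icc (0 : ℝ) 1, P (Prod.map τ τ u) s = τ (P u s)

theorem IsEqPlanner.prod {X Y : Type*} [TopologicalSpace X] [TopologicalSpace Y] {τ : X → X}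
    {σ : Y → Y} {U : Set (X × X)} {V : Set (Y × Y)} {P : X × X → ℝ → X} {Q : Y × Y → ℝ → Y}
    (hP : IsEqPlanner τ U P) (hQ : IsEqPlanner σ V Q) :
    IsEqPlanner (fun z : X × Y => (τ z.1, σ z.2))
      {u | (u.1.1, u.2.1) ∈ U ∧ (u.1.2, u.2.2) ∈ V}
      (fun u s => (P (u.1.1, u.2.1) s, Q (u.1.2, u.2.2) s)) where
  isOpen := (hP.isOpen.preimage (by fun_prop)).inter (hQ.isOpen.preimage (by fun_prop))
  mapsTo u hu := ⟨hP.mapsTo _ hu.1, hQ.mapsTo _ hu.2⟩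
  continuousOn :=
    (hP.continuousOn.comp (f := fun q : ((X × Y) × X × Y) × ℝ => ((q.1.1.1, q.1.2.1), q.2))
      (Continuous.continuousOn (by fun_prop)) fun _ hq => ⟨hq.1.1, hq.2⟩).prodMk
    (hQ.continuousOn.comp (f := fun q : ((X × Y) × X × Y) × ℝ => ((q.1.1.2, q.1.2.2), q.2))
      (Continuous.continuousOn (by fun_prop)) fun _ hq => ⟨hq.1.2, hq.2⟩)
  zero u hu := Prod.ext (hP.zero _ hu.1) (hQ.zero _ hu.2)
  one u hu := Prod.ext (hP.one _ hu.1) (hQ.one _ hu.2)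
  equivariant u hu s hs := Prod.ext (hP.equivariant _ hu.1 s hs) (hQ.equivariant _ hu.2 s hs)

theorem IsEqPlanner.pi {ι : Type*} [Finite ι] {X : ι → Type*} [∀ i, TopologicalSpace (X i)]
    {τ : ∀ i, X i → X i} {U : ∀ i, Set (X i × X i)} {P : ∀ i, X i × X i → ℝ → X i}
    (h : ∀ i, IsEqPlanner (τ i) (U i) (P i)) :
    IsEqPlanner (fun (x : ∀ i, X i) i => τ i (x i)) {u | ∀ i, (u.1 i, u.2 i) ∈ U i}
      (fun u s i => P i (u.1 i, u.2 i) s) where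
  isOpen := by
    rw [Set.ofPred_forall]
    exact isOpen_iInter_of_finite fun i => (h i).isOpen.preimage (by fun_prop)
  mapsTo u hu i := (h i).mapsTo _ (hu i)
  continuousOn := continuousOn_pi.mpr fun i =>
    (h i).continuousOn.comp (f := fun q : ((∀ i, X i) × ∀ i, X i) × ℝ => ((q.1.1 i, q.1.2 i), q.2))
      (Continuous.continuousOn (by fun_prop)) fun _ hq => ⟨hq.1 i, hq.2⟩
  zero u hu := funext fun i => (h i).zero _ (hu i)
  one u hu := funext fun i => (h i).one _ (hu i)
  equivariant u hu s hs := funext fun i => (h i).equivariant _ (hu i) s hs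

theorem hasEqMPCover_of_isEqPlanner {X : Type*} [TopologicalSpace X] {τ : X → X}
    (hτ : Function.Involutive τ) {k : ℕ} {U : Fin k → Set (X × X)} {P : Fin k → X × X → ℝ → X}
    (h : ∀ i, IsEqPlanner τ (U i) (P i)) (hcov : ∀ u, ∃ i, u ∈ U i) : HasEqMPCover τ k := by
  refine ⟨U, fun i => (h i).isOpen, eq_univ_of_forall fun u => mem_iUnion.mpr (hcov u),
    fun i => ?_, fun i => ?_⟩
  · refine Subset.antisymm (image_subset_iff.mpr (h i).mapsTo) fun u hu =>
      ⟨_, (h i).mapsTo u hu, ?_⟩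
    exact Prod.ext (hτ _) (hτ _)
  · have hc : Continuous fun q : U i × unitInterval => P i q.1.1 q.2.1 :=
      (h i).continuousOn.comp_continuous (f := fun q : U i × unitInterval => (q.1.1, q.2.1))
        (by fun_prop) fun q => ⟨q.1.2, q.2.2⟩
    refine ⟨ContinuousMap.curry ⟨_, hc⟩, fun u => ?_, fun u hu t => ?_⟩
    · exact Prod.ext ((h i).zero _ u.2) ((h i).one _ u.2)
    · exact (h i).equivariant _ u.2 _ t.2

section Projective

variable {n : ℕ}

/-- The point of projective space spanned by a vector, with a junk value at zero. -/
noncomputable def cpMk' (v : Fin (n + 1) → ℂ) : CP n :=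
  if h : v ≠ 0 then cpMk ⟨v, h⟩ else cpMk ⟨1, one_ne_zero⟩

theorem cpMk'_of_ne {v : Fin (n + 1) → ℂ} (h : v ≠ 0) : cpMk' v = cpMk ⟨v, h⟩ := dif_pos h

theorem continuousOn_cpMk' : ContinuousOn (cpMk' (n := n)) {v | v ≠ 0} := by
  rw [continuousOn_iff_continuous_domRestrict]
  have e : domRestrict {v | v ≠ 0} (cpMk' (n := n)) = cpMk := funext fun v => cpMk'_of_ne v.2
  rw [e]
  exact continuous_cpMk

theorem cpConj_cpMk' {v : Fin (n + 1) → ℂ} (h : v ≠ 0) :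
    cpConj n (cpMk' v) = cpMk' (fun i => starRingEnd ℂ (v i)) := by
  have h' : (fun i => starRingEnd ℂ (v i)) ≠ 0 := fun h0 => h (by
    funext i
    simpa using congrFun h0 i)
  rw [cpMk'_of_ne h, cpMk'_of_ne h']
  rfl

theorem involutive_cpConj : Function.Involutive (cpConj n) := by
  intro z
  obtain ⟨v, rfl⟩ := cpMk_surjective z
  refine congrArg cpMk (Subtype.ext ?_)
  funext i
  exact Complex.conj_conj _

/-- Evaluation at `t` of the polynomial with given coefficients. -/
noncomputable def powForm (n : ℕ) (t : ℝ) : (Fin (n + 1) → ℂ) →ₗ[ℂ] ℂ :=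
  ∑ i : Fin (n + 1), (t : ℂ) ^ (i : ℕ) • LinearMap.proj i

theorem powForm_apply (t : ℝ) (v : Fin (n + 1) → ℂ) :
    powForm n t v = ∑ i : Fin (n + 1), (t : ℂ) ^ (i : ℕ) * v i := by
  simp [powForm, LinearMap.sum_apply]

theorem powForm_conj (t : ℝ) (v : Fin (n + 1) → ℂ) :
    powForm n t (fun i => starRingEnd ℂ (v i)) = starRingEnd ℂ (powForm n t v) := by
  simp [powForm_apply]

theorem cpLift_cpConj (t : ℝ) (z : CP n) :
    cpLift (powForm n t) (cpConj n z) = fun i => starRingEnd ℂ (cpLift (powForm n t) z i) := by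
  obtain ⟨v, rfl⟩ := cpMk_surjective z
  have h : cpConj n (cpMk v) = cpMk ⟨fun i => starRingEnd ℂ (v.1 i), fun h0 => v.2 (by
    funext i
    simpa using congrFun h0 i)⟩ := rfl
  rw [h, cpLift_cpMk, cpLift_cpMk, powForm_conj]
  funext i
  simp

theorem isEqPlanner_cp (t : ℝ) : IsEqPlanner (cpConj n)
    (cpNonvanishing (powForm n t) ×ˢ cpNonvanishing (powForm n t))
    (fun u s => cpMk' (((1 - s : ℝ) : ℂ) • cpLift (powForm n t) u.1 +
      (s : ℂ) • cpLift (powForm n t) u.2)) := by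
  have hne : ∀ u ∈ cpNonvanishing (powForm n t) ×ˢ cpNonvanishing (powForm n t), ∀ s : ℝ,
      ((1 - s : ℝ) : ℂ) • cpLift (powForm n t) u.1 + (s : ℂ) • cpLift (powForm n t) u.2 ≠ 0 := by
    intro u hu s h
    have := congrArg (powForm n t) h
    rw [map_add, map_smul, map_smul, map_cpLift hu.1, map_cpLift hu.2, map_zero] at this
    simp at this
  have hmem : ∀ z ∈ cpNonvanishing (powForm n t), cpConj n z ∈ cpNonvanishing (powForm n t) := by
    intro z hz h
    refine hz ?_
    rw [cpLift_cpConj] at h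
    funext i
    simpa using congrFun h i
  refine ⟨(isOpen_cpNonvanishing _).prod (isOpen_cpNonvanishing _), fun u hu =>
    ⟨hmem _ hu.1, hmem _ hu.2⟩, ?_, fun u hu => ?_, fun u hu => ?_, fun u hu s _ => ?_⟩
  · refine continuousOn_cpMk'.comp ?_ fun q hq => hne _ hq.1 _
    have h1 := (continuousOn_cpLift (powForm n t)).comp
      (f := fun q : (CP n × CP n) × ℝ => q.1.1)
      (s := (cpNonvanishing (powForm n t) ×ˢ cpNonvanishing (powForm n t)) ×ˢ Icc 0 1)
      (Continuous.continuousOn (by fun_prop)) fun q hq => hq.1.1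
    have h2 := (continuousOn_cpLift (powForm n t)).comp
      (f := fun q : (CP n × CP n) × ℝ => q.1.2)
      (s := (cpNonvanishing (powForm n t) ×ˢ cpNonvanishing (powForm n t)) ×ˢ Icc 0 1)
      (Continuous.continuousOn (by fun_prop)) fun q hq => hq.1.2
    have c1 : ContinuousOn (fun q : (CP n × CP n) × ℝ => ((1 - q.2 : ℝ) : ℂ))
        ((cpNonvanishing (powForm n t) ×ˢ cpNonvanishing (powForm n t)) ×ˢ Icc 0 1) :=
      Continuous.continuousOn (by fun_prop)
    have c2 : ContinuousOn (fun q : (CP n × CP n) × ℝ => (q.2 : ℂ))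
        ((cpNonvanishing (powForm n t) ×ˢ cpNonvanishing (powForm n t)) ×ˢ Icc 0 1) :=
      Continuous.continuousOn (by fun_prop)
    exact (c1.smul h1).add (c2.smul h2)
  · simp only [sub_zero, Complex.ofReal_one, one_smul, Complex.ofReal_zero, zero_smul, add_zero]
    rw [cpMk'_of_ne hu.1]
    exact cpLift_ne_zero_cpMk _
  · simp only [sub_self, Complex.ofReal_one, one_smul, Complex.ofReal_zero, zero_smul, zero_add]
    rw [cpMk'_of_ne hu.2]
    exact cpLift_ne_zero_cpMk _
  · rw [cpConj_cpMk' (hne u hu s)]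
    congr 1
    funext i
    simp [cpLift_cpConj]

theorem card_notMem_cpNonvanishing (s : Finset ℕ) (z : CP n)
    (hs : ∀ t ∈ s, z ∉ cpNonvanishing (powForm n (t : ℝ))) : s.card ≤ n := by
  by_contra! h
  obtain ⟨v, rfl⟩ := cpMk_surjective z
  obtain ⟨s', hs', hc⟩ := Finset.exists_subset_card_eq (Nat.succ_le_of_lt h)
  refine v.2 (Matrix.eq_zero_of_forall_index_sum_pow_mul_eq_zero
    (f := fun i => ((s'.orderEmbOfFin hc i : ℕ) : ℂ)) ?_ fun i => ?_)
  · exact Nat.cast_injective.comp (s'.orderEmbOfFin hc).injective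
  · have := hs _ (hs' (s'.orderEmbOfFin_mem hc i))
    rw [cpMk_mem_cpNonvanishing, not_not, powForm_apply] at this
    simpa using this

end Projective

end UpperBound

section Spheres

variable {m : ℕ}

/-- The direction of a vector, with a junk value at zero. -/
noncomputable def sphMk (v : EuclideanSpace ℝ (Fin (m + 1))) : Sph m :=
  if h : v ≠ 0 then ⟨‖v‖⁻¹ • v, by simp [norm_smul, h]⟩ else
    ⟨EuclideanSpace.single 0 1, by simp⟩

theorem sphMk_coe {v : EuclideanSpace ℝ (Fin (m + 1))} (h : v ≠ 0) :
    (sphMk v : EuclideanSpace ℝ (Fin (m + 1))) = ‖v‖⁻¹ • v := by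
  simp [sphMk, h]

theorem sph_norm (x : Sph m) : ‖(x : EuclideanSpace ℝ (Fin (m + 1)))‖ = 1 :=
  mem_sphere_zero_iff_norm.mp x.2

theorem sph_ne_zero (x : Sph m) : (x : EuclideanSpace ℝ (Fin (m + 1))) ≠ 0 := by
  rw [← norm_ne_zero_iff, sph_norm]
  exact one_ne_zero

theorem sphMk_self (x : Sph m) : sphMk (x : EuclideanSpace ℝ (Fin (m + 1))) = x := by
  refine Subtype.ext ?_
  rw [sphMk_coe (sph_ne_zero x), sph_norm, inv_one, one_smul]

theorem continuousOn_sphMk : ContinuousOn (sphMk (m := m)) {v | v ≠ 0} := by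
  rw [Topology.IsInducing.subtypeVal.continuousOn_iff]
  refine ContinuousOn.congr (f := fun v : EuclideanSpace ℝ (Fin (m + 1)) => ‖v‖⁻¹ • v) ?_
    fun v hv => sphMk_coe hv
  exact (continuous_norm.continuousOn.inv₀ fun v hv => norm_ne_zero_iff.mpr hv).smul
    continuousOn_id

theorem sphMk_neg {v : EuclideanSpace ℝ (Fin (m + 1))} (h : v ≠ 0) :
    sphMk (-v) = negSph m (sphMk v) := by
  refine Subtype.ext ?_
  rw [sphMk_coe (neg_ne_zero.mpr h)]
  simp only [negSph, sphMk_coe h, norm_neg, smul_neg]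

theorem involutive_negSph : Function.Involutive (negSph m) := fun x =>
  Subtype.ext (neg_neg (x : EuclideanSpace ℝ (Fin (m + 1))))

/-- The path of vectors from `x` through `A x` to `y`. -/
noncomputable def sphPath
    (A : EuclideanSpace ℝ (Fin (m + 1)) →ₗ[ℝ] EuclideanSpace ℝ (Fin (m + 1)))
    (u : Sph m × Sph m) (s : ℝ) : EuclideanSpace ℝ (Fin (m + 1)) :=
  max (1 - 2 * s) 0 • (u.1 : EuclideanSpace ℝ (Fin (m + 1))) + min (2 * s) (2 - 2 * s) • A u.1 +
    max (2 * s - 1) 0 • (u.2 : EuclideanSpace ℝ (Fin (m + 1)))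

theorem isEqPlanner_sph
    {A : EuclideanSpace ℝ (Fin (m + 1)) →ₗ[ℝ] EuclideanSpace ℝ (Fin (m + 1))}
    (hA : ∀ x : Sph m, inner ℝ (x : EuclideanSpace ℝ (Fin (m + 1))) (A x) = 1) :
    IsEqPlanner (negSph m)
      {u | ‖A u.1‖ • (u.2 : EuclideanSpace ℝ (Fin (m + 1))) + A u.1 ≠ 0}
      (fun u s => sphMk (sphPath A u s)) := by
  have cA : Continuous A := A.continuous_of_finiteDimensional
  have hne : ∀ u : Sph m × Sph m, ‖A u.1‖ • (u.2 : EuclideanSpace ℝ (Fin (m + 1))) + A u.1 ≠ 0 →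
      ∀ s ∈ Icc (0 : ℝ) 1, sphPath A u s ≠ 0 := by
    intro u hu s hs h0
    simp only [sphPath] at h0
    rcases le_total (2 * s) 1 with h | h
    · rw [max_eq_left (by linarith), min_eq_left (by linarith), max_eq_right (by linarith),
        zero_smul, add_zero] at h0
      have := congrArg (inner ℝ (u.1 : EuclideanSpace ℝ (Fin (m + 1)))) h0
      rw [inner_add_right, inner_smul_right, inner_smul_right, hA, inner_zero_right,
        real_inner_self_eq_norm_sq, sph_norm] at this
      linarith
    · rw [max_eq_right (by linarith), min_eq_right (by linarith), max_eq_left (by linarith),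
        zero_smul, zero_add, add_eq_zero_iff_eq_neg] at h0
      have hn := congrArg norm h0
      rw [norm_neg, norm_smul, norm_smul, sph_norm, Real.norm_of_nonneg (by linarith [hs.2]),
        Real.norm_of_nonneg (by linarith)] at hn
      have h1 : (2 - 2 * s) • (‖A u.1‖ • (u.2 : EuclideanSpace ℝ (Fin (m + 1))) + A u.1) = 0 := by
        rw [smul_add, h0, smul_smul, hn, mul_one, add_neg_cancel]
      rcases smul_eq_zero.mp h1 with h2 | h2
      · rw [h2] at hn
        linarith
      · exact hu h2
  have hneg : ∀ u s, sphPath A (Prod.map (negSph m) (negSph m) u) s = -sphPath A u s := by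
    intro u s
    simp only [sphPath, Prod.map_fst, Prod.map_snd, negSph, map_neg, smul_neg]
    abel
  refine ⟨?_, ?_, ?_, fun u _ => ?_, fun u _ => ?_, fun u hu s hs => ?_⟩
  · exact isOpen_ne.preimage (f := fun u : Sph m × Sph m =>
      ‖A u.1‖ • (u.2 : EuclideanSpace ℝ (Fin (m + 1))) + A u.1) (by fun_prop)
  · intro u hu h
    refine hu ?_
    simp only [Prod.map_fst, Prod.map_snd, negSph, map_neg, norm_neg, smul_neg] at h
    rwa [← neg_add, neg_eq_zero] at h
  · refine continuousOn_sphMk.comp (Continuous.continuousOn ?_) fun q hq => hne _ hq.1 _ hq.2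
    unfold sphPath
    fun_prop
  · simp [sphPath, sphMk_self]
  · have : sphPath A u 1 = u.2 := by
      norm_num [sphPath]
    rw [this, sphMk_self]
  · rw [hneg, sphMk_neg (hne u hu s hs)]

/-- The skew-symmetric matrix pairing the coordinates `i` and `i + 1` for `i ≡ p` modulo two. -/
def pairing (m p : ℕ) : Matrix (Fin (m + 1)) (Fin (m + 1)) ℝ := fun i j =>
  if (j : ℕ) = i + 1 ∧ (i : ℕ) % 2 = p then 1 else
    if (i : ℕ) = j + 1 ∧ (j : ℕ) % 2 = p then -1 else 0

theorem pairing_swap (p : ℕ) (i j : Fin (m + 1)) : pairing m p i j = -pairing m p j i := by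
  simp only [pairing]
  split_ifs <;> first | omega | norm_num

theorem inner_pairing (p : ℕ) (x : EuclideanSpace ℝ (Fin (m + 1))) :
    inner ℝ x (Matrix.toEuclideanLin (pairing m p) x) = 0 := by
  have e : inner ℝ x (Matrix.toEuclideanLin (pairing m p) x) =
      ∑ i, ∑ j, pairing m p i j * (x i * x j) := by
    simp only [PiLp.inner_apply, Matrix.toLpLin_apply, Matrix.mulVec, dotProduct, Finset.sum_mul,
      RCLike.inner_apply, conj_trivial]
    refine Finset.sum_congr rfl fun i _ => Finset.sum_congr rfl fun j _ => ?_
    ring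
  have h : ∑ i, ∑ j, pairing m p i j * (x i * x j) =
      -∑ i, ∑ j, pairing m p i j * (x i * x j) := by
    conv_lhs => rw [Finset.sum_comm]
    rw [← Finset.sum_neg_distrib]
    refine Finset.sum_congr rfl fun i _ => ?_
    rw [← Finset.sum_neg_distrib]
    refine Finset.sum_congr rfl fun j _ => ?_
    rw [pairing_swap]
    ring
  rw [e]
  linarith

theorem apply_eq_zero_of_pairing {p : ℕ} {x : EuclideanSpace ℝ (Fin (m + 1))}
    (h : Matrix.toEuclideanLin (pairing m p) x = 0) {i j : Fin (m + 1)} (hij : (j : ℕ) = i + 1)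
    (hi : (i : ℕ) % 2 = p) : x i = 0 ∧ x j = 0 := by
  have h' : ∀ a, ∑ b, pairing m p a b * x b = 0 := fun a =>
    congrArg (fun v : EuclideanSpace ℝ (Fin (m + 1)) => v a) h
  constructor
  · have := h' j
    rw [Finset.sum_eq_single i] at this
    · have hji : pairing m p j i = -1 := by
        rw [pairing_swap]
        simp [pairing, hij, hi]
      simpa [hji] using this
    · intro b _ hb
      have hb' : (b : ℕ) ≠ i := fun h => hb (Fin.ext h)
      have : pairing m p j b = 0 := by
        simp only [pairing]
        split_ifs <;> first | omega | rfl
      rw [this, zero_mul]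
    · simp
  · have := h' i
    rw [Finset.sum_eq_single j] at this
    · simpa [pairing, hij, hi] using this
    · intro b _ hb
      have hb' : (b : ℕ) ≠ j := fun h => hb (Fin.ext h)
      have : pairing m p i b = 0 := by
        simp only [pairing]
        split_ifs <;> first | omega | rfl
      rw [this, zero_mul]
    · simp

/-- A family of perturbations of the identity by skew-symmetric matrices, linear in `t` in odd
dimensions and quadratic in even dimensions. -/
noncomputable def skewFamily (m : ℕ) (t : ℝ) :
    EuclideanSpace ℝ (Fin (m + 1)) →ₗ[ℝ] EuclideanSpace ℝ (Fin (m + 1)) :=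
  LinearMap.id + t • Matrix.toEuclideanLin (pairing m 0) +
    (if Even m then t ^ 2 else 0) • Matrix.toEuclideanLin (pairing m 1)

theorem inner_skewFamily (t : ℝ) (x : Sph m) :
    inner ℝ (x : EuclideanSpace ℝ (Fin (m + 1))) (skewFamily m t x) = 1 := by
  simp only [skewFamily, LinearMap.add_apply, LinearMap.smul_apply, LinearMap.id_apply,
    inner_add_right, inner_smul_right, inner_pairing, mul_zero, add_zero]
  rw [real_inner_self_eq_norm_sq, sph_norm, one_pow]

theorem eq_of_smul_add_eq_zero {E : Type*} [NormedAddCommGroup E] [InnerProductSpace ℝ E]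
    {x y a b : E} (ha : inner ℝ x a = 1) (hb : inner ℝ x b = 1)
    (ha' : ‖a‖ • y + a = 0) (hb' : ‖b‖ • y + b = 0) : a = b := by
  have ea := congrArg (inner ℝ x) ha'
  have eb := congrArg (inner ℝ x) hb'
  rw [inner_add_right, inner_smul_right, inner_zero_right, ha] at ea
  rw [inner_add_right, inner_smul_right, inner_zero_right, hb] at eb
  have hxy : inner ℝ x y ≠ 0 := fun h => by
    rw [h] at ea
    norm_num at ea
  have : ‖a‖ = ‖b‖ := mul_right_cancel₀ hxy (by linarith)
  rw [add_eq_zero_iff_neg_eq] at ha' hb'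
  rw [← ha', ← hb', this]

theorem card_bad_skewFamily (hm : m ≠ 0) (s : Finset ℕ) (x y : Sph m)
    (hs : ∀ t ∈ s, ‖skewFamily m t x‖ • (y : EuclideanSpace ℝ (Fin (m + 1))) +
      skewFamily m t x = 0) : s.card ≤ if Even m then 2 else 1 := by
  have heq : ∀ a ∈ s, ∀ b ∈ s, skewFamily m a x = skewFamily m b x := fun a ha b hb =>
    eq_of_smul_add_eq_zero (inner_skewFamily _ x) (inner_skewFamily _ x) (hs a ha) (hs b hb)
  set J := Matrix.toEuclideanLin (pairing m 0) (x : EuclideanSpace ℝ (Fin (m + 1))) with hJ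
  set K := Matrix.toEuclideanLin (pairing m 1) (x : EuclideanSpace ℝ (Fin (m + 1))) with hK
  split_ifs with h
  · by_contra! hlt
    obtain ⟨a, ha, b, hb, c, hc, hab, hac, hbc⟩ := Finset.two_lt_card.mp hlt
    have key : ∀ a ∈ s, ∀ b ∈ s, a ≠ b → J + ((a : ℝ) + b) • K = 0 := by
      intro a ha b hb hab
      have h1 := heq a ha b hb
      simp only [skewFamily, h, if_true, LinearMap.add_apply, LinearMap.smul_apply,
        LinearMap.id_apply, ← hJ, ← hK] at h1
      have hab' : ((a : ℝ) - b) ≠ 0 := sub_ne_zero.mpr (Nat.cast_injective.ne hab)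
      refine (smul_eq_zero.mp (?_ : ((a : ℝ) - b) • (J + ((a : ℝ) + b) • K) = 0)).resolve_left hab'
      rw [← sub_eq_zero] at h1
      rw [← h1]
      module
    have h1 := key a ha b hb hab
    have h2 := key a ha c hc hac
    have hK0 : K = 0 := by
      have hbc' : ((b : ℝ) - c) ≠ 0 := sub_ne_zero.mpr (Nat.cast_injective.ne hbc)
      refine (smul_eq_zero.mp (?_ : ((b : ℝ) - c) • K = 0)).resolve_left hbc'
      rw [← sub_self (0 : EuclideanSpace ℝ (Fin (m + 1)))]
      nth_rw 1 [← h1]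
      rw [← h2]
      module
    have hJ0 : J = 0 := by simpa [hK0] using h1
    refine sph_ne_zero x ?_
    ext i
    rcases Nat.even_or_odd' i with ⟨l, hl | hl⟩
    · by_cases hi : (i : ℕ) < m
      · exact (apply_eq_zero_of_pairing hJ0 (i := i) (j := ⟨i + 1, by omega⟩) rfl (by omega)).1
      · exact (apply_eq_zero_of_pairing hK0 (i := ⟨i - 1, by omega⟩) (j := i)
          (by simp only; omega) (by simp only; omega)).2
    · exact (apply_eq_zero_of_pairing hJ0 (i := ⟨i - 1, by omega⟩) (j := i)
        (by simp only; omega) (by simp only; omega)).2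
  · by_contra! hlt
    obtain ⟨a, ha, b, hb, hab⟩ := Finset.one_lt_card.mp hlt
    have hJ0 : J = 0 := by
      have h1 := heq a ha b hb
      simp only [skewFamily, h, if_false, LinearMap.add_apply, LinearMap.smul_apply,
        LinearMap.id_apply, ← hJ, ← hK] at h1
      have hab' : ((a : ℝ) - b) ≠ 0 := sub_ne_zero.mpr (Nat.cast_injective.ne hab)
      refine (smul_eq_zero.mp (?_ : ((a : ℝ) - b) • J = 0)).resolve_left hab'
      rw [← sub_eq_zero] at h1
      rw [← h1]
      module
    rw [Nat.not_even_iff_odd] at h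
    obtain ⟨q, hq⟩ := h
    refine sph_ne_zero x ?_
    ext i
    rcases Nat.even_or_odd' i with ⟨l, hl | hl⟩
    · exact (apply_eq_zero_of_pairing hJ0 (i := i) (j := ⟨i + 1, by omega⟩) rfl (by omega)).1
    · exact (apply_eq_zero_of_pairing hJ0 (i := ⟨i - 1, by omega⟩) (j := i)
        (by simp only; omega) (by simp only; omega)).2

end Spheres

theorem hasEqMPCover_cp_spheres (n r : ℕ) (m : Fin r → ℕ) (hm : ∀ i, m i ≠ 0) :
    HasEqMPCover (fun z : CP n × (∀ i : Fin r, Sph (m i)) =>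
        (cpConj n z.1, fun i => negSph (m i) (z.2 i)))
      (r + (Finset.univ.filter fun i => Even (m i)).card + 2 * n + 1) := by
  classical
  refine hasEqMPCover_of_isEqPlanner ?_
    (fun t => (isEqPlanner_cp (n := n) (((t : ℕ) : ℝ))).prod
      (IsEqPlanner.pi fun i => isEqPlanner_sph (inner_skewFamily (m := m i) ((t : ℕ) : ℝ))))
    fun u => ?_
  · intro z
    exact Prod.ext (involutive_cpConj _) (funext fun i => involutive_negSph _)
  · by_contra! hbad
    set N := r + (Finset.univ.filter fun i => Even (m i)).card + 2 * n with hN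
    let B (Q : ℕ → Prop) : Finset ℕ := (Finset.range (N + 1)).filter Q
    let Q1 : ℕ → Prop := fun t => u.1.1 ∉ cpNonvanishing (powForm n (t : ℝ))
    let Q2 : ℕ → Prop := fun t => u.2.1 ∉ cpNonvanishing (powForm n (t : ℝ))
    let Q3 (i : Fin r) : ℕ → Prop := fun t => ‖skewFamily (m i) t (u.1.2 i)‖ •
      (u.2.2 i : EuclideanSpace ℝ (Fin (m i + 1))) + skewFamily (m i) t (u.1.2 i) = 0
    have hB : ∀ Q, ∀ t ∈ B Q, Q t := fun Q t ht => (Finset.mem_filter.mp ht).2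
    have h1 : (B Q1).card ≤ n := card_notMem_cpNonvanishing _ u.1.1 (hB Q1)
    have h2 : (B Q2).card ≤ n := card_notMem_cpNonvanishing _ u.2.1 (hB Q2)
    have h3 : ∀ i, (B (Q3 i)).card ≤ if Even (m i) then 2 else 1 := fun i =>
      card_bad_skewFamily (hm i) _ (u.1.2 i) (u.2.2 i) (hB (Q3 i))
    have hsub : Finset.range (N + 1) ⊆
        (B Q1 ∪ B Q2) ∪ Finset.univ.biUnion fun i => B (Q3 i) := by
      intro t ht
      by_contra hn
      simp only [Finset.mem_union, Finset.mem_biUnion, Finset.mem_univ, true_and, not_or,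
        not_exists, B, Finset.mem_filter, ht, Q1, Q2, Q3, not_not] at hn
      exact hbad ⟨t, Finset.mem_range.mp ht⟩ ⟨⟨hn.1.1, hn.1.2⟩, hn.2⟩
    have hsum : ∑ i, (if Even (m i) then 2 else 1) =
        r + (Finset.univ.filter fun i => Even (m i)).card := by
      rw [Finset.card_filter]
      calc ∑ i, (if Even (m i) then 2 else 1) = ∑ i, (1 + if Even (m i) then 1 else 0) :=
            Finset.sum_congr rfl fun i _ => by split_ifs <;> rfl
        _ = _ := by rw [Finset.sum_add_distrib]; simp
    have hle := (Finset.card_le_card hsub).trans (Finset.card_union_le _ _)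
    have hle1 := Finset.card_union_le (B Q1) (B Q2)
    have hle2 := (Finset.card_biUnion_le (s := Finset.univ) (t := fun i => B (Q3 i))).trans
      (Finset.sum_le_sum fun i _ => h3 i)
    rw [hsum] at hle2
    rw [Finset.card_range] at hle
    omega

/-- **Example 6.5.**  Let `n_1, …, n_r ≥ 2`, and let `ℤ/2` act on
`ℂP^n × S^{n_1} × ⋯ × S^{n_r}` by complex conjugation on `ℂP^n` and the antipodal map
on each sphere factor.  Then `TC_{ℤ/2}(ℂP^n × S^{n_1} × ⋯ × S^{n_r}) = r + k + 2n + 1`,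
where `k` is the number of indices `i` with `n_i` even. -/
theorem eqtc_cp_spheres (n r : ℕ) (m : Fin r → ℕ) (hm : ∀ i, 2 ≤ m i) :
    eqTC (fun z : CP n × (∀ i : Fin r, Sph (m i)) =>
        (cpConj n z.1, fun i => negSph (m i) (z.2 i))) =
      (r + (Finset.univ.filter fun i => Even (m i)).card + 2 * n + 1 : ℕ) := by
  refine le_antisymm (sInf_le ⟨_, rfl, hasEqMPCover_cp_spheres n r m fun i => ?_⟩) (le_sInf ?_)
  · have := hm i
    omega
  · rintro _ ⟨k, rfl, hk⟩
    exact Nat.cast_le.mpr (lt_of_hasEqMPCover hm hk)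

end Paper
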